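/- Let V₀ be an irreducible germ of real analytic set at 0 ∈ ℂⁿ ≅ ℝ^{2n} of dimension k, represented by a closed real analytic set V of dimension k in an open neighborhood U of 0. Let V* denote the set of points of V near which V is a smooth real submanifold of dimension k. If V* is a complex submanifold of ℂⁿ, then V is a complex variety at 0, i.e. the germ of V at 0 is the germ of a complex analytic set. -/

import Mathlib

open MeasureTheory Metric Set

noncomputable section

/-- `V` is a (closed) real analytic set in the open set `U ⊆ ℂⁿ ≅ ℝ^{2n}`:
the common zero set in `U` of a family of real analytic functions on `U`. -/
def IsRealAnalyticSetIn (n : ℕ) (V U : Set (Fin n → ℂ)) : Prop :=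
  ∃ (ι : Type) (g : ι → (Fin n → ℂ) → ℝ),
    (∀ i, AnalyticOnNhd ℝ (g i) U) ∧ V = {x ∈ U | ∀ i, g i x = 0}

/-- Two sets have the same germ at `0`. -/
def GermEqAt0 (n : ℕ) (V W : Set (Fin n → ℂ)) : Prop :=
  ∃ t ∈ nhds (0 : Fin n → ℂ), V ∩ t = W ∩ t

/-- Germ inclusion at `0`. -/
def GermLeAt0 (n : ℕ) (V W : Set (Fin n → ℂ)) : Prop :=
  ∃ t ∈ nhds (0 : Fin n → ℂ), V ∩ t ⊆ W ∩ t

/-- The germ of `V` at `0` is irreducible: it is not the union of two strictly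
smaller germs of real analytic sets. -/
def IrreducibleGermAt0 (n : ℕ) (V : Set (Fin n → ℂ)) : Prop :=
  ¬ ∃ (V₁ U₁ V₂ U₂ : Set (Fin n → ℂ)),
      IsOpen U₁ ∧ (0 : Fin n → ℂ) ∈ U₁ ∧ IsRealAnalyticSetIn n V₁ U₁ ∧
      IsOpen U₂ ∧ (0 : Fin n → ℂ) ∈ U₂ ∧ IsRealAnalyticSetIn n V₂ U₂ ∧
      GermEqAt0 n V (V₁ ∪ V₂) ∧
      (GermLeAt0 n V₁ V ∧ ¬ GermEqAt0 n V₁ V) ∧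
      (GermLeAt0 n V₂ V ∧ ¬ GermEqAt0 n V₂ V)

/-- `x` is a point near which `V` is a smooth real submanifold of `ℂⁿ ≅ ℝ^{2n}` of
real dimension `d` (regular level-set description). -/
def IsSmoothPtOfDim (n : ℕ) (V : Set (Fin n → ℂ)) (d : ℕ) (x : Fin n → ℂ) : Prop :=
  ∃ U : Set (Fin n → ℂ), IsOpen U ∧ x ∈ U ∧
    ∃ F : (Fin n → ℂ) → (Fin (2 * n - d) → ℝ),
      ContDiffOn ℝ (⊤ : ℕ∞) F U ∧
      (∀ y ∈ U, Function.Surjective (fderiv ℝ F y)) ∧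
      V ∩ U = {y ∈ U | F y = 0}

/-- `x` is a point near which `S` is a complex submanifold of `ℂⁿ`
(regular holomorphic level-set description). -/
def IsComplexSubmanifoldPt (n : ℕ) (S : Set (Fin n → ℂ)) (x : Fin n → ℂ) : Prop :=
  ∃ U : Set (Fin n → ℂ), IsOpen U ∧ x ∈ U ∧
    ∃ (m : ℕ) (F : (Fin n → ℂ) → (Fin m → ℂ)),
      DifferentiableOn ℂ F U ∧
      (∀ y ∈ U, Function.Surjective (fderiv ℂ F y)) ∧
      S ∩ U = {y ∈ U | F y = 0}

end

section Part1
open Metric Set Filter Topology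
open scoped ContDiff

namespace DF

theorem param {𝕜 E G : Type*} [RCLike 𝕜] [NormedAddCommGroup E] [NormedSpace 𝕜 E]
    [FiniteDimensional 𝕜 E] [NormedAddCommGroup G] [NormedSpace 𝕜 G] [FiniteDimensional 𝕜 G]
    {n : WithTop ℕ∞} (hn : n ≠ 0) {F : E → G} {y : E} (hF : ContDiffAt 𝕜 n F y)
    (hs : Function.Surjective (fderiv 𝕜 F y)) :
    ∃ (φ : (fderiv 𝕜 F y).ker → E) (π : E → (fderiv 𝕜 F y).ker)
      (p : E →L[𝕜] (fderiv 𝕜 F y).ker), (∀ v : (fderiv 𝕜 F y).ker, p (v : E) = v) ∧ (∀ x, π x = p (x - y)) ∧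
      ContDiffAt 𝕜 n φ 0 ∧ φ 0 = y ∧ (∀ᶠ x in 𝓝 y, F x = F y → φ (π x) = x) ∧
      (∀ᶠ s in 𝓝 (0 : (fderiv 𝕜 F y).ker), F (φ s) = F y ∧ π (φ s) = s) := by
  have : CompleteSpace E := FiniteDimensional.complete 𝕜 E
  have : CompleteSpace G := FiniteDimensional.complete 𝕜 G
  set f' := fderiv 𝕜 F y with hf'
  obtain ⟨p, hp⟩ : f'.ker.ClosedComplemented := Submodule.ClosedComplemented.of_finiteDimensional f'.ker
  have hcompl : IsCompl f'.ker p.ker := by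
    exact LinearMap.isCompl_of_proj hp
  have hprange : p.range = ⊤ := by
    rw [LinearMap.range_eq_top]
    intro v; exact ⟨v, hp v⟩
  let e := f'.equivProdOfSurjectiveOfIsCompl p (LinearMap.range_eq_top.2 hs) hprange hcompl
  let Φ : E → G × f'.ker := fun x => (F x, p (x - y))
  have hΦ : ContDiffAt 𝕜 n Φ y := by
    apply hF.prodMk
    exact (p.contDiff.comp (contDiff_id.sub contDiff_const)).contDiffAt
  have hΦ' : HasFDerivAt Φ (e : E →L[𝕜] G × f'.ker) y := by
    have h1 : HasFDerivAt F f' y := (hF.differentiableAt hn).hasFDerivAt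
    have h2 : HasFDerivAt (fun x => p (x - y)) p y :=
      p.hasFDerivAt.comp y ((hasFDerivAt_id y).sub_const y)
    exact h1.prodMk h2
  let Ψ := hΦ.toOpenPartialHomeomorph Φ hΦ' hn
  have hΨ : (Ψ : E → _) = Φ := rfl
  have hy : y ∈ Ψ.source := hΦ.mem_toOpenPartialHomeomorph_source hΦ' hn
  have hΦy : Φ y = (F y, 0) := by simp [Φ]
  have hty : (F y, (0 : f'.ker)) ∈ Ψ.target := by
    rw [← hΦy]; exact Ψ.map_source hy
  have hinv : Ψ.symm (F y, 0) = y := by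
    rw [← hΦy]; exact Ψ.left_inv hy
  refine ⟨fun s => Ψ.symm (F y, s), fun x => p (x - y), p, hp, fun _ => rfl, ?_, hinv, ?_, ?_⟩
  · have h1 : ContDiffAt 𝕜 n Ψ.symm (F y, 0) := by
      have := hΦ.to_localInverse hΦ' hn
      rw [hΦy] at this
      exact this
    have h2 : ContDiffAt 𝕜 n (fun s : f'.ker => ((F y, s) : G × f'.ker)) 0 := by fun_prop
    exact ContDiffAt.comp (0 : f'.ker) h1 h2
  · filter_upwards [Ψ.open_source.mem_nhds hy] with x hx hFx
    have : Ψ.symm (Φ x) = x := Ψ.left_inv hx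
    simp only [Φ] at this
    rw [hFx] at this; exact this
  · have hc : Continuous (fun s : f'.ker => ((F y, s) : G × f'.ker)) := by fun_prop
    filter_upwards [hc.continuousAt.preimage_mem_nhds (x := 0) (Ψ.open_target.mem_nhds hty)] with s hs
    have : Φ (Ψ.symm (F y, s)) = (F y, s) := Ψ.right_inv hs
    simp only [Φ, Prod.mk.injEq] at this
    exact this

theorem dim_lemma {E G G' : Type*} [NormedAddCommGroup E] [NormedSpace ℝ E]
    [FiniteDimensional ℝ E] [NormedAddCommGroup G] [NormedSpace ℝ G] [FiniteDimensional ℝ G]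
    [NormedAddCommGroup G'] [NormedSpace ℝ G'] [FiniteDimensional ℝ G']
    {F : E → G} {F' : E → G'} {y : E} (hF : ContDiffAt ℝ 1 F y)
    (hs : Function.Surjective (fderiv ℝ F y)) (hF' : ContDiffAt ℝ 1 F' y)
    (hs' : Function.Surjective (fderiv ℝ F' y)) (h0 : F y = 0) (h0' : F' y = 0)
    (hsub : ∀ᶠ x in 𝓝 y, F x = 0 → F' x = 0) :
    Module.finrank ℝ G' ≤ Module.finrank ℝ G ∧
    (Module.finrank ℝ G' = Module.finrank ℝ G → ∀ᶠ x in 𝓝 y, F' x = 0 → F x = 0) := by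
  obtain ⟨φ, π, p, hp, hπ, hφ, hφ0, h1, h2⟩ := param one_ne_zero hF hs
  obtain ⟨φ', π', p', hp', hπ', hφ', hφ0', h1', h2'⟩ := param one_ne_zero hF' hs'
  have hφd : HasFDerivAt φ (fderiv ℝ φ 0) 0 := (hφ.differentiableAt one_ne_zero).hasFDerivAt
  have hcont : ContinuousAt φ 0 := hφ.continuousAt
  have hinj : ∀ v, p (fderiv ℝ φ 0 v) = v := by
    have a1 : HasFDerivAt (fun s => π (φ s)) (p.comp (fderiv ℝ φ 0)) 0 := by
      simp only [hπ]
      exact p.hasFDerivAt.comp 0 (hφd.sub_const y)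
    have a2 : HasFDerivAt (fun s => π (φ s)) (ContinuousLinearMap.id ℝ _) 0 := by
      refine (hasFDerivAt_id _).congr_of_eventuallyEq ?_
      filter_upwards [h2] with s hs using hs.2
    intro v
    exact congrArg (fun L => L v) (a1.unique a2)
  have hker : ∀ v, fderiv ℝ F' y (fderiv ℝ φ 0 v) = 0 := by
    have a1 : HasFDerivAt (fun s => F' (φ s)) ((fderiv ℝ F' y).comp (fderiv ℝ φ 0)) 0 := by
      have : HasFDerivAt F' (fderiv ℝ F' y) (φ 0) := by
        rw [hφ0]; exact (hF'.differentiableAt one_ne_zero).hasFDerivAt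
      exact this.comp 0 hφd
    have a2 : HasFDerivAt (fun s => F' (φ s)) (0 : _ →L[ℝ] G') 0 := by
      refine (hasFDerivAt_const (0 : G') _).congr_of_eventuallyEq ?_
      have := hcont.eventually (p := fun x => F x = 0 → F' x = 0) (by rw [hφ0]; exact hsub)
      filter_upwards [h2, this] with s hs hs2
      exact hs2 (by rw [hs.1, h0])
    intro v
    exact congrArg (fun L => L v) (a1.unique a2)
  have hrk : Module.finrank ℝ G + Module.finrank ℝ (fderiv ℝ F y).ker = Module.finrank ℝ E := by
    have := LinearMap.finrank_range_add_finrank_ker (fderiv ℝ F y : E →ₗ[ℝ] G)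
    rw [LinearMap.range_eq_top.2 hs, finrank_top] at this
    exact this
  have hrk' : Module.finrank ℝ G' + Module.finrank ℝ (fderiv ℝ F' y).ker = Module.finrank ℝ E := by
    have := LinearMap.finrank_range_add_finrank_ker (fderiv ℝ F' y : E →ₗ[ℝ] G')
    rw [LinearMap.range_eq_top.2 hs', finrank_top] at this
    exact this
  let A : (fderiv ℝ F y).ker →ₗ[ℝ] (fderiv ℝ F' y).ker :=
    LinearMap.codRestrict _ (fderiv ℝ φ 0 : _ →ₗ[ℝ] E) hker
  have hA : Function.Injective A := by
    intro v w hvw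
    have : fderiv ℝ φ 0 v = fderiv ℝ φ 0 w := congrArg Subtype.val hvw
    rw [← hinj v, ← hinj w, this]
  have hle := LinearMap.finrank_le_finrank_of_injective hA
  refine ⟨by omega, fun heq => ?_⟩
  have hbij : Function.Bijective A := by
    refine ⟨hA, ?_⟩
    exact (LinearMap.injective_iff_surjective_of_finrank_eq_finrank (by omega)).1 hA
  let e : (fderiv ℝ F y).ker ≃L[ℝ] (fderiv ℝ F' y).ker :=
    (LinearEquiv.ofBijective A hbij).toContinuousLinearEquiv
  have hψ : ContDiffAt ℝ 1 (fun s => π' (φ s)) 0 := by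
    simp only [hπ']
    exact (p'.contDiff.contDiffAt).comp 0 (hφ.sub contDiffAt_const)
  have hψd : HasFDerivAt (fun s => π' (φ s)) (e : _ →L[ℝ] (fderiv ℝ F' y).ker) 0 := by
    simp only [hπ']
    have := p'.hasFDerivAt.comp 0 (hφd.sub_const y)
    have he : (e : _ →L[ℝ] (fderiv ℝ F' y).ker) = p'.comp (fderiv ℝ φ 0) := by
      refine ContinuousLinearMap.ext fun v => ?_
      have : p' ((A v : (fderiv ℝ F' y).ker) : E) = A v := hp' _
      exact this.symm
    rw [he]
    exact this
  have hst : HasStrictFDerivAt (fun s => π' (φ s)) (e : _ →L[ℝ] (fderiv ℝ F' y).ker) 0 :=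
    hψ.hasStrictFDerivAt' hψd one_ne_zero
  have hmap := hst.map_nhds_eq_of_equiv
  have hπ0 : π' (φ 0) = 0 := by rw [hφ0, hπ']; simp
  have hgood : ∀ᶠ s in 𝓝 (0 : (fderiv ℝ F y).ker), F (φ s) = 0 ∧ φ' (π' (φ s)) = φ s := by
    have b1 := hcont.eventually (p := fun x => F' x = F' y → φ' (π' x) = x) (by rw [hφ0]; exact h1')
    have b2 := hcont.eventually (p := fun x => F x = 0 → F' x = 0) (by rw [hφ0]; exact hsub)
    filter_upwards [h2, b1, b2] with s hs hb1 hb2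
    have : F (φ s) = 0 := by rw [hs.1, h0]
    exact ⟨this, hb1 (by rw [hb2 this, h0'])⟩
  have himg : ∀ᶠ t in 𝓝 (0 : (fderiv ℝ F' y).ker),
      ∃ s, (F (φ s) = 0 ∧ φ' (π' (φ s)) = φ s) ∧ π' (φ s) = t := by
    rw [hπ0] at hmap
    rw [← hmap]
    exact eventually_map.2 (hgood.mono fun s hs => ⟨s, hs, rfl⟩)
  have hπc : ContinuousAt π' y := by
    have : π' = fun x => p' (x - y) := funext hπ'
    rw [this]; fun_prop
  have := hπc.eventually (p := fun t => ∃ s, (F (φ s) = 0 ∧ φ' (π' (φ s)) = φ s) ∧ π' (φ s) = t)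
    (by rw [hπ']; simpa using himg)
  filter_upwards [this, h1'] with x hx hx1 hx0
  obtain ⟨s, ⟨hs1, hs2⟩, hs3⟩ := hx
  have h3 := hx1 (by rw [hx0, h0'])
  rw [← h3, ← hs3, hs2, hs1]

/-- local submanifold of codimension `d`. -/
def LS {E : Type*} [NormedAddCommGroup E] [NormedSpace ℝ E] (d : ℕ) (S : Set E) (y : E) : Prop :=
  ∃ F : E → (Fin d → ℝ), AnalyticAt ℝ F y ∧ Function.Surjective (fderiv ℝ F y) ∧
    ∀ᶠ x in 𝓝 y, (x ∈ S ↔ F x = 0)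

theorem LS.dim {E : Type*} [NormedAddCommGroup E] [NormedSpace ℝ E] [FiniteDimensional ℝ E]
    {d d' : ℕ} {S S' : Set E} {y : E} (h : LS d S y) (h' : LS d' S' y) (hy : y ∈ S)
    (hsub : ∀ᶠ x in 𝓝 y, x ∈ S → x ∈ S') :
    d' ≤ d ∧ (d' = d → ∀ᶠ x in 𝓝 y, x ∈ S' → x ∈ S) := by
  obtain ⟨F, h1, h2, h3⟩ := h
  obtain ⟨F', h1', h2', h3'⟩ := h'
  have := dim_lemma (F := F) (F' := F') h1.contDiffAt h2 h1'.contDiffAt h2'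
    (h3.self_of_nhds.1 hy) (h3'.self_of_nhds.1 (hsub.self_of_nhds hy)) (by
      filter_upwards [h3, h3', hsub] with x a b c using fun hx => b.1 (c (a.2 hx)))
  simp only [Module.finrank_fin_fun] at this
  refine ⟨this.1, fun h => ?_⟩
  filter_upwards [h3, h3', this.2 h] with x a b c using fun hx => a.2 (c (b.1 hx))

theorem LS.ident_local {E : Type*} [NormedAddCommGroup E] [NormedSpace ℝ E] [FiniteDimensional ℝ E]
    {d : ℕ} {S : Set E} {y : E} (h : LS d S y) (hy : y ∈ S) {g : E → ℝ} (hg : AnalyticAt ℝ g y)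
    (hcl : ∃ᶠ z in 𝓝 y, z ∈ S ∧ ∀ᶠ x in 𝓝 z, x ∈ S → g x = 0) :
    ∀ᶠ x in 𝓝 y, x ∈ S → g x = 0 := by
  obtain ⟨F, hF, hs, hS⟩ := h
  have h0 : F y = 0 := hS.self_of_nhds.1 hy
  obtain ⟨φ, π, p, hp, hπ, hφ, hφ0, h1, h2⟩ := param (n := ω) (by simp) hF.contDiffAt hs
  have hφa : AnalyticAt ℝ φ 0 := hφ.analyticAt
  have hga : AnalyticAt ℝ (fun s => g (φ s)) 0 := by
    have : AnalyticAt ℝ g (φ 0) := by rwa [hφ0]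
    exact this.comp hφa
  have hπc : Continuous π := by
    have : π = fun x => p (x - y) := funext hπ
    rw [this]; fun_prop
  have hπy : π y = 0 := by simp [hπ]
  have hSφ : ∀ᶠ s in 𝓝 (0 : (fderiv ℝ F y).ker), φ s ∈ S := by
    have := hφ.continuousAt.eventually (p := fun x => x ∈ S ↔ F x = 0) (by rwa [hφ0])
    filter_upwards [this, h2] with s a b using a.2 (by rw [b.1, h0])
  obtain ⟨r, hr, hball⟩ := Metric.eventually_nhds_iff_ball.1
    ((hga.eventually_analyticAt.and hSφ).and hφa.eventually_analyticAt)
  have hzero : ∀ s ∈ ball (0 : (fderiv ℝ F y).ker) r, g (φ s) = 0 := by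
    have e1 : ∀ᶠ x in 𝓝 y, π x ∈ ball (0 : (fderiv ℝ F y).ker) r :=
      hπc.continuousAt.eventually (by rw [hπy]; exact ball_mem_nhds _ hr)
    obtain ⟨z, ⟨hzS, hz⟩, ⟨hzπ, hz1⟩, hz2⟩ := (hcl.and_eventually ((e1.and h1).and hS)).exists
    have hφz : φ (π z) = z := hz1 (by rw [hz2.1 hzS, h0])
    have han : AnalyticOnNhd ℝ (fun s => g (φ s)) (ball (0 : (fderiv ℝ F y).ker) r) :=
      fun s hs => (hball s hs).1.1
    refine han.eqOn_zero_of_preconnected_of_eventuallyEq_zero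
      (convex_ball _ _).isPreconnected hzπ ?_
    have hc : ContinuousAt φ (π z) := (hball _ hzπ).2.continuousAt
    have := hc.eventually (p := fun x => x ∈ S → g x = 0) (by rwa [hφz])
    filter_upwards [this, isOpen_ball.mem_nhds hzπ] with s a b
    exact a (hball s b).1.2
  have e1 : ∀ᶠ x in 𝓝 y, π x ∈ ball (0 : (fderiv ℝ F y).ker) r :=
      hπc.continuousAt.eventually (by rw [hπy]; exact ball_mem_nhds _ hr)
  filter_upwards [e1, h1, hS] with x a b c hx
  have := b (by rw [c.1 hx, h0])
  rw [← this]; exact hzero _ a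

theorem preconn_const {X Y : Type*} [TopologicalSpace X] {S : Set X} (hS : IsPreconnected S)
    (f : X → Y) (h : ∀ y ∈ S, ∀ᶠ x in 𝓝 y, x ∈ S → f x = f y) {a b : X} (ha : a ∈ S) (hb : b ∈ S) :
    f a = f b := by
  have := isPreconnected_iff_preconnectedSpace.1 hS
  have hl : IsLocallyConstant (fun x : S => f x) := by
    rw [IsLocallyConstant.iff_eventually_eq]
    intro y
    have := continuous_subtype_val.continuousAt.eventually (h y y.2)
    filter_upwards [this] with x hx using hx x.2
  exact hl.apply_eq_of_preconnectedSpace ⟨a, ha⟩ ⟨b, hb⟩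

/-- identity theorem on connected sets which are locally analytic submanifolds. -/
theorem ident {E : Type*} [NormedAddCommGroup E] [NormedSpace ℝ E] [FiniteDimensional ℝ E]
    {d : ℕ} {S : Set E} (hS : IsPreconnected S) (h : ∀ y ∈ S, LS d S y) {g : E → ℝ}
    (hg : AnalyticOnNhd ℝ g S) {y : E} (hy : y ∈ S) (h0 : ∀ᶠ x in 𝓝 y, x ∈ S → g x = 0) :
    ∀ x ∈ S, g x = 0 := by
  intro x hx
  have key : (∀ᶠ z in 𝓝 x, z ∈ S → g z = 0) = (∀ᶠ z in 𝓝 y, z ∈ S → g z = 0) := by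
    refine preconn_const hS (fun x => ∀ᶠ z in 𝓝 x, z ∈ S → g z = 0) ?_ hx hy
    intro u hu
    by_cases hc : ∀ᶠ z in 𝓝 u, z ∈ S → g z = 0
    · filter_upwards [hc.eventually_nhds] with v hv _
      exact propext ⟨fun _ => hc, fun _ => hv⟩
    · have : ¬ ∃ᶠ z in 𝓝 u, z ∈ S ∧ ∀ᶠ x in 𝓝 z, x ∈ S → g x = 0 :=
        fun hh => hc ((h u hu).ident_local hu (hg u hu) hh)
      rw [not_frequently] at this
      filter_upwards [this] with v hv hvS
      exact propext ⟨fun h' => (hv ⟨hvS, h'⟩).elim, fun h' => (hc h').elim⟩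
  exact (key.symm.mp h0).self_of_nhds hx

end DF
end Part1

section Part2
open Metric Set Filter Topology
open scoped ContDiff NNReal ENNReal

namespace DF

/-- coefficient bound -/
def CBd {ι : Type*} [Fintype ι] (c : ∀ n, (Fin n → ι) → ℝ) (r : ℝ) : Prop :=
  0 < r ∧ ∃ C, ∀ n, (∑ w, |c n w|) * r ^ n ≤ C

theorem _root_.HasSum.congr_fun' {α β : Type*} [AddCommMonoid α] [TopologicalSpace α] {f g : β → α}
    {a : α} (h : HasSum f a) (hfg : ∀ b, f b = g b) : HasSum g a := by
  rwa [← funext hfg]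

theorem bc_exists {ι : Type*} [Fintype ι] {f : (ι → ℝ) → ℝ} (hf : AnalyticAt ℝ f 0) :
    ∃ (c : ∀ n, (Fin n → ι) → ℝ) (r : ℝ), CBd c r ∧
      ∀ x : ι → ℝ, ‖x‖ < r → HasSum (fun n => ∑ w, c n w * ∏ i, x (w i)) (f x) := by
  classical
  obtain ⟨p, R, hp⟩ := hf
  obtain ⟨r0, hr0, hr0R⟩ := ENNReal.lt_iff_exists_nnreal_btwn.1 hp.r_pos
  have hr0' : 0 < (r0 : ℝ) := by exact_mod_cast hr0
  obtain ⟨C, hC, hb⟩ := p.norm_mul_pow_le_of_lt_radius (hr0R.trans_le hp.r_le)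
  set k : ℝ := (Fintype.card ι : ℝ) + 1 with hk
  have hk1 : 1 ≤ k := by simp [hk]
  have hcw : ∀ n (w : Fin n → ι), |p n (fun i => Pi.single (w i) (1 : ℝ))| ≤ ‖p n‖ := by
    intro n w
    have := (p n).le_opNorm (fun i => Pi.single (w i) (1 : ℝ))
    refine this.trans ?_
    have : ∏ i, ‖(Pi.single (w i) (1 : ℝ) : ι → ℝ)‖ ≤ 1 := by
      refine Finset.prod_le_one (fun _ _ => norm_nonneg _) (fun i _ => ?_)
      rw [Pi.norm_single]; simp
    calc _ ≤ ‖p n‖ * 1 := by gcongr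
      _ = _ := mul_one _
  refine ⟨fun n w => p n (fun i => Pi.single (w i) 1), r0 / k, ⟨by positivity, C, fun n => ?_⟩, ?_⟩
  · have h1 : ∑ w : Fin n → ι, |p n (fun i => Pi.single (w i) (1 : ℝ))| ≤ k ^ n * ‖p n‖ := by
      calc _ ≤ ∑ w : Fin n → ι, ‖p n‖ := Finset.sum_le_sum fun w _ => hcw n w
        _ = (Fintype.card ι : ℝ) ^ n * ‖p n‖ := by simp
        _ ≤ k ^ n * ‖p n‖ := by gcongr; simp [hk]
    calc _ ≤ k ^ n * ‖p n‖ * (r0 / k) ^ n := by gcongr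
      _ = ‖p n‖ * r0 ^ n := by
        rw [div_pow]; field_simp
      _ ≤ C := hb n
  · intro x hx
    have hx' : ‖x‖ < r0 := hx.trans_le (div_le_self hr0'.le hk1)
    have hs := hp.hasSum (y := x) (by
      rw [Metric.mem_eball, edist_zero_right]
      refine lt_trans ?_ hr0R
      rw [← ofReal_norm_eq_enorm, ENNReal.ofReal_lt_iff_lt_toReal (norm_nonneg _) (by simp)]
      simpa using hx')
    rw [zero_add] at hs
    refine hs.congr_fun' fun n => ?_
    have hxe : x = ∑ j, x j • (Pi.single j (1 : ℝ) : ι → ℝ) := by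
      ext i; simp [Finset.sum_apply, Pi.single_apply]
    symm
    have : p n (fun _ => x) = p n (fun _ => ∑ j, x j • (Pi.single j (1 : ℝ) : ι → ℝ)) := by
      rw [← hxe]
    rw [this]
    rw [(p n).map_sum (fun _ j => x j • (Pi.single j (1 : ℝ) : ι → ℝ))]
    refine Finset.sum_congr rfl fun w _ => ?_
    rw [(p n).map_smul_univ]
    simp [mul_comm]

section
variable {ι : Type*} [Fintype ι] {𝔸 : Type*} [NormedRing 𝔸] [NormedAlgebra ℝ 𝔸]
  [NormOneClass 𝔸] [CompleteSpace 𝔸]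

/-- base change of a power series -/
noncomputable def bcf (c : ∀ n, (Fin n → ι) → ℝ) (X : ι → 𝔸) : 𝔸 :=
  ∑' n, ∑ w, c n w • (List.ofFn fun i => X (w i)).prod

theorem norm_word_le (X : ι → 𝔸) {n : ℕ} (w : Fin n → ι) :
    ‖(List.ofFn fun i => X (w i)).prod‖ ≤ ‖X‖ ^ n := by
  refine (List.norm_prod_le _).trans ?_
  rw [List.map_ofFn, List.prod_ofFn]
  calc _ ≤ ∏ i : Fin n, ‖X‖ := Finset.prod_le_prod (fun _ _ => norm_nonneg _)
        (fun i _ => norm_le_pi_norm X (w i))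
    _ = _ := by simp

/-- the formal series of the base change -/
noncomputable def bcs (𝕜 : Type*) [RCLike 𝕜] [NormedAlgebra 𝕜 𝔸]
    (c : ∀ n, (Fin n → ι) → ℝ) : FormalMultilinearSeries 𝕜 (ι → 𝔸) 𝔸 := fun n =>
  ∑ w : Fin n → ι, ((c n w : ℝ) : 𝕜) •
    (ContinuousMultilinearMap.mkPiAlgebraFin 𝕜 n 𝔸).compContinuousLinearMap
      (fun i => ContinuousLinearMap.proj (w i))

theorem bcs_radius (𝕜 : Type*) [RCLike 𝕜] [NormedAlgebra 𝕜 𝔸]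
    {c : ∀ n, (Fin n → ι) → ℝ} {r : ℝ≥0} (h : CBd c r) :
    (r : ℝ≥0∞) ≤ (bcs (𝔸 := 𝔸) 𝕜 c).radius := by
  obtain ⟨hr, C, hC⟩ := h
  refine FormalMultilinearSeries.le_radius_of_bound _ C fun n => ?_
  refine le_trans ?_ (hC n)
  gcongr
  refine (norm_sum_le _ _).trans (Finset.sum_le_sum fun w _ => ?_)
  rw [norm_smul]
  have h1 : ‖((c n w : ℝ) : 𝕜)‖ = |c n w| := by simp
  rw [h1]
  refine mul_le_of_le_one_right (abs_nonneg _) ?_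
  refine (ContinuousMultilinearMap.norm_compContinuousLinearMap_le _ _).trans ?_
  rw [ContinuousMultilinearMap.norm_mkPiAlgebraFin, one_mul]
  refine Finset.prod_le_one (fun _ _ => norm_nonneg _) (fun i _ => ?_)
  refine ContinuousLinearMap.opNorm_le_bound _ zero_le_one fun x => ?_
  rw [one_mul]; exact norm_le_pi_norm x (w i)

theorem bcs_apply (𝕜 : Type*) [RCLike 𝕜] [NormedAlgebra 𝕜 𝔸] [IsScalarTower ℝ 𝕜 𝔸]
    (c : ∀ n, (Fin n → ι) → ℝ) (X : ι → 𝔸) (n : ℕ) :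
    (bcs (𝔸 := 𝔸) 𝕜 c) n (fun _ => X) = ∑ w, c n w • (List.ofFn fun i => X (w i)).prod := by
  simp only [bcs, ContinuousMultilinearMap.sum_apply, ContinuousMultilinearMap.smul_apply,
    ContinuousMultilinearMap.compContinuousLinearMap_apply,
    ContinuousMultilinearMap.mkPiAlgebraFin_apply, ContinuousLinearMap.proj_apply]
  refine Finset.sum_congr rfl fun w _ => ?_
  rw [RCLike.ofReal_alg, smul_assoc, one_smul]

theorem bcf_onBall (𝕜 : Type*) [RCLike 𝕜] [NormedAlgebra 𝕜 𝔸] [IsScalarTower ℝ 𝕜 𝔸]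
    {c : ∀ n, (Fin n → ι) → ℝ} {r : ℝ≥0} (h : CBd c r) :
    HasFPowerSeriesOnBall (bcf (𝔸 := 𝔸) c) (bcs 𝕜 c) 0 r := by
  have h1 := bcs_radius (𝔸 := 𝔸) 𝕜 h
  have hr : 0 < (r : ℝ≥0∞) := by exact_mod_cast h.1
  have h2 := ((bcs (𝔸 := 𝔸) 𝕜 c).hasFPowerSeriesOnBall (hr.trans_le h1)).mono hr h1
  have : (bcs (𝔸 := 𝔸) 𝕜 c).sum = bcf c := by
    funext X
    simp only [FormalMultilinearSeries.sum, bcs_apply, bcf]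
  rwa [this] at h2

theorem bcf_analyticAt (𝕜 : Type*) [RCLike 𝕜] [NormedAlgebra 𝕜 𝔸] [IsScalarTower ℝ 𝕜 𝔸]
    {c : ∀ n, (Fin n → ι) → ℝ} {r : ℝ} (h : CBd c r) {X : ι → 𝔸} (hX : ‖X‖ < r) :
    AnalyticAt 𝕜 (bcf (𝔸 := 𝔸) c) X := by
  lift r to ℝ≥0 using h.1.le
  refine (bcf_onBall 𝕜 h).analyticAt_of_mem ?_
  rw [Metric.mem_eball, edist_zero_right, ← ofReal_norm_eq_enorm,
    ENNReal.ofReal_lt_iff_lt_toReal (norm_nonneg _) (by simp)]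
  simpa using hX

theorem bcf_hasSum
    {c : ∀ n, (Fin n → ι) → ℝ} {r : ℝ} (h : CBd c r) {X : ι → 𝔸} (hX : ‖X‖ < r) :
    HasSum (fun n => ∑ w, c n w • (List.ofFn fun i => X (w i)).prod) (bcf c X) := by
  lift r to ℝ≥0 using h.1.le
  have := (bcf_onBall (𝔸 := 𝔸) ℝ h).hasSum (y := X) (by
    rw [Metric.mem_eball, edist_zero_right, ← ofReal_norm_eq_enorm,
      ENNReal.ofReal_lt_iff_lt_toReal (norm_nonneg _) (by simp)]
    simpa using hX)
  simpa only [bcs_apply, zero_add] using this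

variable {𝔹 : Type*} [NormedRing 𝔹] [NormedAlgebra ℝ 𝔹] [NormOneClass 𝔹] [CompleteSpace 𝔹]

theorem bcf_rel {M : Type*} [NormedAddCommGroup M] [NormedSpace ℝ M]
    {c : ∀ n, (Fin n → ι) → ℝ} {r : ℝ} (h : CBd c r) {X : ι → 𝔸} (hX : ‖X‖ < r)
    {Y : ι → 𝔹} (hY : ‖Y‖ < r) (L : 𝔸 →L[ℝ] M) (R : 𝔹 →L[ℝ] M)
    (hw : ∀ l : List ι, L (l.map X).prod = R (l.map Y).prod) :
    L (bcf c X) = R (bcf c Y) := by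
  have h1 := (bcf_hasSum h hX).mapL L
  have h2 := (bcf_hasSum h hY).mapL R
  refine h1.unique ?_
  convert h2 using 2 with n
  rw [map_sum, map_sum]
  refine Finset.sum_congr rfl fun w _ => ?_
  rw [map_smul, map_smul]
  have := hw (List.ofFn w)
  rw [List.map_ofFn, List.map_ofFn] at this
  congr 1

end

theorem bcf_real {ι : Type*} [Fintype ι] {f : (ι → ℝ) → ℝ} {c : ∀ n, (Fin n → ι) → ℝ} {r : ℝ}
    (h : ∀ x : ι → ℝ, ‖x‖ < r → HasSum (fun n => ∑ w, c n w * ∏ i, x (w i)) (f x))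
    {x : ι → ℝ} (hx : ‖x‖ < r) : bcf c x = f x := by
  have := (h x hx).tsum_eq
  rw [← this, bcf]
  congr 1; ext n
  refine Finset.sum_congr rfl fun w _ => ?_
  rw [List.prod_ofFn]; simp

end DF
end Part2

section Part3
open Metric Set Filter Topology
open scoped ContDiff NNReal ENNReal

namespace DF

/-- nilpotent shift -/
noncomputable def shift (k : ℕ) : (Fin (k+1) → ℝ) →L[ℝ] (Fin (k+1) → ℝ) :=
  ContinuousLinearMap.pi (Fin.cons 0 (fun j : Fin k => ContinuousLinearMap.proj j.castSucc))

/-- companion operator -/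
noncomputable def comp (k : ℕ) (b : Fin (k+1) → ℝ) : (Fin (k+1) → ℝ) →L[ℝ] (Fin (k+1) → ℝ) :=
  shift k + ContinuousLinearMap.smulRightL ℝ (Fin (k+1) → ℝ) (Fin (k+1) → ℝ)
    (ContinuousLinearMap.proj (Fin.last k)) b

@[simp] theorem shift_zero (k : ℕ) (v : Fin (k+1) → ℝ) : shift k v 0 = 0 := by
  simp [shift]

@[simp] theorem shift_succ (k : ℕ) (v : Fin (k+1) → ℝ) (j : Fin k) :
    shift k v j.succ = v j.castSucc := by
  simp [shift]

theorem comp_apply (k : ℕ) (b v : Fin (k+1) → ℝ) (i) :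
    comp k b v i = shift k v i + v (Fin.last k) * b i := by
  simp [comp]

theorem comp_zero (k : ℕ) : comp k 0 = shift k := by
  simp [comp]

theorem comp_analytic (k : ℕ) (b) : AnalyticAt ℝ (comp k) b := by
  unfold comp
  exact analyticAt_const.add (ContinuousLinearMap.analyticAt _ _)

theorem comp_single (k : ℕ) (b : Fin (k+1) → ℝ) (j : Fin k) :
    comp k b (Pi.single j.castSucc 1) = Pi.single j.succ 1 := by
  ext i
  rw [comp_apply]
  refine Fin.cases ?_ (fun i => ?_) i
  · simp [Pi.single_apply, Fin.castSucc_ne_last, (Fin.succ_ne_zero _).symm,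
      (Fin.castSucc_lt_last j).ne']
  · simp [Pi.single_apply, (Fin.castSucc_lt_last j).ne']

theorem comp_last (k : ℕ) (b : Fin (k+1) → ℝ) :
    comp k b (Pi.single (Fin.last k) 1) = b := by
  ext i
  rw [comp_apply]
  refine Fin.cases ?_ (fun i => ?_) i
  · simp
  · simp [Pi.single_apply, (Fin.castSucc_lt_last i).ne]

theorem comp_pow (k : ℕ) (b : Fin (k+1) → ℝ) (j : ℕ) (hj : j < k + 1) :
    (comp k b ^ j) (Pi.single 0 1) = Pi.single ⟨j, hj⟩ 1 := by
  induction j with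
  | zero => simp
  | succ j ih =>
    rw [pow_succ', ContinuousLinearMap.mul_apply, ih (by omega)]
    exact comp_single k b ⟨j, by omega⟩

theorem comp_pow_last (k : ℕ) (b : Fin (k+1) → ℝ) :
    (comp k b ^ (k+1)) (Pi.single 0 1) = b := by
  rw [pow_succ', ContinuousLinearMap.mul_apply, comp_pow k b k (by omega)]
  exact comp_last k b

theorem shift_pow_vanish (k : ℕ) (v : Fin (k+1) → ℝ) (i : Fin (k+1)) (hv : ∀ j < i, v j = 0)
    (n : ℕ) : (shift k ^ (n+1)) v i = 0 := by
  have key : ∀ n, ∀ j ≤ i, (shift k ^ (n+1)) v j = 0 := by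
    intro n
    induction n with
    | zero =>
      intro j hj
      rw [zero_add, pow_one]
      revert hj
      refine Fin.cases (by simp) (fun j hj => ?_) j
      rw [shift_succ]
      exact hv _ (lt_of_lt_of_le (Fin.castSucc_lt_succ) hj)
    | succ n ih =>
      intro j hj
      rw [pow_succ', ContinuousLinearMap.mul_apply]
      revert hj
      refine Fin.cases (by simp) (fun j hj => ?_) j
      rw [shift_succ]
      exact ih _ (le_of_lt (lt_of_lt_of_le (Fin.castSucc_lt_succ) hj))
  exact key n i le_rfl

section
variable {N : ℕ} {𝔸 : Type*} [NormedRing 𝔸] [NormedAlgebra ℝ 𝔸]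

/-- substitution tuple -/
def mkA (x : Fin N → ℝ) (T : 𝔸) : Option (Fin N) → 𝔸 := fun o => o.elim T (fun i => x i • 1)

theorem mkA_norm [NormOneClass 𝔸] {x : Fin N → ℝ} {T : 𝔸} {r : ℝ} (hr : 0 < r) (hx : ‖x‖ < r) (hT : ‖T‖ < r) :
    ‖mkA x T‖ < r := by
  rw [pi_norm_lt_iff hr]
  rintro (_ | i)
  · simpa [mkA] using hT
  · simp only [mkA, Option.elim]
    rw [norm_smul, norm_one, mul_one]
    exact (norm_le_pi_norm x i).trans_lt hx

theorem mkA_analytic {E : Type*} [NormedAddCommGroup E] [NormedSpace ℝ E]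
    {x : E → Fin N → ℝ} {T : E → 𝔸} {e : E} (hx : AnalyticAt ℝ x e) (hT : AnalyticAt ℝ T e) :
    AnalyticAt ℝ (fun e => mkA (x e) (T e)) e := by
  rw [analyticAt_pi_iff]
  rintro (_ | i)
  · simpa [mkA] using hT
  · simp only [mkA, Option.elim]
    exact ((analyticAt_pi_iff.1 hx) i).smul analyticAt_const

theorem mkA_zero_hasSum [NormOneClass 𝔸] [CompleteSpace 𝔸]
    {c : ∀ n, (Fin n → Option (Fin N)) → ℝ} {r : ℝ} (h : CBd c r) {T : 𝔸} (hT : ‖T‖ < r) :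
    HasSum (fun n => c n (fun _ => none) • T ^ n) (bcf c (mkA 0 T)) := by
  refine (bcf_hasSum h (mkA_norm h.1 (by simpa using h.1) hT)).congr_fun' fun n => ?_
  rw [Finset.sum_eq_single (fun _ => none)]
  · congr 1
    simp [mkA]
  · intro w _ hw
    obtain ⟨i, hi⟩ : ∃ i, w i ≠ none := by
      by_contra hh
      push Not at hh
      exact hw (funext hh)
    obtain ⟨j, hj⟩ := Option.ne_none_iff_exists'.1 hi
    rw [List.prod_eq_zero, smul_zero]
    rw [List.mem_ofFn]
    exact ⟨i, by simp [mkA, hj]⟩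
  · simp
end

end DF
end Part3

section Part4
open Metric Set Filter Topology
open scoped ContDiff NNReal ENNReal

namespace DF

theorem wp_implicit {N k : ℕ} {c : ∀ n, (Fin n → Option (Fin N)) → ℝ} {r : ℝ} (h : CBd c r)
    (hr : ‖shift k‖ < r) (hc0 : ∀ j < k + 1, c j (fun _ => none) = 0)
    (hcm : c (k+1) (fun _ => none) ≠ 0) :
    ∃ b : (Fin N → ℝ) → (Fin (k+1) → ℝ), AnalyticAt ℝ b 0 ∧ b 0 = 0 ∧
      ∀ᶠ x in 𝓝 (0 : Fin N → ℝ), bcf c (mkA x (comp k (b x))) (Pi.single 0 1) = 0 := by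
  have hr0 : 0 < r := h.1
  let R : (Fin N → ℝ) × (Fin (k+1) → ℝ) → (Fin (k+1) → ℝ) :=
    fun u => bcf c (mkA u.1 (comp k u.2)) (Pi.single 0 1)
  have hcompan : AnalyticAt ℝ (fun u : (Fin N → ℝ) × (Fin (k+1) → ℝ) => comp k u.2) (0, 0) :=
    (comp_analytic k 0).comp_of_eq analyticAt_snd rfl
  have hR : AnalyticAt ℝ R (0, 0) := by
    have h1 : AnalyticAt ℝ (fun u : (Fin N → ℝ) × (Fin (k+1) → ℝ) => mkA u.1 (comp k u.2)) (0, 0) :=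
      mkA_analytic analyticAt_fst hcompan
    have h2 := (bcf_analyticAt ℝ h (X := mkA (0 : Fin N → ℝ) (comp k 0))
      (mkA_norm hr0 (by simpa using hr0) (by rwa [comp_zero]))).comp_of_eq h1 rfl
    exact ((ContinuousLinearMap.apply ℝ (Fin (k+1) → ℝ) (Pi.single 0 1 : Fin (k+1) → ℝ)).analyticAt _).comp h2
  -- the tail operator
  let d : ∀ n, (Fin n → Unit) → ℝ := fun n _ => c (k + 1 + n) (fun _ => none)
  have hd : CBd d r := by
    refine ⟨hr0, ?_⟩
    obtain ⟨C, hC⟩ := h.2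
    refine ⟨C / r ^ (k+1), fun n => ?_⟩
    rw [le_div_iff₀ (by positivity)]
    refine le_trans ?_ (hC (k + 1 + n))
    rw [mul_assoc, ← pow_add, add_comm n]
    gcongr
    rw [Finset.univ_unique, Finset.sum_singleton]
    exact Finset.single_le_sum (f := fun w : Fin (k+1+n) → Option (Fin N) => |c (k+1+n) w|)
      (fun _ _ => abs_nonneg _) (Finset.mem_univ (fun _ => none))
  let T : (Fin (k+1) → ℝ) → ((Fin (k+1) → ℝ) →L[ℝ] (Fin (k+1) → ℝ)) :=
    fun b => bcf d (fun _ => comp k b)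
  have hunit : ∀ b, ‖comp k b‖ < r → ‖(fun _ : Unit => comp k b)‖ < r := fun b hb => by
    rw [pi_norm_lt_iff hr0]; exact fun _ => hb
  have hT : AnalyticAt ℝ T 0 := by
    have h1 : AnalyticAt ℝ (fun b => (fun _ : Unit => comp k b)) 0 := by
      rw [analyticAt_pi_iff]; exact fun _ => comp_analytic k 0
    exact (bcf_analyticAt ℝ hd (hunit 0 (by rwa [comp_zero]))).comp_of_eq h1 rfl
  have hTs : ∀ b, ‖comp k b‖ < r →
      HasSum (fun n => c (k+1+n) (fun _ => none) • comp k b ^ n) (T b) := by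
    intro b hb
    refine (bcf_hasSum hd (hunit b hb)).congr_fun' fun n => ?_
    rw [Finset.univ_unique, Finset.sum_singleton]
    simp [d]
  have hRT : ∀ b, ‖comp k b‖ < r → R (0, b) = T b b := by
    intro b hb
    have h1 := (mkA_zero_hasSum h hb).mapL (ContinuousLinearMap.apply ℝ _ (Pi.single 0 1 : Fin (k+1) → ℝ))
    have h2 := (hTs b hb).mapL (ContinuousLinearMap.apply ℝ _ b)
    refine h1.unique ?_
    rw [← hasSum_nat_add_iff' (k+1)]
    rw [Finset.sum_eq_zero, sub_zero]
    · refine h2.congr_fun' fun n => ?_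
      simp only [ContinuousLinearMap.apply_apply, ContinuousLinearMap.smul_apply]
      rw [add_comm n, pow_add, ← pow_add, add_comm (k+1) n, pow_add, ContinuousLinearMap.mul_apply, comp_pow_last]
    · intro i hi
      simp [hc0 i (Finset.mem_range.1 hi)]
  have hnear : ∀ᶠ b in 𝓝 (0 : Fin (k+1) → ℝ), ‖comp k b‖ < r :=
    (comp_analytic k 0).continuousAt.norm.eventually (gt_mem_nhds (by show ‖comp k 0‖ < r; rwa [comp_zero]))
  have hR0 : R (0, 0) = 0 := by rw [hRT 0 (by rwa [comp_zero])]; simp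
  have hderiv : fderiv ℝ R (0, 0) ∘L .inr ℝ (Fin N → ℝ) (Fin (k+1) → ℝ) = T 0 := by
    have h1 : HasFDerivAt (fun b => R (0, b))
        (fderiv ℝ R (0, 0) ∘L .inr ℝ (Fin N → ℝ) (Fin (k+1) → ℝ)) 0 := by
      exact hR.differentiableAt.hasFDerivAt.comp (0 : Fin (k+1) → ℝ) (hasFDerivAt_prodMk_right _ _)
    have h2 : HasFDerivAt (fun b => R (0, b)) (T 0) 0 := by
      have := hT.differentiableAt.hasFDerivAt.clm_apply (hasFDerivAt_id (0 : Fin (k+1) → ℝ))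
      have h3 : HasFDerivAt (fun b => T b b) (T 0) 0 := by
        refine this.congr_fderiv ?_
        ext v; simp
      refine h3.congr_of_eventuallyEq ?_
      filter_upwards [hnear] with b hb using hRT b hb
    exact h1.unique h2
  have hinj : Function.Injective (T 0) := by
    rw [injective_iff_map_eq_zero]
    intro v hv
    by_contra hne
    obtain ⟨i0, hi0⟩ := Function.ne_iff.1 hne
    obtain ⟨i, hi, hmin⟩ := WellFounded.has_min (wellFounded_lt (α := Fin (k+1))) {i | v i ≠ 0} ⟨i0, hi0⟩
    have hlt : ∀ j < i, v j = 0 := fun j hj => by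
      by_contra hh; exact hmin j hh hj
    have h2 := ((hTs 0 (by rwa [comp_zero])).mapL (ContinuousLinearMap.apply ℝ _ v)).mapL
      (ContinuousLinearMap.proj (R := ℝ) (φ := fun _ : Fin (k+1) => ℝ) i)
    have h3 : HasSum (fun n => ContinuousLinearMap.proj (R := ℝ) (φ := fun _ : Fin (k+1) => ℝ) i
      (ContinuousLinearMap.apply ℝ _ v (c (k+1+n) (fun _ => none) • comp k 0 ^ n))) (c (k+1) (fun _ => none) * v i) := by
      have := hasSum_single (f := fun n => ContinuousLinearMap.proj (R := ℝ) (φ := fun _ : Fin (k+1) => ℝ) i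
        (ContinuousLinearMap.apply ℝ _ v (c (k+1+n) (fun _ => none) • comp k 0 ^ n))) 0 (by
          rintro (_ | n) hn
          · exact (hn rfl).elim
          · simp only [ContinuousLinearMap.apply_apply, ContinuousLinearMap.smul_apply,
              ContinuousLinearMap.proj_apply, Pi.smul_apply, comp_zero, shift_pow_vanish k v i hlt n, smul_zero])
      simpa using this
    have h4 := h2.unique h3
    simp only [ContinuousLinearMap.apply_apply, hv] at h4
    simp only [ContinuousLinearMap.proj_apply, Pi.zero_apply] at h4
    exact mul_ne_zero hcm hi h4.symm
  have hinv : (fderiv ℝ R (0, 0) ∘L .inr ℝ (Fin N → ℝ) (Fin (k+1) → ℝ)).IsInvertible := by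
    rw [hderiv]
    refine ⟨(LinearEquiv.ofInjectiveEndo (T 0 : (Fin (k+1) → ℝ) →ₗ[ℝ] (Fin (k+1) → ℝ)) hinj).toContinuousLinearEquiv, ?_⟩
    ext v; rfl
  have hcd : ContDiffAt ℝ ω R (0, 0) := hR.contDiffAt
  refine ⟨hcd.implicitFunction (by simp) hinv, (hcd.contDiffAt_implicitFunction (by simp) hinv).analyticAt,
    hcd.implicitFunction_apply_self (by simp) hinv, ?_⟩
  have := hcd.eventually_apply_implicitFunction (by simp) hinv
  filter_upwards [this] with x hx
  rw [hR0] at hx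
  exact hx

end DF
end Part4

section Part5
open Metric Set Filter Topology
open scoped ContDiff NNReal ENNReal

namespace DF

theorem rel_list {ι M1 M2 : Type*} [NormedAddCommGroup M1] [NormedSpace ℝ M1]
    [NormedAddCommGroup M2] [NormedSpace ℝ M2] (π : M1 →L[ℝ] M2)
    (X : ι → (M1 →L[ℝ] M1)) (Y : ι → (M2 →L[ℝ] M2)) (h : ∀ o v, π (X o v) = Y o (π v))
    (l : List ι) (v : M1) : π ((l.map X).prod v) = (l.map Y).prod (π v) := by
  induction l with
  | nil => simp
  | cons a l ih => simp [List.prod_cons, ContinuousLinearMap.mul_apply, h, ih]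

theorem rel_list' {ι M1 : Type*} [NormedAddCommGroup M1] [NormedSpace ℝ M1]
    (π : M1 →L[ℝ] ℝ)
    (X : ι → (M1 →L[ℝ] M1)) (Y : ι → ℝ) (h : ∀ o v, π (X o v) = Y o * (π v))
    (l : List ι) (v : M1) : π ((l.map X).prod v) = (l.map Y).prod * (π v) := by
  induction l with
  | nil => simp
  | cons a l ih => simp [List.prod_cons, ContinuousLinearMap.mul_apply, h, ih, mul_assoc]

/-- coefficients of the product polynomial -/
def bprod {k : ℕ} (b : Fin (k+1) → ℝ) (t : ℝ) : Fin (k+2) → ℝ :=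
  fun i => (Fin.cons 0 b : Fin (k+2) → ℝ) i + (Fin.snoc (fun i => - t * b i) t : Fin (k+2) → ℝ) i

noncomputable def prj {k : ℕ} (b : Fin (k+1) → ℝ) : (Fin (k+2) → ℝ) →L[ℝ] (Fin (k+1) → ℝ) :=
  ContinuousLinearMap.pi fun i => ContinuousLinearMap.proj i.castSucc +
    b i • ContinuousLinearMap.proj (Fin.last (k+1))

theorem prj_apply {k : ℕ} (b : Fin (k+1) → ℝ) (v) (i) :
    prj b v i = v i.castSucc + b i * v (Fin.last (k+1)) := by
  simp [prj]

noncomputable def evl (k : ℕ) (t : ℝ) : (Fin (k+1) → ℝ) →L[ℝ] ℝ :=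
  ∑ i : Fin (k+1), t ^ (i : ℕ) • ContinuousLinearMap.proj i

theorem evl_apply (k : ℕ) (t : ℝ) (v) : evl k t v = ∑ i : Fin (k+1), t ^ (i : ℕ) * v i := by
  simp [evl, ContinuousLinearMap.sum_apply]

theorem prj_comp {k : ℕ} (b : Fin (k+1) → ℝ) (t : ℝ) (v) :
    prj b (comp (k+1) (bprod b t) v) = comp k b (prj b v) := by
  have hl : shift (k+1) v (Fin.last (k+1)) = v (Fin.last k).castSucc := by
    rw [← Fin.succ_last, shift_succ]
  have hb : bprod b t (Fin.last (k+1)) = b (Fin.last k) + t := by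
    simp only [bprod, Fin.snoc_last]
    rw [← Fin.succ_last, Fin.cons_succ]
  ext i
  rw [prj_apply, comp_apply, comp_apply, comp_apply, hl, hb, prj_apply]
  refine Fin.cases ?_ (fun j => ?_) i
  · rw [shift_zero, Fin.castSucc_zero, shift_zero]
    have : bprod b t 0 = - t * b 0 := by
      simp only [bprod, Fin.cons_zero]
      rw [← Fin.castSucc_zero, Fin.snoc_castSucc, zero_add]
    rw [this]; ring
  · rw [shift_succ, ← Fin.succ_castSucc, shift_succ, prj_apply]
    have : bprod b t j.castSucc.succ = b j.castSucc - t * b j.succ := by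
      simp only [bprod, Fin.cons_succ]
      rw [Fin.succ_castSucc, Fin.snoc_castSucc]; ring
    rw [this]; ring

theorem evl_comp {k : ℕ} (b : Fin (k+1) → ℝ) (t : ℝ) (v) :
    evl (k+1) t (comp (k+1) (bprod b t) v) = t * evl (k+1) t v := by
  have h1 : ∑ i : Fin (k+2), t ^ (i : ℕ) * shift (k+1) v i = t * ∑ i : Fin (k+1), t ^ (i : ℕ) * v i.castSucc := by
    rw [Fin.sum_univ_succ]
    simp only [shift_zero, mul_zero, zero_add, shift_succ, Fin.val_succ, Finset.mul_sum]
    exact Finset.sum_congr rfl fun i _ => by ring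
  have h2 : ∑ i : Fin (k+2), t ^ (i : ℕ) * bprod b t i = t ^ (k+2) := by
    simp only [bprod, mul_add, Finset.sum_add_distrib]
    rw [Fin.sum_univ_succ (n := k+1)]
    rw [Fin.sum_univ_castSucc (n := k+1) (f := fun i => t ^ (i : ℕ) * (Fin.snoc (fun i => - t * b i) t : Fin (k+2) → ℝ) i)]
    simp only [Fin.cons_zero, mul_zero, Fin.cons_succ, Fin.snoc_castSucc, Fin.snoc_last, Fin.val_succ, Fin.val_castSucc, Fin.val_last, zero_add]
    rw [← add_assoc, ← Finset.sum_add_distrib, Finset.sum_eq_zero]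
    · ring
    · intro i _; ring
  rw [evl_apply, evl_apply]
  simp only [comp_apply, mul_add, Finset.sum_add_distrib]
  rw [h1]
  have h3 : ∑ i : Fin (k+2), t ^ (i : ℕ) * (v (Fin.last (k+1)) * bprod b t i) = v (Fin.last (k+1)) * t ^ (k+2) := by
    rw [← h2, Finset.mul_sum]; exact Finset.sum_congr rfl fun i _ => by ring
  rw [h3, Fin.sum_univ_castSucc (n := k+1)]
  simp only [Fin.val_castSucc, Fin.val_last]
  ring

theorem bprod_cont {k : ℕ} {X : Type*} [TopologicalSpace X] {b : X → Fin (k+1) → ℝ} {t : X → ℝ} {x : X}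
    (hb : ContinuousAt b x) (ht : ContinuousAt t x) : ContinuousAt (fun x => bprod (b x) (t x)) x := by
  have hb' := continuousAt_pi.1 hb
  refine continuousAt_pi.2 fun i => ?_
  unfold bprod
  refine ContinuousAt.add ?_ ?_
  · refine Fin.cases ?_ (fun j => ?_) i
    · simpa using continuousAt_const
    · simpa using hb' j
  · refine Fin.lastCases ?_ (fun j => ?_) i
    · simpa using ht
    · have := (ht.mul (hb' j)).neg
      simp only [Fin.snoc_castSucc, neg_mul]
      exact this

theorem wp_core {N k : ℕ} {c : ∀ n, (Fin n → Option (Fin N)) → ℝ} {r : ℝ} (h : CBd c r)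
    (hr : ‖shift k‖ < r) (hr' : ‖shift (k+1)‖ < r) (hc0 : ∀ j < k + 1, c j (fun _ => none) = 0)
    (hcm : c (k+1) (fun _ => none) ≠ 0) :
    ∃ b : (Fin N → ℝ) → (Fin (k+1) → ℝ), AnalyticAt ℝ b 0 ∧ b 0 = 0 ∧
      ∀ᶠ z in 𝓝 (0 : (Fin N → ℝ) × ℝ),
        (bcf c (mkA z.1 z.2) = 0 ↔ z.2 ^ (k+1) = ∑ i, b z.1 i * z.2 ^ (i:ℕ)) := by
  obtain ⟨b, hb, hb0, hbz⟩ := wp_implicit h hr hc0 hcm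
  refine ⟨b, hb, hb0, ?_⟩
  have hr0 := h.1
  let A : (Fin N → ℝ) × ℝ → ((Fin (k+2) → ℝ) →L[ℝ] (Fin (k+2) → ℝ)) :=
    fun z => comp (k+1) (bprod (b z.1) z.2)
  let rh : (Fin N → ℝ) × ℝ → (Fin (k+2) → ℝ) := fun z => bcf c (mkA z.1 (A z)) (Pi.single 0 1)
  have hbc : ContinuousAt (fun z : (Fin N → ℝ) × ℝ => b z.1) 0 :=
    ContinuousAt.comp (f := Prod.fst) (by exact hb.continuousAt) continuousAt_fst
  have hbp0 : bprod (b 0) 0 = 0 := by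
    rw [hb0]; ext i
    simp only [bprod, Pi.zero_apply, mul_zero]
    have : (Fin.cons 0 0 : Fin (k+2) → ℝ) i = 0 := by
      refine Fin.cases ?_ (fun j => ?_) i <;> simp
    rw [this, zero_add]
    refine Fin.lastCases ?_ (fun j => ?_) i <;> simp
  have hA0 : A 0 = shift (k+1) := by
    simp only [A, Prod.fst_zero, Prod.snd_zero, hbp0, comp_zero]
  have hAc : ContinuousAt A 0 :=
    ContinuousAt.comp (f := fun z : (Fin N → ℝ) × ℝ => bprod (b z.1) z.2) (g := comp (k+1)) (comp_analytic _ _).continuousAt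
      (bprod_cont hbc continuousAt_snd)
  have hAn : ∀ᶠ z in 𝓝 (0 : (Fin N → ℝ) × ℝ), ‖A z‖ < r :=
    hAc.norm.eventually (gt_mem_nhds (by show ‖A 0‖ < r; rwa [hA0]))
  have hmc : ContinuousAt (fun z => mkA z.1 (A z)) 0 := by
    refine continuousAt_pi.2 ?_
    rintro (_ | i)
    · simpa [mkA] using hAc
    · simp only [mkA, Option.elim]
      exact ContinuousAt.smul ((continuous_apply i).continuousAt.comp continuousAt_fst) continuousAt_const
  have hrc : ContinuousAt rh 0 := by
    have h2 := ContinuousAt.comp (f := fun z => mkA z.1 (A z)) (g := bcf c) (x := (0 : (Fin N → ℝ) × ℝ))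
      (bcf_analyticAt ℝ h (mkA_norm hr0 (by simpa using hr0) (by rwa [hA0]))).continuousAt hmc
    exact ContinuousAt.comp (g := ContinuousLinearMap.apply ℝ (Fin (k+2) → ℝ) (Pi.single 0 1 : Fin (k+2) → ℝ))
      (ContinuousLinearMap.continuous _).continuousAt h2
  have hr00 : rh 0 (Fin.last (k+1)) = c (k+1) (fun _ => none) := by
    have h1 := ((mkA_zero_hasSum h hr').mapL (ContinuousLinearMap.apply ℝ _ (Pi.single 0 1 : Fin (k+2) → ℝ))).mapL
      (ContinuousLinearMap.proj (R := ℝ) (φ := fun _ : Fin (k+2) => ℝ) (Fin.last (k+1)))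
    have h0 : rh 0 = bcf c (mkA 0 (shift (k+1))) (Pi.single 0 1) := by
      simp only [rh, hA0, Prod.fst_zero]
    rw [h0]
    refine h1.unique ?_
    have h3 := hasSum_single (f := fun n => ContinuousLinearMap.proj (R := ℝ) (φ := fun _ : Fin (k+2) => ℝ) (Fin.last (k+1))
      (ContinuousLinearMap.apply ℝ (Fin (k+2) → ℝ) (Pi.single 0 1 : Fin (k+2) → ℝ)
        (c n (fun _ => none) • shift (k+1) ^ n))) (k+1) (by
        intro n hn
        simp only [ContinuousLinearMap.apply_apply, ContinuousLinearMap.smul_apply,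
              ContinuousLinearMap.proj_apply, Pi.smul_apply, ← comp_zero]
        rcases lt_or_ge n (k+2) with hlt | hge
        · rw [comp_pow (k+1) 0 n hlt, Pi.single_apply, if_neg, smul_zero]
          rw [Fin.ext_iff]; exact fun hh => hn hh.symm
        · obtain ⟨d, rfl⟩ := Nat.exists_eq_add_of_le hge
          rw [add_comm, pow_add, ContinuousLinearMap.mul_apply, comp_pow_last]
          simp)
    simp only [ContinuousLinearMap.apply_apply, ContinuousLinearMap.smul_apply,
              ContinuousLinearMap.proj_apply, Pi.smul_apply, ← comp_zero] at h3 ⊢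
    rw [comp_pow (k+1) 0 (k+1) (by omega)] at h3
    have h4 : (Pi.single (⟨k+1, by omega⟩ : Fin (k+2)) 1 : Fin (k+2) → ℝ) (Fin.last (k+1)) = 1 := by
      rw [Pi.single_apply, if_pos]; rfl
    rw [h4, smul_eq_mul, mul_one] at h3
    exact h3
  have hne : ∀ᶠ z in 𝓝 (0 : (Fin N → ℝ) × ℝ), rh z (Fin.last (k+1)) ≠ 0 :=
    ((continuous_apply (Fin.last (k+1))).continuousAt.comp hrc).eventually_ne (by simpa [hr00] using hcm)
  have hkb : ∀ᶠ z in 𝓝 (0 : (Fin N → ℝ) × ℝ), ‖comp k (b z.1)‖ < r :=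
    (ContinuousAt.comp (f := fun z : (Fin N → ℝ) × ℝ => b z.1) (g := comp k) (comp_analytic _ _).continuousAt hbc).norm.eventually
      (gt_mem_nhds (by simpa [hb0, comp_zero] using hr))
  have hzr : ∀ᶠ z in 𝓝 (0 : (Fin N → ℝ) × ℝ), ‖z‖ < r := by
    filter_upwards [ball_mem_nhds (0 : (Fin N → ℝ) × ℝ) hr0] with z hz using by simpa using hz
  have hbz' : ∀ᶠ z in 𝓝 (0 : (Fin N → ℝ) × ℝ), bcf c (mkA z.1 (comp k (b z.1))) (Pi.single 0 1) = 0 :=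
    (continuousAt_fst (p := (0 : (Fin N → ℝ) × ℝ))).eventually hbz
  filter_upwards [hne, hkb, hzr, hbz', hAn] with z hne hkb hzr hbz hAn
  have hz1 : ‖z.1‖ < r := (norm_fst_le z).trans_lt hzr
  have hz2 : ‖z.2‖ < r := (norm_snd_le z).trans_lt hzr
  have hpr : prj (b z.1) (rh z) = 0 := by
    rw [← hbz]
    have := bcf_rel h (mkA_norm hr0 hz1 hAn) (mkA_norm hr0 hz1 hkb)
      ((prj (b z.1)).comp (ContinuousLinearMap.apply ℝ _ (Pi.single 0 1 : Fin (k+2) → ℝ)))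
      (ContinuousLinearMap.apply ℝ _ (Pi.single 0 1 : Fin (k+1) → ℝ)) (by
        intro l
        simp only [ContinuousLinearMap.comp_apply, ContinuousLinearMap.apply_apply]
        rw [rel_list (prj (b z.1)) _ (mkA z.1 (comp k (b z.1)))]
        · congr 1
          ext i
          rw [prj_apply]
          simp [Pi.single_apply]
        · rintro (_ | i) v
          · simpa [mkA] using prj_comp _ _ _
          · simp [mkA])
    simpa using this
  have hev : evl (k+1) z.2 (rh z) = bcf c (mkA z.1 z.2) := by
    have := bcf_rel h (mkA_norm hr0 hz1 hAn) (mkA_norm hr0 hz1 hz2)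
      ((evl (k+1) z.2).comp (ContinuousLinearMap.apply ℝ _ (Pi.single 0 1 : Fin (k+2) → ℝ)))
      (ContinuousLinearMap.id ℝ ℝ) (by
        intro l
        simp only [ContinuousLinearMap.comp_apply, ContinuousLinearMap.apply_apply]
        rw [rel_list' (evl (k+1) z.2) _ (mkA z.1 z.2)]
        · rw [evl_apply, Fin.sum_univ_succ]
          simp
        · rintro (_ | i) v
          · simpa [mkA] using evl_comp _ _ _
          · simp [mkA])
    simpa using this
  rw [← hev, evl_apply, Fin.sum_univ_castSucc]
  have h5 : ∀ i : Fin (k+1), rh z i.castSucc = - (b z.1 i * rh z (Fin.last (k+1))) := by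
    intro i
    have := congrFun hpr i
    rw [prj_apply] at this
    simp only [Pi.zero_apply] at this
    linarith
  simp only [h5, Fin.val_castSucc, Fin.val_last]
  have h6 : ∑ x : Fin (k+1), z.2 ^ (x:ℕ) * -(b z.1 x * rh z (Fin.last (k + 1))) + z.2 ^ (k + 1) * rh z (Fin.last (k + 1))
      = rh z (Fin.last (k+1)) * (z.2 ^ (k+1) - ∑ i, b z.1 i * z.2 ^ (i:ℕ)) := by
    rw [mul_sub, Finset.mul_sum, sub_eq_add_neg, ← Finset.sum_neg_distrib, add_comm]
    congr 1
    · ring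
    · exact Finset.sum_congr rfl fun i _ => by ring
  rw [h6, mul_eq_zero, or_iff_right hne, sub_eq_zero]

theorem CBd.scale {ι : Type*} [Fintype ι] {c : ∀ n, (Fin n → ι) → ℝ} {r : ℝ} (h : CBd c r) {ε : ℝ} (hε : 0 < ε) :
    CBd (fun n w => ε ^ n * c n w) (r / ε) := by
  refine ⟨div_pos h.1 hε, ?_⟩
  obtain ⟨C, hC⟩ := h.2
  refine ⟨C, fun n => ?_⟩
  refine le_of_eq_of_le ?_ (hC n)
  simp only [abs_mul, abs_of_pos (pow_pos hε n), ← Finset.mul_sum]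
  rw [div_pow]
  field_simp

theorem WP {N : ℕ} {f : (Fin N → ℝ) × ℝ → ℝ} (hf : AnalyticAt ℝ f 0)
    (hne : ¬ ∀ᶠ t in 𝓝 (0:ℝ), f (0, t) = 0) :
    ∃ (m : ℕ) (b : (Fin N → ℝ) → (Fin m → ℝ)), AnalyticAt ℝ b 0 ∧ b 0 = 0 ∧
      ∀ᶠ z in 𝓝 (0 : (Fin N → ℝ) × ℝ), (f z = 0 ↔ z.2 ^ m = ∑ i, b z.1 i * z.2 ^ (i:ℕ)) := by
  let e : (Option (Fin N) → ℝ) →L[ℝ] (Fin N → ℝ) × ℝ :=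
    (ContinuousLinearMap.pi fun i => ContinuousLinearMap.proj (some i)).prod (ContinuousLinearMap.proj none)
  have hg : AnalyticAt ℝ (fun y => f (e y)) 0 :=
    AnalyticAt.comp_of_eq hf (e.analyticAt 0) (by simp)
  obtain ⟨c, r, hc, hs⟩ := bc_exists hg
  have hr0 := hc.1
  have hval : ∀ y, ‖y‖ < r → bcf c y = f (e y) := fun y hy => bcf_real hs hy
  have he : ∀ z : (Fin N → ℝ) × ℝ, e (mkA z.1 z.2) = z := by
    intro z; ext <;> simp [e, mkA]
  have hval' : ∀ z : (Fin N → ℝ) × ℝ, ‖z‖ < r → bcf c (mkA z.1 z.2) = f z := fun z hz => by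
    rw [hval _ (mkA_norm hr0 ((norm_fst_le z).trans_lt hz) ((norm_snd_le z).trans_lt hz)), he]
  have hex : ∃ j, c j (fun _ => none) ≠ 0 := by
    by_contra hh
    push Not at hh
    apply hne
    filter_upwards [ball_mem_nhds (0:ℝ) hr0] with t ht
    have ht' : ‖t‖ < r := by simpa using ht
    have h1 := mkA_zero_hasSum hc ht'
    simp only [hh, zero_smul] at h1
    rw [← hval' (0, t) (by simpa [Prod.norm_def] using ht')]
    exact h1.unique hasSum_zero
  classical
  let m := Nat.find hex
  have hm : c m (fun _ => none) ≠ 0 := Nat.find_spec hex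
  have hlt : ∀ j < m, c j (fun _ => none) = 0 := fun j hj => by
    by_contra hh; exact Nat.find_min hex hj hh
  rcases hmm : m with _ | k
  · refine ⟨0, fun _ => 0, analyticAt_const, rfl, ?_⟩
    have hf0 : f 0 ≠ 0 := by
      rw [← hval' 0 (by simpa using hr0)]
      have h1 := mkA_zero_hasSum hc (T := (0:ℝ)) (by simpa using hr0)
      have h2 := hasSum_single (f := fun n => c n (fun _ => none) • (0:ℝ)^n) 0 (by
        intro n hn; simp [hn])
      have h3 := h1.unique h2
      simp only [Prod.fst_zero, Prod.snd_zero]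
      rw [h3]
      rw [hmm] at hm
      simpa using hm
    filter_upwards [hf.continuousAt.eventually_ne hf0] with z hz
    simp [hz]
  · obtain ⟨ε, hε, hε1, hε2⟩ : ∃ ε : ℝ, 0 < ε ∧ ‖shift k‖ < r / ε ∧ ‖shift (k+1)‖ < r / ε := by
      refine ⟨r / (‖shift k‖ + ‖shift (k+1)‖ + 1), by positivity, ?_, ?_⟩
      · rw [div_div_cancel₀ hr0.ne']; linarith [norm_nonneg (shift (k+1))]
      · rw [div_div_cancel₀ hr0.ne']; linarith [norm_nonneg (shift k)]
    rw [hmm] at hm hlt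
    obtain ⟨b, hb, hb0, hbz⟩ := wp_core (hc.scale hε) hε1 hε2 (fun j hj => by simp [hlt j hj])
      (by simpa using ⟨hε.ne', hm⟩)
    have hscale : ∀ y : Option (Fin N) → ℝ, bcf (fun n w => ε ^ n * c n w) y = bcf c (ε • y) := by
      intro y
      unfold bcf
      refine tsum_congr fun n => Finset.sum_congr rfl fun w _ => ?_
      simp only [List.prod_ofFn, Pi.smul_apply, smul_eq_mul, Finset.prod_mul_distrib]
      simp; ring
    refine ⟨k+1, fun x i => ε ^ (k + 1 - (i:ℕ)) * b (ε⁻¹ • x) i, ?_, ?_, ?_⟩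
    · rw [analyticAt_pi_iff]
      intro i
      refine analyticAt_const.mul ?_
      have h1 : AnalyticAt ℝ (fun x : Fin N → ℝ => ε⁻¹ • x) 0 := (analyticAt_const (v := ε⁻¹)).smul analyticAt_id
      exact ((analyticAt_pi_iff.1 hb) i).comp_of_eq h1 (by simp)
    · ext i; simp [hb0]
    · have ht : Tendsto (fun z : (Fin N → ℝ) × ℝ => ε⁻¹ • z) (𝓝 0) (𝓝 0) := by
        have : Continuous (fun z : (Fin N → ℝ) × ℝ => ε⁻¹ • z) := continuous_const_smul _
        simpa using this.tendsto 0
      filter_upwards [ht.eventually hbz, ball_mem_nhds (0 : (Fin N → ℝ) × ℝ) hr0] with z hz hzr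
      rw [hscale] at hz
      have h1 : ε • mkA (ε⁻¹ • z).1 (ε⁻¹ • z).2 = mkA z.1 z.2 := by
        ext o
        rcases o with _ | i <;> simp [mkA, hε.ne']
      rw [h1, hval' z (by simpa using hzr)] at hz
      rw [hz]
      have h2 : ε ^ (k+1) * ∑ i : Fin (k+1), b (ε⁻¹ • z.1) i * (ε⁻¹ * z.2) ^ (i:ℕ) =
          ∑ i : Fin (k+1), ε ^ (k + 1 - (i:ℕ)) * b (ε⁻¹ • z.1) i * z.2 ^ (i:ℕ) := by
        rw [Finset.mul_sum]
        refine Finset.sum_congr rfl fun i _ => ?_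
        have : ε ^ (k+1) = ε ^ (k+1-(i:ℕ)) * ε ^ (i:ℕ) := by rw [← pow_add]; congr 1; omega
        rw [this, mul_pow, inv_pow]
        field_simp
      rw [← h2]
      show (ε⁻¹ * z.2) ^ (k+1) = ∑ i : Fin (k+1), b (ε⁻¹ • z.1) i * (ε⁻¹ * z.2) ^ (i:ℕ) ↔ _
      rw [mul_pow ε⁻¹ z.2 (k+1), inv_pow]
      constructor
      · intro hh; rw [← hh]; field_simp
      · intro hh; rw [hh]; field_simp

end DF
end Part5

section Part6
open Metric Set Filter Topology
open scoped ContDiff NNReal ENNReal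

namespace DF
open Polynomial

/-- complexification of a polynomial -/
noncomputable def cx (p : ℝ[X]) : ℂ[X] := p.map (algebraMap ℝ ℂ)

/-- distinct complex roots -/
noncomputable def CR (p : ℝ[X]) : Finset ℂ := by classical exact (cx p).roots.toFinset

/-- distinct real roots -/
noncomputable def RR (p : ℝ[X]) : Finset ℝ := by classical exact p.roots.toFinset

/-- number of real roots below `t` -/
noncomputable def nu (p : ℝ[X]) (t : ℝ) : ℕ := by classical exact ((RR p).filter (· < t)).card

theorem cx_monic {p : ℝ[X]} (h : p.Monic) : (cx p).Monic := h.map _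

theorem mem_CR {p : ℝ[X]} (h : p.Monic) {z : ℂ} : z ∈ CR p ↔ (cx p).eval z = 0 := by
  classical
  simp [CR, Polynomial.mem_roots (cx_monic h).ne_zero, IsRoot]

theorem mem_RR {p : ℝ[X]} (h : p.Monic) {z : ℝ} : z ∈ RR p ↔ p.eval z = 0 := by
  classical
  simp [RR, Polynomial.mem_roots h.ne_zero, IsRoot]

theorem cx_eval_real (p : ℝ[X]) (t : ℝ) : (cx p).eval (t : ℂ) = ((p.eval t : ℝ) : ℂ) := by
  have := Polynomial.eval_map_algebraMap (B := ℂ) p (t : ℂ)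
  rw [cx, this]
  exact Polynomial.aeval_algebraMap_apply_eq_algebraMap_eval t p

theorem mem_CR_real {p : ℝ[X]} (h : p.Monic) {t : ℝ} : (t : ℂ) ∈ CR p ↔ t ∈ RR p := by
  rw [mem_CR h, mem_RR h, cx_eval_real]; simp

theorem cx_conj (p : ℝ[X]) (z : ℂ) : (cx p).eval (starRingEnd ℂ z) = starRingEnd ℂ ((cx p).eval z) := by
  rw [cx, Polynomial.eval_map_algebraMap, Polynomial.eval_map_algebraMap]
  exact Polynomial.aeval_conj p z

theorem mem_CR_conj {p : ℝ[X]} (h : p.Monic) {z : ℂ} (hz : z ∈ CR p) : starRingEnd ℂ z ∈ CR p := by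
  rw [mem_CR h] at *
  rw [cx_conj, hz, map_zero]

theorem prod_lower {Q : ℂ[X]} (hQ : Q.Monic) {ρ : ℂ} {ε : ℝ} (hε : 0 < ε)
    (h : ∀ l, Q.eval l = 0 → ε ≤ ‖l - ρ‖) : ε ^ Q.natDegree ≤ ‖Q.eval ρ‖ := by
  have hs := IsAlgClosed.splits Q
  rw [hs.eval_eq_prod_roots, hs.natDegree_eq_card_roots, hQ.leadingCoeff, one_mul]
  have h' : ∀ l ∈ Q.roots, ε ≤ ‖ρ - l‖ := fun l hl => by
    rw [norm_sub_rev]; exact h l (Polynomial.isRoot_of_mem_roots hl)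
  generalize Q.roots = s at h'
  induction s using Multiset.induction with
  | empty => simp
  | cons a s ih =>
    rw [Multiset.map_cons, Multiset.prod_cons, Multiset.card_cons, norm_mul, pow_succ']
    exact mul_le_mul (h' a (by simp)) (ih fun l hl => h' l (by simp [hl])) (by positivity) (norm_nonneg _)

theorem eval_iter {p : ℝ[X]} {m : ℕ} (hd : p.natDegree ≤ m) (k : ℕ) (z : ℂ) :
    (derivative^[k] (cx p)).eval z =
      ∑ i ∈ Finset.range (m+1), (((i+k).descFactorial k : ℝ) * p.coeff (i+k) : ℝ) * z ^ i := by
  rw [Polynomial.eval_eq_sum_range' (n := m+1)]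
  · refine Finset.sum_congr rfl fun i _ => ?_
    rw [coeff_iterate_derivative, cx, coeff_map]
    simp
  · refine Nat.lt_succ_of_le ((natDegree_iterate_derivative _ _).trans ?_)
    have := natDegree_map_le (f := algebraMap ℝ ℂ) (p := p)
    unfold cx; omega

theorem eval_iter_real {p : ℝ[X]} {m : ℕ} (hd : p.natDegree ≤ m) (k : ℕ) (z : ℝ) :
    (derivative^[k] p).eval z =
      ∑ i ∈ Finset.range (m+1), (((i+k).descFactorial k : ℝ) * p.coeff (i+k)) * z ^ i := by
  rw [Polynomial.eval_eq_sum_range' (n := m+1)]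
  · refine Finset.sum_congr rfl fun i _ => ?_
    rw [coeff_iterate_derivative]
    simp
  · refine Nat.lt_succ_of_le ((natDegree_iterate_derivative _ _).trans ?_)
    omega

section fam
variable {B : Type*} [TopologicalSpace B] {P : B → ℝ[X]} {m : ℕ} {u0 : B}

theorem cont_eval (hd : ∀ u, (P u).natDegree ≤ m)
    (hc : ∀ j, ContinuousAt (fun u => (P u).coeff j) u0) (k : ℕ) (z0 : ℂ) :
    ContinuousAt (fun q : B × ℂ => (derivative^[k] (cx (P q.1))).eval q.2) (u0, z0) := by
  have : (fun q : B × ℂ => (derivative^[k] (cx (P q.1))).eval q.2) = fun q =>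
      ∑ i ∈ Finset.range (m+1), ((((i+k).descFactorial k : ℝ) * (P q.1).coeff (i+k) : ℝ) : ℂ) * q.2 ^ i := by
    funext q; exact eval_iter (hd _) k _
  rw [this]
  refine tendsto_finsetSum _ fun i _ => ?_
  refine ContinuousAt.mul ?_ (continuousAt_snd.pow i)
  refine Complex.continuous_ofReal.continuousAt.comp ?_
  refine continuousAt_const.mul ?_
  exact ContinuousAt.comp (f := Prod.fst) (g := fun u => (P u).coeff (i+k)) (by exact hc _) continuousAt_fst

theorem EX (hm : ∀ u, (P u).Monic) (hd : ∀ u, (P u).natDegree = m)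
    (hc : ∀ j, ContinuousAt (fun u => (P u).coeff j) u0) {ρ : ℂ} (hρ : ρ ∈ CR (P u0))
    {ε : ℝ} (hε : 0 < ε) : ∀ᶠ u in 𝓝 u0, ∃ l ∈ CR (P u), ‖l - ρ‖ < ε := by
  have h1 : ContinuousAt (fun u => (cx (P u)).eval ρ) u0 := by
    have := cont_eval (fun u => (hd u).le) hc 0 ρ
    exact ContinuousAt.comp (f := fun u => (u, ρ)) (g := fun q : B × ℂ => (cx (P q.1)).eval q.2) this
      (continuousAt_id.prodMk continuousAt_const)
  have h2 : ∀ᶠ u in 𝓝 u0, ‖(cx (P u)).eval ρ‖ < ε ^ m :=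
    h1.norm.eventually (gt_mem_nhds (by
      show ‖(cx (P u0)).eval ρ‖ < ε ^ m
      rw [(mem_CR (hm u0)).1 hρ, norm_zero]; positivity))
  filter_upwards [h2] with u hu
  by_contra hh
  push Not at hh
  have := prod_lower (cx_monic (hm u)) (ρ := ρ) hε (fun l hl => hh l ((mem_CR (hm u)).2 hl))
  rw [cx, (hm u).natDegree_map, hd u] at this
  exact absurd hu (not_lt.2 this)

theorem sum_mult (p : ℝ[X]) (h : p.Monic) : ∑ z ∈ CR p, rootMultiplicity z (cx p) = p.natDegree := by
  classical
  rw [← h.natDegree_map (algebraMap ℝ ℂ)]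
  change _ = (cx p).natDegree
  rw [(IsAlgClosed.splits (cx p)).natDegree_eq_card_roots, ← Multiset.toFinset_sum_count_eq, CR]
  refine Finset.sum_congr (by congr) fun z _ => ?_
  rw [count_roots]

theorem mult_usc (hm : ∀ u, (P u).Monic) (hd : ∀ u, (P u).natDegree = m)
    (hc : ∀ j, ContinuousAt (fun u => (P u).coeff j) u0) (ρ : ℂ) :
    ∃ ε > 0, ∀ᶠ u in 𝓝 u0, ∀ l, ‖l - ρ‖ < ε →
      rootMultiplicity l (cx (P u)) ≤ rootMultiplicity ρ (cx (P u0)) := by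
  set μ := rootMultiplicity ρ (cx (P u0)) with hμ
  -- some derivative of order at most `μ` does not vanish
  have h1 : ∃ k ≤ μ, (derivative^[k] (cx (P u0))).eval ρ ≠ 0 := by
    by_contra hh
    push Not at hh
    exact lt_irrefl μ ((lt_rootMultiplicity_iff_isRoot_iterate_derivative (cx_monic (hm u0)).ne_zero).2 hh)
  obtain ⟨k, hk, hne⟩ := h1
  have h2 := (cont_eval (fun u => (hd u).le) hc k ρ).eventually_ne hne
  rw [nhds_prod_eq] at h2
  obtain ⟨p, hp, q, hq, hpq⟩ := eventually_prod_iff.1 h2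
  obtain ⟨ε, hε, hb⟩ := Metric.eventually_nhds_iff.1 hq
  refine ⟨ε, hε, ?_⟩
  filter_upwards [hp] with u hu l hl
  by_contra hlt
  push Not at hlt
  exact hpq hu (hb (by rwa [dist_eq_norm])) (isRoot_iterate_derivative_of_lt_rootMultiplicity (lt_of_le_of_lt hk hlt))

theorem finset_gap {X : Type*} [NormedAddCommGroup X] (s : Finset X) :
    ∃ ε > 0, ∀ a ∈ s, ∀ b ∈ s, a ≠ b → ε ≤ ‖a - b‖ := by
  classical
  have : ∀ q ∈ s.offDiag, ∀ᶠ ε in 𝓝[>] (0:ℝ), ε ≤ ‖q.1 - q.2‖ := by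
    intro q hq
    rw [Finset.mem_offDiag] at hq
    have : 0 < ‖q.1 - q.2‖ := norm_pos_iff.2 (sub_ne_zero.2 hq.2.2)
    filter_upwards [Ioo_mem_nhdsGT this] with ε hε using hε.2.le
  obtain ⟨ε, hε, h0⟩ := (((Finset.eventually_all _).2 this).and self_mem_nhdsWithin).exists
  exact ⟨ε, h0, fun a ha b hb hab => hε (a, b) (by simp [ha, hb, hab])⟩

theorem loc_complex (hm : ∀ u, (P u).Monic) (hd : ∀ u, (P u).natDegree = m)
    (hc : ∀ j, ContinuousAt (fun u => (P u).coeff j) u0) :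
    ∃ ε₀ > 0, ∀ ε > 0, ε ≤ ε₀ → ∀ᶠ u in 𝓝 u0, (CR (P u)).card = (CR (P u0)).card →
      ∃ g : ℂ → ℂ, (∀ ρ ∈ CR (P u0), g ρ ∈ CR (P u) ∧ ‖g ρ - ρ‖ < ε ∧
          rootMultiplicity (g ρ) (cx (P u)) = rootMultiplicity ρ (cx (P u0))) ∧
        (∀ l ∈ CR (P u), ∃ ρ ∈ CR (P u0), g ρ = l) ∧
        (∀ l ∈ CR (P u), ∀ ρ ∈ CR (P u0), ‖l - ρ‖ < ε₀ → l = g ρ) := by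
  classical
  obtain ⟨ε₁, hε₁, hgap⟩ := finset_gap (CR (P u0))
  choose η hη hus using fun ρ : ℂ => mult_usc hm hd hc ρ
  have hη' : ∀ᶠ ε in 𝓝[>] (0:ℝ), ∀ ρ ∈ CR (P u0), ε < η ρ := by
    rw [Finset.eventually_all]
    intro ρ _
    filter_upwards [Ioo_mem_nhdsGT (hη ρ)] with ε hε using hε.2
  obtain ⟨ε₂, hε₂, h0⟩ := (hη'.and self_mem_nhdsWithin).exists
  have h0 : 0 < ε₂ := h0
  refine ⟨min (ε₁ / 2) ε₂, by positivity, fun ε hε hle => ?_⟩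
  have hle1 : ε ≤ ε₁ / 2 := hle.trans (min_le_left _ _)
  have hle2 : ε ≤ ε₂ := hle.trans (min_le_right _ _)
  have e1 : ∀ᶠ u in 𝓝 u0, ∀ ρ ∈ CR (P u0), ∃ l ∈ CR (P u), ‖l - ρ‖ < ε := by
    rw [Finset.eventually_all]; exact fun ρ hρ => EX hm hd hc hρ hε
  have e2 : ∀ᶠ u in 𝓝 u0, ∀ ρ ∈ CR (P u0), ∀ l, ‖l - ρ‖ < η ρ →
      rootMultiplicity l (cx (P u)) ≤ rootMultiplicity ρ (cx (P u0)) := by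
    rw [Finset.eventually_all]; exact fun ρ hρ => hus ρ
  filter_upwards [e1, e2] with u e1 e2 hcard
  choose! g hg hgε using e1
  have hinj : Set.InjOn g (CR (P u0)) := by
    intro a ha b hb hab
    by_contra hne
    have h1 := hgap a ha b hb hne
    have h2 := hgε a ha
    have h3 := hgε b hb
    rw [← hab] at h3
    have : ‖a - b‖ ≤ ‖g a - a‖ + ‖g a - b‖ := by
      have := norm_sub_le (g a - b) (g a - a)
      have e : g a - b - (g a - a) = a - b := by ring
      rw [e] at this; linarith
    linarith
  have himg : (CR (P u0)).image g = CR (P u) := by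
    refine Finset.eq_of_subset_of_card_le ?_ ?_
    · intro l hl
      obtain ⟨ρ, hρ, rfl⟩ := Finset.mem_image.1 hl
      exact hg ρ hρ
    · rw [Finset.card_image_of_injOn hinj, hcard]
  have hle' : ∀ ρ ∈ CR (P u0), rootMultiplicity (g ρ) (cx (P u)) ≤ rootMultiplicity ρ (cx (P u0)) :=
    fun ρ hρ => e2 ρ hρ _ ((hgε ρ hρ).trans_le (hle2.trans (hε₂ ρ hρ).le))
  have hsum : ∑ ρ ∈ CR (P u0), rootMultiplicity (g ρ) (cx (P u)) = ∑ ρ ∈ CR (P u0), rootMultiplicity ρ (cx (P u0)) := by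
    rw [sum_mult _ (hm u0), ← Finset.sum_image (f := fun l => rootMultiplicity l (cx (P u))) hinj, himg, sum_mult _ (hm u), hd, hd]
  have heq := (Finset.sum_eq_sum_iff_of_le hle').1 hsum
  have hsurj : ∀ l ∈ CR (P u), ∃ ρ ∈ CR (P u0), g ρ = l := fun l hl => by
    rw [← himg] at hl; simpa using hl
  refine ⟨g, fun ρ hρ => ⟨hg ρ hρ, hgε ρ hρ, heq ρ hρ⟩, hsurj, ?_⟩
  intro l hl ρ hρ hlt
  obtain ⟨ρ', hρ', rfl⟩ := hsurj l hl
  by_contra hne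
  have hne' : ρ ≠ ρ' := fun h => hne (by rw [h])
  have h1 := hgap ρ hρ ρ' hρ' hne'
  have h2 := hgε ρ' hρ'
  have : ‖ρ - ρ'‖ ≤ ‖g ρ' - ρ'‖ + ‖g ρ' - ρ‖ := by
    have := norm_sub_le (g ρ' - ρ') (g ρ' - ρ)
    have e : g ρ' - ρ' - (g ρ' - ρ) = ρ - ρ' := by ring
    rw [e] at this; linarith
  have := hlt.trans_le (min_le_left _ _)
  linarith

end fam
end DF
end Part6

section Part7
open Metric Set Filter Topology
open scoped ContDiff NNReal ENNReal

namespace DF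
open Polynomial

theorem cx_mult (p : ℝ[X]) (t : ℝ) : rootMultiplicity (t:ℂ) (cx p) = rootMultiplicity t p :=
  (eq_rootMultiplicity_map (f := algebraMap ℝ ℂ) (algebraMap ℝ ℂ).injective t).symm

section fam
variable {B : Type*} [TopologicalSpace B] {P : B → ℝ[X]} {m : ℕ} {u0 : B}

theorem loc_real (hm : ∀ u, (P u).Monic) (hd : ∀ u, (P u).natDegree = m)
    (hc : ∀ j, ContinuousAt (fun u => (P u).coeff j) u0) :
    ∃ ε₀ > 0, ∀ ε > 0, ∀ᶠ u in 𝓝 u0, (CR (P u)).card = (CR (P u0)).card →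
      ∃ g : ℝ → ℝ, (∀ ρ ∈ RR (P u0), g ρ ∈ RR (P u) ∧ |g ρ - ρ| < ε ∧ |g ρ - ρ| < ε₀ ∧
          rootMultiplicity (g ρ) (P u) = rootMultiplicity ρ (P u0)) ∧
        (∀ l ∈ RR (P u), ∃ ρ ∈ RR (P u0), g ρ = l) ∧
        (∀ l ∈ CR (P u), ∀ ρ ∈ RR (P u0), ‖l - ρ‖ < ε₀ → l = g ρ) := by
  obtain ⟨ε₁, hε₁, H⟩ := loc_complex hm hd hc
  have hi : ∀ᶠ ε in 𝓝[>] (0:ℝ), ∀ ρ ∈ CR (P u0), ρ.im ≠ 0 → ε < |ρ.im| := by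
    rw [Finset.eventually_all]
    intro ρ _
    by_cases h : ρ.im = 0
    · simp [h]
    · filter_upwards [Ioo_mem_nhdsGT (abs_pos.2 h)] with ε hε _ using hε.2
  obtain ⟨ε₂, hε₂, h0⟩ := (hi.and self_mem_nhdsWithin).exists
  have h0 : 0 < ε₂ := h0
  refine ⟨min ε₁ ε₂, by positivity, fun ε hε => ?_⟩
  filter_upwards [H (min ε (min ε₁ ε₂)) (by positivity) ((min_le_right _ _).trans (min_le_left _ _))] with u hu hcard
  obtain ⟨g, hg1, hg2, hg3⟩ := hu hcard
  have hreal : ∀ ρ ∈ RR (P u0), g ρ = ((g ρ).re : ℂ) := by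
    intro ρ hρ
    have hρ' := (mem_CR_real (hm u0)).2 hρ
    obtain ⟨a1, a2, -⟩ := hg1 ρ hρ'
    have h1 : starRingEnd ℂ (g ρ) = g ρ := by
      refine hg3 _ (mem_CR_conj (hm u) a1) ρ hρ' ?_
      have : starRingEnd ℂ (g ρ) - ρ = starRingEnd ℂ (g ρ - ρ) := by simp
      rw [this, Complex.norm_conj]
      exact a2.trans_le ((min_le_right _ _).trans (min_le_left _ _))
    exact (Complex.conj_eq_iff_re.1 h1).symm
  have hnorm : ∀ ρ ∈ RR (P u0), |(g ρ).re - ρ| = ‖g ρ - ρ‖ := by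
    intro ρ hρ
    conv_rhs => rw [hreal ρ hρ, ← Complex.ofReal_sub, Complex.norm_real, Real.norm_eq_abs]
  refine ⟨fun ρ => (g ρ).re, fun ρ hρ => ?_, fun l hl => ?_, fun l hl ρ hρ hlt => ?_⟩
  · have hρ' := (mem_CR_real (hm u0)).2 hρ
    obtain ⟨a1, a2, a3⟩ := hg1 ρ hρ'
    refine ⟨?_, ?_, ?_, ?_⟩
    · rw [← mem_CR_real (hm u), ← hreal ρ hρ]; exact a1
    · show |(g ρ).re - ρ| < ε
      rw [hnorm ρ hρ]; exact a2.trans_le (min_le_left _ _)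
    · show |(g ρ).re - ρ| < _
      rw [hnorm ρ hρ]; exact a2.trans_le (min_le_right _ _)
    · rw [← cx_mult, ← cx_mult, ← hreal ρ hρ]; exact a3
  · obtain ⟨ρ, hρ, hgl⟩ := hg2 l ((mem_CR_real (hm u)).2 hl)
    have him : ρ.im = 0 := by
      by_contra hne
      have h1 := hε₂ ρ hρ hne
      obtain ⟨-, a2, -⟩ := hg1 ρ hρ
      have h2 := (Complex.abs_im_le_norm (g ρ - ρ)).trans_lt a2
      rw [hgl] at h2
      simp only [Complex.sub_im, Complex.ofReal_im, zero_sub, abs_neg] at h2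
      have := h2.trans_le ((min_le_right _ _).trans (min_le_right _ _))
      linarith
    have hρr : ρ = (ρ.re : ℂ) := by apply Complex.ext <;> simp [him]
    refine ⟨ρ.re, ?_, ?_⟩
    · rw [← mem_CR_real (hm u0), ← hρr]; exact hρ
    · show (g (ρ.re : ℂ)).re = l
      rw [← hρr, hgl]; simp
  · have hρ' := (mem_CR_real (hm u0)).2 hρ
    rw [hg3 l hl ρ hρ' (hlt.trans_le (min_le_left _ _))]
    exact hreal ρ hρ

theorem card_RR_loc (hm : ∀ u, (P u).Monic) (hd : ∀ u, (P u).natDegree = m)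
    (hc : ∀ j, ContinuousAt (fun u => (P u).coeff j) u0) :
    ∀ᶠ u in 𝓝 u0, (CR (P u)).card = (CR (P u0)).card → (RR (P u)).card = (RR (P u0)).card := by
  classical
  obtain ⟨ε₀, hε₀, H⟩ := loc_real hm hd hc
  obtain ⟨ε₁, hε₁, hgap⟩ := finset_gap (RR (P u0))
  filter_upwards [H (ε₁/2) (by positivity)] with u hu hcard
  obtain ⟨g, hg1, hg2, hg3⟩ := hu hcard
  symm
  refine Finset.card_bij (fun ρ _ => g ρ) (fun ρ hρ => (hg1 ρ hρ).1) (fun a ha b hb hab => ?_) (fun l hl => ?_)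
  · by_contra hne
    have h1 := hgap a ha b hb hne
    have h2 := abs_lt.1 (hg1 a ha).2.1
    have h3 := abs_lt.1 (hg1 b hb).2.1
    rw [Real.norm_eq_abs] at h1
    rcases le_abs.1 h1 with h | h <;> linarith [h2.1, h2.2, h3.1, h3.2]
  · obtain ⟨ρ, hρ, h⟩ := hg2 l hl
    exact ⟨ρ, hρ, h⟩

theorem nu_loc (hm : ∀ u, (P u).Monic) (hd : ∀ u, (P u).natDegree = m)
    (hc : ∀ j, ContinuousAt (fun u => (P u).coeff j) u0) (t1 : ℝ) :
    ∀ᶠ z in 𝓝 (u0, t1), (CR (P z.1)).card = (CR (P u0)).card →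
      ((P z.1).eval z.2 = 0 ↔ (P u0).eval t1 = 0) → nu (P z.1) z.2 = nu (P u0) t1 := by
  classical
  obtain ⟨ε₀, hε₀, H⟩ := loc_real hm hd hc
  obtain ⟨ε₁, hε₁, hgap⟩ := finset_gap (insert t1 (RR (P u0)))
  have e1 := (continuousAt_fst (p := (u0, t1))).eventually (H (min (ε₁/2) (ε₀/2)) (by positivity))
  have e2 : ∀ᶠ z in 𝓝 (u0, t1), dist z.2 t1 < min (ε₁/2) (ε₀/2) :=
    (continuousAt_snd (p := (u0, t1))).eventually (ball_mem_nhds t1 (by positivity))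
  filter_upwards [e1, e2] with z hz hzt hcard hiff
  obtain ⟨g, hg1, hg2, hg3⟩ := hz hcard
  rw [Real.dist_eq] at hzt
  have hzt1 := abs_lt.1 (hzt.trans_le (min_le_left _ _))
  have key : ∀ ρ ∈ RR (P u0), (g ρ < z.2 ↔ ρ < t1) := by
    intro ρ hρ
    by_cases hρt : ρ = t1
    · subst hρt
      have h1 := (mem_RR (hm u0)).1 hρ
      have h2 := hiff.2 h1
      have h3 := hg3 z.2 ((mem_CR_real (hm _)).2 ((mem_RR (hm _)).2 h2)) ρ hρ (by
        rw [← Complex.ofReal_sub, Complex.norm_real, Real.norm_eq_abs]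
        exact (hzt.trans_le (min_le_right _ _)).trans (by linarith))
      rw [← Complex.ofReal_inj.1 h3]
      simp
    · have h1 := hgap ρ (by simp [hρ]) t1 (by simp) hρt
      have h2 := abs_lt.1 ((hg1 ρ hρ).2.1.trans_le (min_le_left _ _))
      rw [Real.norm_eq_abs] at h1
      rcases le_abs.1 h1 with h | h
      · constructor <;> intro <;> linarith
      · constructor <;> intro <;> linarith
  unfold nu
  symm
  refine Finset.card_bij (fun ρ _ => g ρ) (fun ρ hρ => ?_) (fun a ha b hb hab => ?_) (fun l hl => ?_)
  · simp only [Finset.mem_filter] at hρ ⊢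
    exact ⟨(hg1 ρ hρ.1).1, (key ρ hρ.1).2 hρ.2⟩
  · simp only [Finset.mem_filter] at ha hb
    by_contra hne
    have h1 := hgap a (by simp [ha]) b (by simp [hb]) hne
    have h2 := abs_lt.1 ((hg1 a ha.1).2.1.trans_le (min_le_left _ _))
    have h3 := abs_lt.1 ((hg1 b hb.1).2.1.trans_le (min_le_left _ _))
    rw [Real.norm_eq_abs] at h1
    rcases le_abs.1 h1 with h | h <;> linarith [h2.1, h2.2, h3.1, h3.2]
  · simp only [Finset.mem_filter] at hl
    obtain ⟨ρ, hρ, h⟩ := hg2 l hl.1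
    refine ⟨ρ, ?_, h⟩
    simp only [Finset.mem_filter]
    exact ⟨hρ, (key ρ hρ).1 (by rw [h]; exact hl.2)⟩

end fam

theorem nu_mono (p : ℝ[X]) {s t : ℝ} (h : s ≤ t) : nu p s ≤ nu p t := by
  classical
  unfold nu
  refine Finset.card_le_card fun x hx => ?_
  simp only [Finset.mem_filter] at hx ⊢
  exact ⟨hx.1, hx.2.trans_le h⟩

theorem nu_strict {p : ℝ[X]} {s t : ℝ} (hs : s ∈ RR p) (h : s < t) : nu p s < nu p t := by
  classical
  unfold nu
  refine Finset.card_lt_card (Finset.ssubset_iff_of_subset (fun x hx => ?_) |>.2 ⟨s, ?_, ?_⟩)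
  · simp only [Finset.mem_filter] at hx ⊢
    exact ⟨hx.1, hx.2.trans h⟩
  · simp [hs, h]
  · simp

theorem nu_le (p : ℝ[X]) (t : ℝ) : nu p t ≤ (RR p).card := by
  classical
  exact Finset.card_le_card (Finset.filter_subset _ _)

theorem nu_lt_card {p : ℝ[X]} {t : ℝ} (ht : t ∈ RR p) : nu p t < (RR p).card := by
  exact (nu_strict ht (lt_add_one t)).trans_le (nu_le _ _)

/-- next root -/
theorem next_root {p : ℝ[X]} {t : ℝ} (h : nu p t < (RR p).card) :
    ∃ x ∈ RR p, t ≤ x ∧ nu p x = nu p t := by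
  classical
  have hne : ((RR p).filter (t ≤ ·)).Nonempty := by
    rw [Finset.nonempty_iff_ne_empty]
    intro he
    have : (RR p).filter (· < t) = RR p := by
      rw [Finset.filter_eq_self]
      intro x hx
      by_contra hlt
      have : x ∈ (RR p).filter (t ≤ ·) := by simp [hx, not_lt.1 hlt]
      rw [he] at this
      simp at this
    unfold nu at h
    rw [this] at h
    exact lt_irrefl _ h
  refine ⟨_, (Finset.mem_filter.1 (Finset.min'_mem _ hne)).1, (Finset.mem_filter.1 (Finset.min'_mem _ hne)).2, ?_⟩
  unfold nu
  congr 1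
  ext y
  simp only [Finset.mem_filter, and_congr_right_iff]
  intro hy
  constructor
  · intro hlt
    by_contra hge
    have := Finset.min'_le ((RR p).filter (t ≤ ·)) y (by simp [hy, not_lt.1 hge])
    linarith
  · intro hlt
    exact hlt.trans_le (Finset.mem_filter.1 (Finset.min'_mem _ hne)).2

theorem band_exists {p : ℝ[X]} {ε : ℝ} (hε : 0 < ε) (hR : ∀ x ∈ RR p, |x| < ε) (i : ℕ) (hi : i ≤ (RR p).card) :
    ∃ t, |t| < ε ∧ t ∉ RR p ∧ nu p t = i := by
  classical
  induction i with
  | zero =>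
    have h1 : ∀ᶠ t in 𝓝[>] (-ε), ∀ x ∈ RR p, t < x := by
      rw [Finset.eventually_all]
      intro x hx
      filter_upwards [Ioo_mem_nhdsGT (abs_lt.1 (hR x hx)).1] with t ht using ht.2
    have h2 : ∀ᶠ t in 𝓝[>] (-ε), t ∈ Ioo (-ε) ε := Ioo_mem_nhdsGT (by linarith)
    obtain ⟨t, ht1, ht2⟩ := (h1.and h2).exists
    refine ⟨t, abs_lt.2 ht2, fun h => lt_irrefl _ (ht1 t h), ?_⟩
    unfold nu
    rw [Finset.card_eq_zero, Finset.filter_eq_empty_iff]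
    intro x hx
    exact not_lt.2 (ht1 x hx).le
  | succ i ih =>
    obtain ⟨t, ht, hn, hnu⟩ := ih (by omega)
    obtain ⟨x, hx, htx, hnx⟩ := next_root (p := p) (t := t) (by omega)
    have h1 : ∀ᶠ t in 𝓝[>] x, ∀ y ∈ RR p, x < y → t < y := by
      rw [Finset.eventually_all]
      intro y hy
      by_cases hxy : x < y
      · filter_upwards [Ioo_mem_nhdsGT hxy] with t ht _ using ht.2
      · simp [hxy]
    have h2 : ∀ᶠ t in 𝓝[>] x, t ∈ Ioo x ε := Ioo_mem_nhdsGT (abs_lt.1 (hR x hx)).2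
    obtain ⟨s, hs1, hs2⟩ := (h1.and h2).exists
    refine ⟨s, abs_lt.2 ⟨(abs_lt.1 (hR x hx)).1.trans hs2.1, hs2.2⟩, fun h => lt_irrefl _ (hs1 s h hs2.1), ?_⟩
    have : (RR p).filter (· < s) = insert x ((RR p).filter (· < x)) := by
      ext y
      simp only [Finset.mem_filter, Finset.mem_insert]
      constructor
      · rintro ⟨hy, hys⟩
        rcases lt_trichotomy y x with h | h | h
        · exact Or.inr ⟨hy, h⟩
        · exact Or.inl h
        · exact absurd (hs1 y hy h) (not_lt.2 hys.le)
      · rintro (rfl | ⟨hy, h⟩)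
        · exact ⟨hx, hs2.1⟩
        · exact ⟨hy, h.trans hs2.1⟩
    have h3 : nu p s = nu p x + 1 := by
      unfold nu
      rw [this, Finset.card_insert_of_notMem (by simp)]
    omega

theorem graph_exists {p : ℝ[X]} {ε : ℝ} (hε : 0 < ε) (hR : ∀ x ∈ RR p, |x| < ε) (i : ℕ) (hi : i < (RR p).card) :
    ∃ t ∈ RR p, nu p t = i := by
  obtain ⟨t, -, -, ht⟩ := band_exists hε hR i hi.le
  obtain ⟨x, hx, -, h⟩ := next_root (p := p) (t := t) (by omega)
  exact ⟨x, hx, by omega⟩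

/-- roots are small when the lower coefficients are small -/
theorem small_roots {B : Type*} [TopologicalSpace B] {P : B → ℝ[X]} {m : ℕ} {u0 : B}
    (hm : ∀ u, (P u).Monic) (hd : ∀ u, (P u).natDegree = m)
    (hc : ∀ j, ContinuousAt (fun u => (P u).coeff j) u0) (h0 : P u0 = X ^ m) {ε : ℝ} (hε : 0 < ε) :
    ∀ᶠ u in 𝓝 u0, ∀ x ∈ RR (P u), |x| < ε := by
  have hS : 0 < ∑ i ∈ Finset.range m, ((ε⁻¹) ^ (m - i)) + 1 := by positivity
  set S := ∑ i ∈ Finset.range m, ((ε⁻¹) ^ (m - i)) + 1 with hSdef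
  have h1 : ∀ᶠ u in 𝓝 u0, ∀ i ∈ Finset.range m, |(P u).coeff i| < S⁻¹ := by
    rw [Finset.eventually_all]
    intro i hi
    refine (hc i).abs.eventually (gt_mem_nhds ?_)
    show |(P u0).coeff i| < S⁻¹
    rw [h0, coeff_X_pow, if_neg (Finset.mem_range.1 hi).ne, abs_zero]
    positivity
  filter_upwards [h1] with u hu x hx
  by_contra hge
  push Not at hge
  have hx0 : 0 < |x| := hε.trans_le hge
  have h2 := (mem_RR (hm u)).1 hx
  rw [eval_eq_sum_range, hd, Finset.sum_range_succ] at h2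
  have h3 : (P u).coeff m = 1 := by have := (hm u).coeff_natDegree; rwa [hd] at this
  rw [h3, one_mul] at h2
  have h4 : |x| ^ m ≤ ∑ i ∈ Finset.range m, |(P u).coeff i| * |x| ^ i := by
    have : x ^ m = - ∑ i ∈ Finset.range m, (P u).coeff i * x ^ i := by linarith
    rw [← abs_pow, this, abs_neg]
    refine (Finset.abs_sum_le_sum_abs _ _).trans (le_of_eq ?_)
    exact Finset.sum_congr rfl fun i _ => by rw [abs_mul, abs_pow]
  have h5 : ∑ i ∈ Finset.range m, |(P u).coeff i| * |x| ^ i ≤ ∑ i ∈ Finset.range m, S⁻¹ * (|x| ^ m * (ε⁻¹) ^ (m - i)) := by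
    refine Finset.sum_le_sum fun i hi => ?_
    refine mul_le_mul (hu i hi).le ?_ (by positivity) (by positivity)
    have hi' := Finset.mem_range.1 hi
    have : |x| ^ m = |x| ^ i * |x| ^ (m - i) := by rw [← pow_add]; congr 1; omega
    rw [this, mul_assoc, ← mul_pow]
    have : 1 ≤ |x| * ε⁻¹ := by rw [← div_eq_mul_inv, le_div_iff₀ hε]; linarith
    exact le_mul_of_one_le_right (by positivity) (one_le_pow₀ this)
  rw [← Finset.mul_sum, ← Finset.mul_sum] at h5
  have h6 : ∑ i ∈ Finset.range m, ((ε⁻¹) ^ (m - i)) = S - 1 := by rw [hSdef]; ring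
  rw [h6] at h5
  have h7 : S⁻¹ * (|x| ^ m * (S - 1)) < |x| ^ m := by
    have : 0 < |x| ^ m := by positivity
    rw [inv_mul_lt_iff₀ hS]
    nlinarith
  linarith

end DF
end Part7

section Part8
open Metric Set Filter Topology
open scoped ContDiff NNReal ENNReal

namespace DF
open Polynomial

noncomputable def Dl (m s : ℕ) : MvPolynomial (Fin m) ℝ :=
  ∑ I ∈ Finset.powersetCard s (Finset.univ : Finset (Fin m)),
    ∏ q ∈ I.offDiag, (MvPolynomial.X q.1 - MvPolynomial.X q.2)

theorem Dl_symm (m s : ℕ) : (Dl m s).IsSymmetric := by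
  classical
  intro e
  unfold Dl
  rw [map_sum]
  refine Finset.sum_bij (fun I _ => I.map e.toEmbedding) ?_ ?_ ?_ ?_
  · intro I hI
    simp only [Finset.mem_powersetCard, Finset.subset_univ, true_and, Finset.card_map] at hI ⊢
    exact hI
  · intro I _ J _ h
    exact Finset.map_injective _ h
  · intro J hJ
    refine ⟨J.map e.symm.toEmbedding, ?_, ?_⟩
    · simp only [Finset.mem_powersetCard, Finset.subset_univ, true_and, Finset.card_map] at hJ ⊢
      exact hJ
    · ext x; simp
  · intro I _
    rw [map_prod]
    refine Finset.prod_bij (fun q _ => (e q.1, e q.2)) ?_ ?_ ?_ ?_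
    · intro q hq
      simp only [Finset.mem_offDiag, Finset.mem_map_equiv, Equiv.symm_apply_apply] at hq ⊢
      exact ⟨hq.1, hq.2.1, fun h => hq.2.2 (e.injective h)⟩
    · intro q _ q' _ h
      simp only [Prod.mk.injEq, EmbeddingLike.apply_eq_iff_eq] at h
      exact Prod.ext h.1 h.2
    · intro q hq
      simp only [Finset.mem_offDiag, Finset.mem_map_equiv] at hq
      exact ⟨(e.symm q.1, e.symm q.2), by
        simp only [Finset.mem_offDiag]
        exact ⟨hq.1, hq.2.1, fun h => hq.2.2 (e.symm.injective h)⟩, by simp⟩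
    · intro q _
      simp

theorem tuple_exists {α : Type*} (s : Multiset α) {m : ℕ} (h : s.card = m) :
    ∃ ρ : Fin m → α, Multiset.map ρ Finset.univ.val = s := by
  subst h
  induction s using Quotient.inductionOn with
  | _ l => 
    refine ⟨fun i => l.get ⟨i, by simpa using i.2⟩, ?_⟩
    rw [Fin.univ_val_map]
    simp only [Multiset.quot_mk_to_coe, Multiset.coe_eq_coe]
    have : List.ofFn (fun i : Fin (Multiset.card (l : Multiset α)) => l.get ⟨i, by simpa using i.2⟩) = l := by
      apply List.ext_get
      · simp
      · intro n h1 h2; simp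
    exact List.Perm.of_eq this

theorem Dl_eval {m s : ℕ} (ρ : Fin m → ℂ) : MvPolynomial.aeval ρ (Dl m s) =
    ∑ I ∈ Finset.powersetCard s (Finset.univ : Finset (Fin m)), ∏ q ∈ I.offDiag, (ρ q.1 - ρ q.2) := by
  simp [Dl, map_sum, map_prod]

theorem Dl_zero {m s : ℕ} (ρ : Fin m → ℂ) {R : Finset ℂ} (hR : ∀ i, ρ i ∈ R) (hs : R.card < s) :
    MvPolynomial.aeval ρ (Dl m s) = 0 := by
  rw [Dl_eval]
  refine Finset.sum_eq_zero fun I hI => ?_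
  rw [Finset.mem_powersetCard] at hI
  obtain ⟨x, hx, y, hy, hne, he⟩ := Finset.exists_ne_map_eq_of_card_lt_of_maps_to (s := I) (t := R) (f := ρ) (by omega)
    (fun i _ => hR i)
  exact Finset.prod_eq_zero (i := (x, y)) (by simp [hx, hy, hne]) (by simp [he])

theorem Dl_ne {m s : ℕ} (ρ : Fin m → ℂ) {R : Finset ℂ} (hR : ∀ i, ρ i ∈ R) (hR' : ∀ z ∈ R, ∃ i, ρ i = z)
    (hs : R.card = s) : MvPolynomial.aeval ρ (Dl m s) ≠ 0 := by
  classical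
  rw [Dl_eval]
  set K : ℂ := ∏ q ∈ R.offDiag, (q.1 - q.2) with hK
  have hK0 : K ≠ 0 := by
    rw [hK, Finset.prod_ne_zero_iff]
    intro q hq
    rw [Finset.mem_offDiag] at hq
    exact sub_ne_zero.2 hq.2.2
  have h1 : ∀ I ∈ Finset.powersetCard s (Finset.univ : Finset (Fin m)),
      ∏ q ∈ I.offDiag, (ρ q.1 - ρ q.2) = if Set.InjOn ρ I then K else 0 := by
    intro I hI
    rw [Finset.mem_powersetCard] at hI
    split_ifs with hinj
    · have himg : I.image ρ = R := by
        refine Finset.eq_of_subset_of_card_le (fun z hz => ?_) ?_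
        · obtain ⟨i, _, rfl⟩ := Finset.mem_image.1 hz; exact hR i
        · rw [Finset.card_image_of_injOn hinj]; omega
      rw [hK, ← himg]
      refine Finset.prod_bij (fun q _ => (ρ q.1, ρ q.2)) ?_ ?_ ?_ ?_
      · intro q hq
        simp only [Finset.mem_offDiag] at hq ⊢
        exact ⟨Finset.mem_image_of_mem _ hq.1, Finset.mem_image_of_mem _ hq.2.1, fun h => hq.2.2 (hinj hq.1 hq.2.1 h)⟩
      · intro q hq q' hq' h
        simp only [Finset.mem_offDiag] at hq hq'
        simp only [Prod.mk.injEq] at h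
        exact Prod.ext (hinj hq.1 hq'.1 h.1) (hinj hq.2.1 hq'.2.1 h.2)
      · intro q hq
        simp only [Finset.mem_offDiag, Finset.mem_image] at hq
        obtain ⟨⟨a, ha, ha'⟩, ⟨b, hb, hb'⟩, hne⟩ := hq
        refine ⟨(a, b), ?_, by simp [ha', hb']⟩
        simp only [Finset.mem_offDiag]
        refine ⟨ha, hb, fun h => hne ?_⟩
        rw [← ha', ← hb', h]
      · intro q _; rfl
    · unfold Set.InjOn at hinj
      push Not at hinj
      obtain ⟨x, hx, y, hy, he, hne⟩ := hinj
      exact Finset.prod_eq_zero (i := (x, y)) (by simpa [hne] using ⟨hx, hy⟩) (by simp [he])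
  rw [Finset.sum_congr rfl h1, ← Finset.sum_filter, Finset.sum_const, nsmul_eq_mul]
  refine mul_ne_zero ?_ hK0
  rw [Nat.cast_ne_zero, Finset.card_ne_zero]
  rcases R.eq_empty_or_nonempty with rfl | hRn
  · refine ⟨∅, ?_⟩
    simp only [Finset.mem_filter, Finset.mem_powersetCard]
    refine ⟨⟨by simp, by simpa using hs⟩, by simp⟩
  haveI : Nonempty (Fin m) := let ⟨z, hz⟩ := hRn; let ⟨i, _⟩ := hR' z hz; ⟨i⟩
  choose! σ hσ using hR'
  have hinj : Set.InjOn σ R := fun a ha b hb h => by rw [← hσ a ha, ← hσ b hb, h]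
  refine ⟨R.image σ, ?_⟩
  simp only [Finset.mem_filter, Finset.mem_powersetCard, Finset.subset_univ, true_and]
  refine ⟨by rw [Finset.card_image_of_injOn hinj, hs], ?_⟩
  intro x hx y hy h
  simp only [Finset.coe_image, Set.mem_image, Finset.mem_coe] at hx hy
  obtain ⟨a, ha, rfl⟩ := hx
  obtain ⟨b, hb, rfl⟩ := hy
  rw [hσ a ha, hσ b hb] at h
  rw [h]

theorem count_detect (m s : ℕ) : ∃ Q : MvPolynomial (Fin m) ℝ, ∀ p : ℝ[X], p.Monic → p.natDegree = m →
    ((CR p).card = s → MvPolynomial.eval (fun i : Fin m => (-1) ^ ((i:ℕ)+1) * p.coeff (m - ((i:ℕ)+1))) Q ≠ 0) ∧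
    ((CR p).card < s → MvPolynomial.eval (fun i : Fin m => (-1) ^ ((i:ℕ)+1) * p.coeff (m - ((i:ℕ)+1))) Q = 0) := by
  classical
  obtain ⟨Q, hQ⟩ := MvPolynomial.esymmAlgHom_surjective (σ := Fin m) ℝ (n := m) (by simp) ⟨Dl m s, Dl_symm m s⟩
  refine ⟨Q, fun p hp hd => ?_⟩
  have hsp := IsAlgClosed.splits (cx p)
  have hdc : (cx p).natDegree = m := by rw [cx, hp.natDegree_map, hd]
  have hcard : (cx p).roots.card = m := by rw [← hsp.natDegree_eq_card_roots, hdc]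
  obtain ⟨ρ, hρ⟩ := tuple_exists _ hcard
  have hR : ∀ i, ρ i ∈ CR p := fun i => by
    simp only [CR, Multiset.mem_toFinset]
    rw [← hρ]; exact Multiset.mem_map_of_mem _ (by simp)
  have hR' : ∀ z ∈ CR p, ∃ i, ρ i = z := fun z hz => by
    simp only [CR, Multiset.mem_toFinset] at hz
    rw [← hρ] at hz; simpa using hz
  have hD : Dl m s = MvPolynomial.aeval (fun i : Fin m => MvPolynomial.esymm (Fin m) ℝ (i+1)) Q := by
    have := congrArg Subtype.val hQ
    rw [← MvPolynomial.esymmAlgHom_apply (n := m), hQ]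
  have hval : MvPolynomial.aeval ρ (Dl m s) =
      ((MvPolynomial.eval (fun i : Fin m => (-1) ^ ((i:ℕ)+1) * p.coeff (m - ((i:ℕ)+1))) Q : ℝ) : ℂ) := by
    rw [hD]
    have h1 : MvPolynomial.aeval ρ (MvPolynomial.aeval (fun i : Fin m => MvPolynomial.esymm (Fin m) ℝ (i+1)) Q) =
      MvPolynomial.aeval (fun i : Fin m => MvPolynomial.aeval ρ (MvPolynomial.esymm (Fin m) ℝ (i+1))) Q := by
      rw [← AlgHom.comp_apply, MvPolynomial.comp_aeval]
    rw [h1]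
    have h2 : (fun i : Fin m => MvPolynomial.aeval ρ (MvPolynomial.esymm (Fin m) ℝ ((i:ℕ)+1))) =
        fun i : Fin m => algebraMap ℝ ℂ ((-1) ^ ((i:ℕ)+1) * p.coeff (m - ((i:ℕ)+1))) := by
      funext i
      rw [MvPolynomial.aeval_esymm_eq_multiset_esymm, hρ]
      have h3 := Polynomial.coeff_eq_esymm_roots_of_card (p := cx p) (by rw [hcard, hdc]) (k := m - ((i:ℕ)+1)) (by omega)
      rw [hdc, (cx_monic hp).leadingCoeff, one_mul] at h3
      have h4 : m - (m - ((i:ℕ)+1)) = (i:ℕ)+1 := by omega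
      rw [h4] at h3
      have h5 : algebraMap ℝ ℂ (p.coeff (m - ((i:ℕ)+1))) = (cx p).coeff (m - ((i:ℕ)+1)) := by
        rw [cx, coeff_map]
      rw [map_mul, h5, h3, ← mul_assoc]
      simp [← mul_pow]
    rw [h2]
    have := MvPolynomial.aeval_algebraMap_apply (B := ℂ) (fun i : Fin m => (-1) ^ ((i:ℕ)+1) * p.coeff (m - ((i:ℕ)+1))) Q
    rw [MvPolynomial.aeval_eq_eval] at this
    exact this
  constructor
  · intro hs h0
    refine Dl_ne ρ hR hR' hs ?_
    rw [hval, h0]; simp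
  · intro hs
    have := Dl_zero ρ hR hs
    rw [hval] at this
    exact_mod_cast this

theorem CR_card_le {p : ℝ[X]} (hp : p.Monic) : (CR p).card ≤ p.natDegree := by
  classical
  unfold CR
  refine (Multiset.toFinset_card_le _).trans ?_
  rw [← hp.natDegree_map (algebraMap ℝ ℂ)]
  exact card_roots' _

end DF
end Part8

section Part9
open Metric Set Filter Topology
open scoped ContDiff NNReal ENNReal

namespace DF
open Polynomial

theorem conn_fib {B : Type*} [TopologicalSpace B] {C : Set B} (hC : IsPreconnected C) {S : Set (B × ℝ)}
    (hSC : ∀ z ∈ S, z.1 ∈ C) (hfib : ∀ u ∈ C, IsPreconnected {t | (u, t) ∈ S})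
    (hlsc : ∀ z ∈ S, ∀ W ∈ 𝓝 z, ∀ᶠ u in 𝓝 z.1, u ∈ C → ∃ t, (u, t) ∈ S ∧ (u, t) ∈ W)
    (hne : ∀ u ∈ C, ∀ᶠ v in 𝓝 u, v ∈ C → (∃ t, (v, t) ∈ S) → ∃ t, (u, t) ∈ S) : IsPreconnected S := by
  refine isPreconnected_of_forall_constant fun f hf x hx y hy => ?_
  let F : B → Set Bool := fun u => {b | ∃ t, (u, t) ∈ S ∧ f (u, t) = b}
  have huniq : ∀ u ∈ C, ∀ t t', (u, t) ∈ S → (u, t') ∈ S → f (u, t) = f (u, t') := by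
    intro u hu t t' ht ht'
    have h1 : ContinuousOn (fun t => f (u, t)) {t | (u, t) ∈ S} :=
      hf.comp (Continuous.continuousOn (by fun_prop)) (fun t ht => ht)
    refine preconn_const (hfib u hu) (fun t => f (u, t)) (fun y hy => ?_) ht ht'
    have h2 : ∀ᶠ t in 𝓝[{t | (u, t) ∈ S}] y, f (u, t) = f (u, y) :=
      (h1 y hy).eventually (p := fun b => b = f (u, y)) (by rw [nhds_discrete]; simp)
    exact eventually_nhdsWithin_iff.1 h2
  have hF : F x.1 = F y.1 := by
    refine preconn_const hC F (fun u hu => ?_) (hSC x hx) (hSC y hy)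
    by_cases hemp : ∃ t, (u, t) ∈ S
    · obtain ⟨t0, ht0⟩ := hemp
      have h1 : ∀ᶠ z in 𝓝[S] (u, t0), f z = f (u, t0) :=
        (hf (u, t0) ht0).eventually (p := fun b => b = f (u, t0)) (by rw [nhds_discrete]; simp)
      rw [eventually_nhdsWithin_iff] at h1
      filter_upwards [hlsc (u, t0) ht0 _ h1] with v hv hvC
      obtain ⟨t, htS, htW⟩ := hv hvC
      have h2 := htW htS
      ext b
      constructor
      · rintro ⟨t', ht', rfl⟩
        exact ⟨t0, ht0, by rw [← h2]; exact huniq v hvC _ _ htS ht'⟩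
      · rintro ⟨t', ht', rfl⟩
        exact ⟨t, htS, by rw [h2]; exact huniq u hu _ _ ht0 ht'⟩
    · filter_upwards [hne u hu] with v hv hvC
      have h3 : ¬ ∃ t, (v, t) ∈ S := fun h => hemp (hv hvC h)
      ext b
      constructor
      · rintro ⟨t', ht', rfl⟩; exact (h3 ⟨t', ht'⟩).elim
      · rintro ⟨t', ht', rfl⟩; exact (hemp ⟨t', ht'⟩).elim
  have : f x ∈ F y.1 := by rw [← hF]; exact ⟨x.2, hx, rfl⟩
  obtain ⟨t, ht, hft⟩ := this
  rw [← hft]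
  exact huniq y.1 (hSC y hy) _ _ ht hy

section LSprod
variable {B : Type*} [NormedAddCommGroup B] [NormedSpace ℝ B]

theorem LS.graph {d : ℕ} {C : Set B} {u0 : B} {t0 : ℝ} (h : LS d C u0) {g : B × ℝ → ℝ}
    (hg : AnalyticAt ℝ g (u0, t0)) (hgt : fderiv ℝ g (u0, t0) (0, 1) ≠ 0) {S : Set (B × ℝ)}
    (hS : ∀ᶠ z in 𝓝 (u0, t0), (z ∈ S ↔ z.1 ∈ C ∧ g z = 0)) : LS (d+1) S (u0, t0) := by
  obtain ⟨F, hF, hsurj, hiff⟩ := h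
  have hF1 : AnalyticAt ℝ (fun z : B × ℝ => F z.1) (u0, t0) := hF.comp_of_eq analyticAt_fst rfl
  have han : AnalyticAt ℝ (fun z : B × ℝ => (Fin.cons (g z) (F z.1) : Fin (d+1) → ℝ)) (u0, t0) := by
    rw [analyticAt_pi_iff]
    intro i
    refine Fin.cases ?_ (fun j => ?_) i
    · simpa using hg
    · simpa using (analyticAt_pi_iff.1 hF1) j
  refine ⟨_, han, ?_, ?_⟩
  · intro w
    obtain ⟨du, hdu⟩ := hsurj (fun j => w j.succ)
    have h1 : ∀ v i, fderiv ℝ (fun z : B × ℝ => (Fin.cons (g z) (F z.1) : Fin (d+1) → ℝ)) (u0, t0) v i =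
        fderiv ℝ (fun z : B × ℝ => (Fin.cons (g z) (F z.1) : Fin (d+1) → ℝ) i) (u0, t0) v := by
      intro v i
      have := hasFDerivAt_pi'.1 han.differentiableAt.hasFDerivAt i
      rw [this.fderiv]; rfl
    have h2 : fderiv ℝ (fun z : B × ℝ => F z.1) (u0, t0) = (fderiv ℝ F u0).comp (ContinuousLinearMap.fst ℝ B ℝ) := by
      have := (show HasFDerivAt F (fderiv ℝ F u0) ((u0, t0) : B × ℝ).1 from hF.differentiableAt.hasFDerivAt).comp
        ((u0, t0) : B × ℝ) (hasFDerivAt_fst)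
      exact this.fderiv
    refine ⟨(du, (w 0 - fderiv ℝ g (u0, t0) (du, 0)) / fderiv ℝ g (u0, t0) (0, 1)), ?_⟩
    ext i
    rw [h1]
    refine Fin.cases ?_ (fun j => ?_) i
    · simp only [Fin.cons_zero]
      have : ((du, (w 0 - fderiv ℝ g (u0, t0) (du, 0)) / fderiv ℝ g (u0, t0) (0, 1)) : B × ℝ) =
        (du, 0) + ((w 0 - fderiv ℝ g (u0, t0) (du, 0)) / fderiv ℝ g (u0, t0) (0, 1)) • ((0 : B), (1 : ℝ)) := by
        simp
      rw [this, map_add, map_smul, smul_eq_mul]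
      field_simp
      ring
    · simp only [Fin.cons_succ]
      have h3 := hasFDerivAt_pi'.1 hF1.differentiableAt.hasFDerivAt j
      rw [h3.fderiv, h2]
      simp only [ContinuousLinearMap.comp_apply, ContinuousLinearMap.proj_apply, ContinuousLinearMap.coe_fst']
      rw [hdu]
  · filter_upwards [hS, (continuousAt_fst (p := (u0, t0))).eventually hiff] with z hz hz'
    rw [hz, hz']
    constructor
    · rintro ⟨h1, h2⟩
      ext i
      refine Fin.cases ?_ (fun j => ?_) i
      · simpa using h2
      · simpa using congrFun h1 j
    · intro h
      refine ⟨?_, by simpa using congrFun h 0⟩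
      ext j
      simpa using congrFun h j.succ

theorem LS.band {d : ℕ} {C : Set B} {u0 : B} {t0 : ℝ} (h : LS d C u0) {S : Set (B × ℝ)}
    (hS : ∀ᶠ z in 𝓝 (u0, t0), (z ∈ S ↔ z.1 ∈ C)) : LS d S (u0, t0) := by
  obtain ⟨F, hF, hsurj, hiff⟩ := h
  have hF1 : AnalyticAt ℝ (fun z : B × ℝ => F z.1) (u0, t0) := hF.comp_of_eq analyticAt_fst rfl
  refine ⟨_, hF1, ?_, ?_⟩
  · have h2 : fderiv ℝ (fun z : B × ℝ => F z.1) (u0, t0) = (fderiv ℝ F u0).comp (ContinuousLinearMap.fst ℝ B ℝ) := by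
      have := (show HasFDerivAt F (fderiv ℝ F u0) ((u0, t0) : B × ℝ).1 from hF.differentiableAt.hasFDerivAt).comp
        ((u0, t0) : B × ℝ) (hasFDerivAt_fst)
      exact this.fderiv
    rw [h2]
    intro w
    obtain ⟨du, hdu⟩ := hsurj w
    exact ⟨(du, 0), by simpa using hdu⟩
  · filter_upwards [hS, (continuousAt_fst (p := (u0, t0))).eventually hiff] with z hz hz'
    rw [hz, hz']
end LSprod

/-- the cells over `C` -/
def cellS {B : Type*} (C : Set B) (P : B → ℝ[X]) (ε : ℝ) (b : Bool) (i : ℕ) : Set (B × ℝ) :=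
  {z | z.1 ∈ C ∧ |z.2| < ε ∧ ((P z.1).eval z.2 = 0 ↔ b = true) ∧ nu (P z.1) z.2 = i}

section cell
variable {B : Type*} [NormedAddCommGroup B] [NormedSpace ℝ B] {P : B → ℝ[X]} {m : ℕ} {C : Set B} {ε : ℝ}

theorem cont_real (hd : ∀ u, (P u).natDegree = m) {u0 : B}
    (hc : ∀ j, ContinuousAt (fun u => (P u).coeff j) u0) (k : ℕ) (t0 : ℝ) :
    ContinuousAt (fun q : B × ℝ => (derivative^[k] (P q.1)).eval q.2) (u0, t0) := by
  simp only [fun q : B × ℝ => eval_iter_real (hd q.1).le k q.2]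
  refine tendsto_finsetSum _ fun i _ => ?_
  refine ContinuousAt.mul ?_ (continuousAt_snd.pow i)
  refine continuousAt_const.mul ?_
  exact ContinuousAt.comp (f := Prod.fst) (g := fun u => (P u).coeff (i+k)) (by exact hc _) continuousAt_fst

theorem an_real (hd : ∀ u, (P u).natDegree = m) {u0 : B}
    (hc : ∀ j, AnalyticAt ℝ (fun u => (P u).coeff j) u0) (k : ℕ) (t0 : ℝ) :
    AnalyticAt ℝ (fun q : B × ℝ => (derivative^[k] (P q.1)).eval q.2) (u0, t0) := by
  simp only [fun q : B × ℝ => eval_iter_real (hd q.1).le k q.2]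
  refine Finset.analyticAt_fun_sum _ fun i _ => ?_
  refine AnalyticAt.mul ?_ (analyticAt_snd.pow i)
  refine analyticAt_const.mul ?_
  exact AnalyticAt.comp_of_eq (f := Prod.fst) (g := fun u => (P u).coeff (i+k)) (hc _) analyticAt_fst rfl

theorem cell_fib (hm : ∀ u, (P u).Monic) (b : Bool) (i : ℕ) (u : B) :
    IsPreconnected {t | (u, t) ∈ cellS C P ε b i} := by
  refine Set.OrdConnected.isPreconnected ⟨fun x hx y hy z hz => ?_⟩
  obtain ⟨hx1, hx2, hx3, hx4⟩ := hx
  obtain ⟨hy1, hy2, hy3, hy4⟩ := hy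
  simp only at hx1 hx2 hx3 hx4 hy1 hy2 hy3 hy4
  have hnu : nu (P u) z = i := le_antisymm (hy4 ▸ nu_mono _ hz.2) (hx4 ▸ nu_mono _ hz.1)
  refine ⟨hx1, abs_lt.2 ⟨(abs_lt.1 hx2).1.trans_le hz.1, lt_of_le_of_lt hz.2 (abs_lt.1 hy2).2⟩, ?_, hnu⟩
  cases b with
  | true =>
    have hx0 := hx3.2 rfl
    rcases hz.1.eq_or_lt with rfl | hlt
    · exact hx3
    · have h9 : nu (P u) x < nu (P u) z := nu_strict ((mem_RR (hm u)).2 hx0) hlt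
      have hx5 : nu (P u) x = i := hx4
      omega
  | false =>
    refine ⟨fun hz0 => ?_, fun h => by simp at h⟩
    rcases hz.2.eq_or_lt with rfl | hlt
    · exact hy3.1 hz0
    · have h9 : nu (P u) z < nu (P u) y := nu_strict ((mem_RR (hm u)).2 hz0) hlt
      have hy5 : nu (P u) y = i := hy4
      omega

theorem cell_lsc (hm : ∀ u, (P u).Monic) (hd : ∀ u, (P u).natDegree = m)
  (hc : ∀ u ∈ C, ∀ j, ContinuousAt (fun u => (P u).coeff j) u)
  (hcard : ∀ u ∈ C, ∀ v ∈ C, (CR (P u)).card = (CR (P v)).card) {b : Bool} {i : ℕ} {z : B × ℝ} (hz : z ∈ cellS C P ε b i) {W : Set (B × ℝ)} (hW : W ∈ 𝓝 z) :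
    ∀ᶠ u in 𝓝 z.1, u ∈ C → ∃ t, (u, t) ∈ cellS C P ε b i ∧ (u, t) ∈ W := by
  obtain ⟨u0, t0⟩ := z
  obtain ⟨hz1, hz2, hz3, hz4⟩ := hz
  simp only at hz1 hz2 hz3 hz4 ⊢
  have e1 : ∀ᶠ z in 𝓝 (u0, t0), |z.2| < ε :=
    (continuousAt_snd (p := (u0, t0))).abs.eventually (gt_mem_nhds hz2)
  have e2 := nu_loc hm hd (hc u0 hz1) t0
  have e3 : ∀ᶠ z in 𝓝 (u0, t0), z ∈ W := hW
  have e4 := e1.and (e2.and e3)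
  rw [nhds_prod_eq] at e4
  obtain ⟨p, hp, q, hq, hpq⟩ := eventually_prod_iff.1 e4
  obtain ⟨δ, hδ, hb⟩ := Metric.eventually_nhds_iff.1 hq
  have key : ∀ᶠ u in 𝓝 u0, u ∈ C → ∃ t, |t - t0| < δ ∧ ((P u).eval t = 0 ↔ b = true) := by
    cases b with
    | true =>
      obtain ⟨ε₀, hε₀, H⟩ := loc_real hm hd (hc u0 hz1)
      filter_upwards [H δ hδ] with u hu huC
      obtain ⟨g, hg1, -, -⟩ := hu (hcard _ huC _ hz1)
      obtain ⟨a1, a2, -⟩ := hg1 t0 ((mem_RR (hm _)).2 (hz3.2 rfl))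
      exact ⟨g t0, a2, by simpa using (mem_RR (hm _)).1 a1⟩
    | false =>
      have h0 : (P u0).eval t0 ≠ 0 := fun h => by simpa using hz3.1 h
      have h1 := (cont_real hd (hc u0 hz1) 0 t0).eventually_ne h0
      have h2 : ContinuousAt (fun u : B => (u, t0)) u0 := by fun_prop
      filter_upwards [h2.eventually h1] with u hu _
      exact ⟨t0, by simpa using hδ, by simpa using hu⟩
  filter_upwards [hp, key] with u hu hk huC
  obtain ⟨t, ht1, ht2⟩ := hk huC
  obtain ⟨a1, a2, a3⟩ := hpq hu (hb (by rwa [Real.dist_eq]))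
  exact ⟨t, ⟨huC, a1, ht2, by rw [← hz4]; exact a2 (hcard _ huC _ hz1) (ht2.trans hz3.symm)⟩, a3⟩

theorem cell_ne (hm : ∀ u, (P u).Monic) (hd : ∀ u, (P u).natDegree = m)
  (hc : ∀ u ∈ C, ∀ j, ContinuousAt (fun u => (P u).coeff j) u)
  (hcard : ∀ u ∈ C, ∀ v ∈ C, (CR (P u)).card = (CR (P v)).card) (hε : 0 < ε) (hR : ∀ u ∈ C, ∀ x ∈ RR (P u), |x| < ε) (b : Bool) (i : ℕ) {u : B} (hu : u ∈ C) :
    ∀ᶠ v in 𝓝 u, v ∈ C → (∃ t, (v, t) ∈ cellS C P ε b i) → ∃ t, (u, t) ∈ cellS C P ε b i := by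
  filter_upwards [card_RR_loc hm hd (hc u hu)] with v hv hvC
  have hcd := hv (hcard _ hvC _ hu)
  rintro ⟨t, h1, h2, h3, h4⟩
  simp only at h1 h2 h3 h4
  cases b with
  | true =>
    have h5 := nu_lt_card ((mem_RR (hm _)).2 (h3.2 rfl))
    obtain ⟨s, hs, hs'⟩ := graph_exists hε (hR u hu) i (by omega)
    exact ⟨s, hu, hR u hu s hs, by simpa using (mem_RR (hm _)).1 hs, hs'⟩
  | false =>
    have h5 := nu_le (P v) t
    obtain ⟨s, hs, hs', hs''⟩ := band_exists hε (hR u hu) i (by omega)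
    rw [mem_RR (hm _)] at hs'
    exact ⟨s, hu, hs, by simpa using hs', hs''⟩

theorem cell_conn (hm : ∀ u, (P u).Monic) (hd : ∀ u, (P u).natDegree = m)
  (hc : ∀ u ∈ C, ∀ j, ContinuousAt (fun u => (P u).coeff j) u)
  (hcard : ∀ u ∈ C, ∀ v ∈ C, (CR (P u)).card = (CR (P v)).card) (hC : IsPreconnected C) (hε : 0 < ε) (hR : ∀ u ∈ C, ∀ x ∈ RR (P u), |x| < ε) (b : Bool) (i : ℕ) :
    IsPreconnected (cellS C P ε b i) :=
  conn_fib hC (fun z hz => hz.1) (fun u _ => cell_fib hm b i u)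
    (fun _ hz _ hW => cell_lsc hm hd hc hcard hz hW) (fun _ hu => cell_ne hm hd hc hcard hε hR b i hu)

/-- near a point over `C`, having the right zero pattern means being in the cell -/
theorem cell_loc (hm : ∀ u, (P u).Monic) (hd : ∀ u, (P u).natDegree = m)
  (hc : ∀ u ∈ C, ∀ j, ContinuousAt (fun u => (P u).coeff j) u)
  (hcard : ∀ u ∈ C, ∀ v ∈ C, (CR (P u)).card = (CR (P v)).card) {b : Bool} {i : ℕ} {u0 : B} {t0 : ℝ} (hu0 : u0 ∈ C) (hb : (P u0).eval t0 = 0 ↔ b = true) (ht0 : |t0| < ε) :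
    ∀ᶠ z in 𝓝 (u0, t0), z.1 ∈ C → ((P z.1).eval z.2 = 0 ↔ b = true) →
      (z ∈ cellS C P ε b i ↔ (u0, t0) ∈ cellS C P ε b i) := by
  have e1 : ∀ᶠ z in 𝓝 (u0, t0), |z.2| < ε :=
    (continuousAt_snd (p := (u0, t0))).abs.eventually (gt_mem_nhds ht0)
  filter_upwards [e1, nu_loc hm hd (hc u0 hu0) t0] with z h1 h2 hzC hzb
  have h3 := h2 (hcard _ hzC _ hu0) (hzb.trans hb.symm)
  constructor
  · rintro ⟨-, -, -, h⟩
    exact ⟨hu0, ht0, hb, by rw [← h3]; exact h⟩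
  · rintro ⟨-, -, -, h⟩
    exact ⟨hzC, h1, hzb, by rw [h3]; exact h⟩

theorem cell_band_loc (hm : ∀ u, (P u).Monic) (hd : ∀ u, (P u).natDegree = m)
  (hc : ∀ u ∈ C, ∀ j, ContinuousAt (fun u => (P u).coeff j) u)
  (hcard : ∀ u ∈ C, ∀ v ∈ C, (CR (P u)).card = (CR (P v)).card) {u0 : B} {t0 : ℝ} {i : ℕ} (hz : (u0, t0) ∈ cellS C P ε false i) :
    ∀ᶠ z in 𝓝 (u0, t0), (z ∈ cellS C P ε false i ↔ z.1 ∈ C) := by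
  have h0 : (P u0).eval t0 ≠ 0 := fun h => by simpa using hz.2.2.1.1 h
  have h1 := (cont_real hd (hc u0 hz.1) 0 t0).eventually_ne h0
  filter_upwards [h1, cell_loc hm hd hc hcard (i := i) hz.1 hz.2.2.1 hz.2.1] with z h1 h2
  refine ⟨fun h => h.1, fun h => (h2 h ?_).2 hz⟩
  simpa using h1

theorem cell_graph_chart (hm : ∀ u, (P u).Monic) (hd : ∀ u, (P u).natDegree = m)
  (hc : ∀ u ∈ C, ∀ j, ContinuousAt (fun u => (P u).coeff j) u)
  (hcard : ∀ u ∈ C, ∀ v ∈ C, (CR (P u)).card = (CR (P v)).card) {u0 : B} {t0 : ℝ} {i d : ℕ} (hz : (u0, t0) ∈ cellS C P ε true i)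
    (hca : ∀ j, AnalyticAt ℝ (fun u => (P u).coeff j) u0) (hLS : LS d C u0) :
    LS (d+1) (cellS C P ε true i) (u0, t0) := by
  have hu0 := hz.1
  have hroot : (P u0).eval t0 = 0 := hz.2.2.1.2 rfl
  have hP0 := (hm u0).ne_zero
  have hpos : 0 < rootMultiplicity t0 (P u0) := (rootMultiplicity_pos hP0).2 hroot
  obtain ⟨k, hk⟩ : ∃ k, rootMultiplicity t0 (P u0) = k + 1 := ⟨_, (Nat.succ_pred_eq_of_pos hpos).symm⟩
  have hne : (derivative^[k+1] (P u0)).eval t0 ≠ 0 := by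
    intro h0
    have : k + 1 < rootMultiplicity t0 (P u0) := by
      rw [lt_rootMultiplicity_iff_isRoot_iterate_derivative hP0]
      intro j hj
      rcases hj.eq_or_lt with rfl | hlt
      · exact h0
      · exact isRoot_iterate_derivative_of_lt_rootMultiplicity (by omega)
    omega
  have hgan := an_real hd hca k t0
  refine LS.graph hLS hgan ?_ ?_
  · have h1 : HasDerivAt (fun t => (derivative^[k] (P u0)).eval t)
        (fderiv ℝ (fun q : B × ℝ => (derivative^[k] (P q.1)).eval q.2) (u0, t0) (0, 1)) t0 := by
      have h2 : HasDerivAt (fun t : ℝ => (u0, t)) ((0 : B), (1 : ℝ)) t0 :=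
        (hasDerivAt_const t0 u0).prodMk (hasDerivAt_id t0)
      exact hgan.differentiableAt.hasFDerivAt.comp_hasDerivAt t0 h2
    have h3 := (Polynomial.hasDerivAt (derivative^[k] (P u0)) t0)
    rw [h1.unique h3]
    rwa [Function.iterate_succ_apply'] at hne
  · obtain ⟨ε₀, hε₀, H⟩ := loc_real hm hd (hc u0 hu0)
    have e0 := (cont_real hd (hc u0 hu0) (k+1) t0).eventually_ne hne
    rw [nhds_prod_eq] at e0
    obtain ⟨p, hp, q, hq, hpq⟩ := eventually_prod_iff.1 e0
    obtain ⟨δ, hδ, hb⟩ := Metric.eventually_nhds_iff.1 hq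
    have e1 := (continuousAt_fst (p := (u0, t0))).eventually (hp.and (H δ hδ))
    have e2 : ∀ᶠ z in 𝓝 (u0, t0), dist z.2 t0 < min δ ε₀ :=
      (continuousAt_snd (p := (u0, t0))).eventually (ball_mem_nhds t0 (by positivity))
    filter_upwards [e1, e2, cell_loc hm hd hc hcard (i := i) hz.1 hz.2.2.1 hz.2.1] with z he1 hdist hcl
    obtain ⟨hpz, hH⟩ := he1
    have hRR0 := (mem_RR (hm u0)).2 hroot
    constructor
    · intro hzS
      refine ⟨hzS.1, ?_⟩
      obtain ⟨g, hg1, -, hg3⟩ := hH (hcard _ hzS.1 _ hu0)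
      have hzr := hzS.2.2.1.2 rfl
      have h3 := hg3 z.2 ((mem_CR_real (hm _)).2 ((mem_RR (hm _)).2 hzr)) t0 hRR0 (by
        rw [← Complex.ofReal_sub, Complex.norm_real, Real.norm_eq_abs, ← Real.dist_eq]
        exact hdist.trans_le (min_le_right _ _))
      have h4 := Complex.ofReal_inj.1 h3
      have h5 := (hg1 t0 hRR0).2.2.2
      rw [← h4, hk] at h5
      exact isRoot_iterate_derivative_of_lt_rootMultiplicity (by omega)
    · rintro ⟨hzC, hgz⟩
      obtain ⟨g, hg1, -, -⟩ := hH (hcard _ hzC _ hu0)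
      obtain ⟨a1, a2, -, a4⟩ := hg1 t0 hRR0
      have h5 : (derivative^[k] (P z.1)).eval (g t0) = 0 :=
        isRoot_iterate_derivative_of_lt_rootMultiplicity (by omega)
      have hder : ∀ s, |s - t0| < δ → deriv (fun t => (derivative^[k] (P z.1)).eval t) s ≠ 0 := by
        intro s hs
        rw [Polynomial.deriv, ← Function.iterate_succ_apply' (f := derivative)]
        exact hpq hpz (hb (by rwa [Real.dist_eq]))
      have hzd : |z.2 - t0| < δ := by rw [← Real.dist_eq]; exact hdist.trans_le (min_le_left _ _)
      have rolle : ∀ a b, a < b → |a - t0| < δ → |b - t0| < δ → (derivative^[k] (P z.1)).eval a = 0 →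
          (derivative^[k] (P z.1)).eval b = 0 → False := by
        intro a b hab ha hb' ha0 hb0
        obtain ⟨s, hs, hs0⟩ := exists_deriv_eq_zero (f := fun t => (derivative^[k] (P z.1)).eval t) hab
          (Polynomial.continuous _).continuousOn (by show eval a _ = eval b _; rw [ha0, hb0])
        refine hder s ?_ hs0
        rw [abs_lt] at *
        constructor <;> linarith [hs.1, hs.2]
      have heq : z.2 = g t0 := by
        rcases lt_trichotomy z.2 (g t0) with h | h | h
        · exact (rolle _ _ h hzd a2 hgz h5).elim
        · exact h
        · exact (rolle _ _ h a2 hzd h5 hgz).elim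
      refine (hcl hzC ?_).2 hz
      rw [heq]
      simpa using (mem_RR (hm _)).1 a1

theorem cell_div (hm : ∀ u, (P u).Monic) (hd : ∀ u, (P u).natDegree = m)
  (hc : ∀ u ∈ C, ∀ j, ContinuousAt (fun u => (P u).coeff j) u)
  (hcard : ∀ u ∈ C, ∀ v ∈ C, (CR (P u)).card = (CR (P v)).card) {p : B → ℝ[X]} {m' : ℕ} (hpm : ∀ u, (p u).Monic) (hpd : ∀ u, (p u).natDegree = m')
    (hpc : ∀ u ∈ C, ∀ j, ContinuousAt (fun u => (p u).coeff j) u) (hdvd : ∀ u, p u ∣ P u)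
    (hC : IsPreconnected C) (hε : 0 < ε) (hR : ∀ u ∈ C, ∀ x ∈ RR (P u), |x| < ε) (b : Bool) (i : ℕ) :
    (∀ z ∈ cellS C P ε b i, (p z.1).eval z.2 = 0) ∨ (∀ z ∈ cellS C P ε b i, (p z.1).eval z.2 ≠ 0) := by
  cases b with
  | false =>
    right
    intro z hz h0
    have := Polynomial.eval_eq_zero_of_dvd_of_eval_eq_zero (hdvd z.1) h0
    simpa using hz.2.2.1.1 this
  | true =>
    have hconn := cell_conn hm hd hc hcard hC hε hR true i
    have hloc : ∀ y ∈ cellS C P ε true i, ∀ᶠ x in 𝓝 y, x ∈ cellS C P ε true i →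
        ((p x.1).eval x.2 = 0) = ((p y.1).eval y.2 = 0) := by
      rintro ⟨u0, t0⟩ hy
      by_cases h0 : (p u0).eval t0 = 0
      · obtain ⟨ε₀, hε₀, H⟩ := loc_real hm hd (hc u0 hy.1)
        have e1 := (continuousAt_fst (p := (u0, t0))).eventually
          ((EX hpm hpd (hpc u0 hy.1) ((mem_CR_real (hpm u0)).2 ((mem_RR (hpm u0)).2 h0)) hε₀).and (H ε₀ hε₀))
        have e2 : ∀ᶠ z in 𝓝 (u0, t0), dist z.2 t0 < ε₀ :=
          (continuousAt_snd (p := (u0, t0))).eventually (ball_mem_nhds t0 (by positivity))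
        filter_upwards [e1, e2] with z he1 hdist hzS
        obtain ⟨⟨l, hl, hlt⟩, hH⟩ := he1
        obtain ⟨g, -, -, hg3⟩ := hH (hcard _ hzS.1 _ hy.1)
        have hRR0 := (mem_RR (hm u0)).2 (hy.2.2.1.2 rfl)
        have h3 := hg3 z.2 ((mem_CR_real (hm _)).2 ((mem_RR (hm _)).2 (hzS.2.2.1.2 rfl))) t0 hRR0 (by
          rw [← Complex.ofReal_sub, Complex.norm_real, Real.norm_eq_abs, ← Real.dist_eq]
          exact hdist)
        have hl' : l ∈ CR (P z.1) := by
          rw [mem_CR (hpm _)] at hl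
          rw [mem_CR (hm _)]
          exact Polynomial.eval_eq_zero_of_dvd_of_eval_eq_zero (Polynomial.map_dvd _ (hdvd z.1)) hl
        have h4 := hg3 l hl' t0 hRR0 hlt
        rw [h4, ← h3, mem_CR_real (hpm _), mem_RR (hpm _)] at hl
        simp [hl, h0]
      · filter_upwards [(cont_real hpd (hpc u0 hy.1) 0 t0).eventually_ne h0] with z hz _
        have hz' : eval z.2 (p z.1) ≠ 0 := hz
        simp [h0, hz']
    by_cases hex : ∃ y ∈ cellS C P ε true i, (p y.1).eval y.2 = 0
    · obtain ⟨y, hy, hy0⟩ := hex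
      left
      intro z hz
      have := preconn_const hconn (fun x => (p x.1).eval x.2 = 0) hloc hz hy
      simpa [hy0] using this
    · right
      intro z hz h0
      exact hex ⟨z, hz, h0⟩

end cell

end DF
end Part9

section Part10
open Metric Set Filter Topology
open scoped ContDiff NNReal ENNReal

namespace DF
open Polynomial

/-- A finite stratification of an open neighbourhood of `0` into connected analytic cells
described by vanishing patterns of finitely many analytic functions. -/
structure Strat (E : Type) [NormedAddCommGroup E] [NormedSpace ℝ E] where
  D : Set E
  hD : IsOpen D
  h0 : (0 : E) ∈ D
  ι : Type
  fι : Finite ι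
  P : ι → E → ℝ
  an : ∀ i, AnalyticOnNhd ℝ (P i) D
  c : Type
  fc : Finite c
  S : c → Set E
  τ : c → Set ι
  cd : c → ℕ
  cover : ∀ x ∈ D, ∃ a, x ∈ S a
  sub : ∀ a, S a ⊆ D
  conn : ∀ a, IsPreconnected (S a)
  pat : ∀ a, ∀ x ∈ S a, ∀ j, j ∈ τ a ↔ P j x = 0
  loc : ∀ a, ∀ y ∈ D, (∀ j, j ∈ τ a ↔ P j y = 0) →
    ∀ᶠ x in 𝓝 y, (∀ j, j ∈ τ a ↔ P j x = 0) → (x ∈ S a ↔ y ∈ S a)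
  chart : ∀ a, ∀ y ∈ S a, LS (cd a) (S a) y
  mono : ∀ a b, τ a ⊆ τ b → cd a ≤ cd b

section
variable {E : Type} [NormedAddCommGroup E] [NormedSpace ℝ E]

theorem Strat.loc' (s : Strat E) {a : s.c} {y : E} (hy : y ∈ s.S a) :
    ∀ᶠ x in 𝓝 y, (∀ j ∈ s.τ a, s.P j x = 0) → x ∈ s.S a := by
  haveI := s.fι
  have hyD := s.sub a hy
  have h1 : ∀ᶠ x in 𝓝 y, ∀ j, j ∉ s.τ a → s.P j x ≠ 0 := by
    rw [eventually_all]
    intro j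
    by_cases hj : j ∈ s.τ a
    · exact Eventually.of_forall fun x h => (h hj).elim
    · have : s.P j y ≠ 0 := fun h => hj ((s.pat a y hy j).2 h)
      filter_upwards [(s.an j y hyD).continuousAt.eventually_ne this] with x hx _ using hx
  filter_upwards [s.loc a y hyD (s.pat a y hy), h1] with x hx h2 h3
  refine (hx fun j => ⟨h3 j, fun h => ?_⟩).2 hy
  by_contra hj
  exact h2 j hj h

theorem Strat.clos (s : Strat E) {a : s.c} {y : E} (hyD : y ∈ s.D) (hy : y ∈ closure (s.S a))
    (hp : ∀ j, j ∈ s.τ a ↔ s.P j y = 0) : y ∈ s.S a := by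
  obtain ⟨x, hx, hxS⟩ := mem_closure_iff_nhds.1 hy _ (s.loc a y hyD hp)
  exact (hx (s.pat a x hxS)).1 hxS

/-- transport along a continuous linear equivalence -/
def Strat.pull {E' : Type} [NormedAddCommGroup E'] [NormedSpace ℝ E'] (s : Strat E) (e : E' ≃L[ℝ] E) :
    Strat E' where
  D := e ⁻¹' s.D
  hD := s.hD.preimage e.continuous
  h0 := by simpa using s.h0
  ι := s.ι
  fι := s.fι
  P := fun i => s.P i ∘ e
  an := fun i x hx => (s.an i (e x) hx).comp (e.analyticAt x)
  c := s.c
  fc := s.fc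
  S := fun a => e ⁻¹' s.S a
  τ := s.τ
  cd := s.cd
  cover := fun x hx => s.cover (e x) hx
  sub := fun a x hx => s.sub a hx
  conn := fun a => by
    have : e ⁻¹' s.S a = e.symm '' s.S a := by
      ext x
      constructor
      · intro h; exact ⟨e x, h, by simp⟩
      · rintro ⟨y, hy, rfl⟩; simpa using hy
    rw [this]
    exact (s.conn a).image _ e.symm.continuous.continuousOn
  pat := fun a x hx => s.pat a (e x) hx
  loc := fun a y hy hp => e.continuous.continuousAt.eventually (s.loc a (e y) hy hp)
  chart := fun a y hy => by
    obtain ⟨F, hF, hs, hl⟩ := s.chart a (e y) hy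
    refine ⟨F ∘ e, hF.comp (e.analyticAt y), ?_, e.continuous.continuousAt.eventually hl⟩
    rw [fderiv_comp y hF.differentiableAt e.differentiableAt, e.fderiv]
    exact hs.comp e.surjective
  mono := s.mono

theorem nu_le_deg {p : ℝ[X]} (hp : p.Monic) {m : ℕ} (hd : p.natDegree = m) (t : ℝ) : nu p t < m + 1 := by
  classical
  have h1 : nu p t ≤ (RR p).card := by unfold nu; exact Finset.card_le_card (Finset.filter_subset _ _)
  have h2 : (RR p).card ≤ m := by
    rw [← hd]; unfold RR
    exact (Multiset.toFinset_card_le _).trans (Polynomial.card_roots' p)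
  omega

/-- the step: cylindrical stratification -/
def Strat.step (s : Strat E) {P : E → ℝ[X]} {m : ℕ} {ε : ℝ} (hε : 0 < ε) (hm : ∀ u, (P u).Monic)
    (hd : ∀ u, (P u).natDegree = m)
    (hc : ∀ u ∈ s.D, ∀ j, AnalyticAt ℝ (fun u => (P u).coeff j) u)
    (hR : ∀ u ∈ s.D, ∀ x ∈ RR (P u), |x| < ε)
    (hcard : ∀ a, ∀ u ∈ s.S a, ∀ v ∈ s.S a, (CR (P u)).card = (CR (P v)).card) : Strat (E × ℝ) where
  D := {z | z.1 ∈ s.D ∧ |z.2| < ε}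
  hD := (s.hD.preimage continuous_fst).inter (isOpen_lt continuous_snd.abs continuous_const)
  h0 := ⟨s.h0, by simpa using hε⟩
  ι := Option s.ι
  fι := by haveI := s.fι; infer_instance
  P := fun j z => j.elim ((P z.1).eval z.2) (fun j => s.P j z.1)
  an := fun i z hz => by
    cases i with
    | none => exact an_real hd (hc z.1 hz.1) 0 z.2
    | some i => exact AnalyticAt.comp_of_eq (f := Prod.fst) (s.an i z.1 hz.1) analyticAt_fst rfl
  c := s.c × Bool × Fin (m+1)
  fc := by haveI := s.fc; infer_instance
  S := fun a => cellS (s.S a.1) P ε a.2.1 a.2.2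
  τ := fun a => {j | j.elim (a.2.1 = true) (fun j => j ∈ s.τ a.1)}
  cd := fun a => if a.2.1 then s.cd a.1 + 1 else s.cd a.1
  cover := fun z hz => by
    obtain ⟨a, ha⟩ := s.cover z.1 hz.1
    by_cases h : (P z.1).eval z.2 = 0
    · exact ⟨(a, true, ⟨nu (P z.1) z.2, nu_le_deg (hm _) (hd _) _⟩), ha, hz.2, by simpa using h, rfl⟩
    · exact ⟨(a, false, ⟨nu (P z.1) z.2, nu_le_deg (hm _) (hd _) _⟩), ha, hz.2, by simpa using h, rfl⟩
  sub := fun a z hz => ⟨s.sub _ hz.1, hz.2.1⟩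
  conn := fun a => cell_conn hm hd (fun u hu j => (hc u (s.sub _ hu) j).continuousAt) (hcard a.1) (s.conn a.1) hε
    (fun u hu => hR u (s.sub _ hu)) _ _
  pat := fun a z hz j => by
    cases j with
    | none => exact hz.2.2.1.symm
    | some j => exact s.pat a.1 z.1 hz.1 j
  loc := by
    rintro ⟨a, b, i⟩ ⟨u0, t0⟩ ⟨hu, ht⟩ hp
    have hp1 : ∀ j, j ∈ s.τ a ↔ s.P j u0 = 0 := fun j => hp (some j)
    have hp2 : (P u0).eval t0 = 0 ↔ b = true := (hp none).symm
    have h1 := (continuousAt_fst (p := (u0, t0))).eventually (s.loc a u0 hu hp1)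
    by_cases hua : u0 ∈ s.S a
    · have h2 := cell_loc (ε := ε) (b := b) (i := i) hm hd
        (fun u hu j => (hc u (s.sub _ hu) j).continuousAt) (hcard a) hua hp2 ht
      filter_upwards [h1, h2] with z hz1 hz2 hz
      exact hz2 ((hz1 fun j => hz (some j)).2 hua) (hz none).symm
    · filter_upwards [h1] with z hz1 hz
      constructor
      · intro h; exact (hua ((hz1 fun j => hz (some j)).1 h.1)).elim
      · intro h; exact (hua h.1).elim
  chart := by
    rintro ⟨a, b, i⟩ ⟨u0, t0⟩ hz
    have hu : u0 ∈ s.S a := hz.1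
    cases b with
    | true =>
      exact cell_graph_chart hm hd (fun u hu j => (hc u (s.sub _ hu) j).continuousAt) (hcard a) hz
        (hc u0 (s.sub _ hu)) (s.chart a u0 hu)
    | false =>
      exact LS.band (s.chart a u0 hu)
        (cell_band_loc hm hd (fun u hu j => (hc u (s.sub _ hu) j).continuousAt) (hcard a) hz)
  mono := by
    rintro ⟨a, b, i⟩ ⟨a', b', i'⟩ h
    have h1 : s.τ a ⊆ s.τ a' := fun j hj => h (show some j ∈ _ from hj)
    have h2 := s.mono _ _ h1
    have h3 : b = true → b' = true := fun hb => h (show none ∈ _ from hb)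
    cases b <;> cases b' <;> simp at h3 ⊢ <;> omega

/-- the trivial stratification -/
def Strat.triv {D : Set E} (hD : IsOpen D) (h0 : (0:E) ∈ D) (hc : IsPreconnected D) : Strat E where
  D := D
  hD := hD
  h0 := h0
  ι := Empty
  fι := inferInstance
  P := fun j => j.elim
  an := fun j => j.elim
  c := Unit
  fc := inferInstance
  S := fun _ => D
  τ := fun _ => ∅
  cd := fun _ => 0
  cover := fun x hx => ⟨(), hx⟩
  sub := fun _ => le_rfl
  conn := fun _ => hc
  pat := fun _ _ _ j => j.elim
  loc := fun a y hy _ => by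
    filter_upwards [hD.mem_nhds hy] with x hx _ using ⟨fun _ => hy, fun _ => hx⟩
  chart := fun _ y hy => ⟨fun _ => 0, analyticAt_const, fun v => ⟨0, Subsingleton.elim _ _⟩, by
    filter_upwards [hD.mem_nhds hy] with x hx using ⟨fun _ => rfl, fun _ => hx⟩⟩
  mono := fun _ _ _ => le_rfl

/-- `f` is constant-vanishing on the cells of `s` -/
def Strat.Adapted (s : Strat E) (f : E → ℝ) : Prop :=
  ∀ a, (∀ x ∈ s.S a, f x = 0) ∨ (∀ x ∈ s.S a, f x ≠ 0)

end
end DF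
end Part10

section Part11
open Metric Set Filter Topology
open scoped ContDiff NNReal ENNReal

namespace DF
open Polynomial

theorem common_nonzero {E : Type*} [NormedAddCommGroup E] [NormedSpace ℝ E] {κ : Type*} {B : Set E}
    (hBo : IsOpen B) (hBc : IsPreconnected B) (h0B : (0:E) ∈ B) {f : κ → E → ℝ}
    (s : Finset κ) (hf : ∀ i ∈ s, AnalyticOnNhd ℝ (f i) B) (hne : ∀ i ∈ s, ¬ ∀ᶠ x in 𝓝 0, f i x = 0) :
    ∀ O : Set E, IsOpen O → O.Nonempty → O ⊆ B → ∃ y ∈ O, ∀ i ∈ s, f i y ≠ 0 := by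
  classical
  induction s using Finset.induction_on with
  | empty => rintro O - ⟨y, hy⟩ -; exact ⟨y, hy, by simp⟩
  | insert i s hi ih =>
    intro O hO hOn hOB
    obtain ⟨y, hyO, hy⟩ := ih (fun j hj => hf j (Finset.mem_insert_of_mem hj))
      (fun j hj => hne j (Finset.mem_insert_of_mem hj)) O hO hOn hOB
    have h1 : ∀ᶠ x in 𝓝 y, x ∈ O ∧ ∀ j ∈ s, f j x ≠ 0 := by
      refine Filter.Eventually.and (hO.mem_nhds hyO) ?_
      rw [Finset.eventually_all]
      intro j hj
      exact (hf j (Finset.mem_insert_of_mem hj) y (hOB hyO)).continuousAt.eventually_ne (hy j hj)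
    by_contra hcon
    push Not at hcon
    have h2 : f i =ᶠ[𝓝 y] 0 := by
      filter_upwards [h1] with x hx
      obtain ⟨j, hj, hj0⟩ := hcon x hx.1
      rcases Finset.mem_insert.1 hj with rfl | hj
      · exact hj0
      · exact (hx.2 j hj hj0).elim
    have h3 := (hf i (Finset.mem_insert_self _ _)).eqOn_zero_of_preconnected_of_eventuallyEq_zero hBc (hOB hyO) h2
    refine hne i (Finset.mem_insert_self _ _) ?_
    filter_upwards [hBo.mem_nhds h0B] with x hx using h3 hx

/-- a common direction of regularity -/
theorem good_dir {E : Type*} [NormedAddCommGroup E] [NormedSpace ℝ E] [Nontrivial E] {κ : Type*} [Finite κ]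
    {f : κ → E → ℝ} (hf : ∀ i, AnalyticAt ℝ (f i) 0) (hne : ∀ i, ¬ ∀ᶠ x in 𝓝 0, f i x = 0) :
    ∃ v : E, v ≠ 0 ∧ ∀ i, ¬ ∀ᶠ t in 𝓝 (0:ℝ), f i (t • v) = 0 := by
  classical
  haveI := Fintype.ofFinite κ
  have h1 : ∀ᶠ x in 𝓝 (0:E), ∀ i, AnalyticAt ℝ (f i) x :=
    eventually_all.2 fun i => (hf i).eventually_analyticAt
  obtain ⟨r, hr, hB⟩ := Metric.eventually_nhds_iff_ball.1 h1
  have hO : (ball (0:E) r \ {0}).Nonempty := by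
    obtain ⟨x, hx⟩ := NormedSpace.exists_lt_norm ℝ E 0
    refine ⟨(r / (2 * ‖x‖)) • x, ?_, ?_⟩
    · rw [mem_ball_zero_iff, norm_smul, Real.norm_of_nonneg (by positivity)]
      have : r / (2 * ‖x‖) * ‖x‖ = r / 2 := by field_simp
      linarith
    · have hx0 : x ≠ 0 := norm_pos_iff.1 hx
      have : r / (2 * ‖x‖) ≠ 0 := by positivity
      simp [this, hx0, hr.ne']
  obtain ⟨v, hvO, hv⟩ := common_nonzero isOpen_ball (convex_ball (0:E) r).isPreconnected (mem_ball_self hr)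
    Finset.univ (fun i _ x hx => hB x hx i) (fun i _ => hne i) _ (isOpen_ball.sdiff isClosed_singleton) hO diff_subset
  refine ⟨v, hvO.2, fun i hi => hv i (Finset.mem_univ _) ?_⟩
  have hconv : IsPreconnected {t : ℝ | t • v ∈ ball (0:E) r} := by
    refine Convex.isPreconnected ?_
    exact (convex_ball (0:E) r).is_linear_preimage (IsLinearMap.isLinearMap_smul' v)
  have han : AnalyticOnNhd ℝ (fun t : ℝ => f i (t • v)) {t : ℝ | t • v ∈ ball (0:E) r} := by
    intro t ht
    exact AnalyticAt.comp (g := f i) (f := fun t : ℝ => t • v) (hB _ ht i) (by fun_prop)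
  have := han.eqOn_zero_of_preconnected_of_eventuallyEq_zero hconv (z₀ := 0)
    (by show (0:ℝ) • v ∈ ball (0:E) r; rw [zero_smul]; exact mem_ball_self hr) hi
  have h2 := this (x := 1) (by show (1:ℝ) • v ∈ ball (0:E) r; rw [one_smul]; exact hvO.1)
  simpa using h2

/-- the Weierstrass polynomial attached to its coefficients -/
noncomputable def wpoly {m : ℕ} (b : Fin m → ℝ) : ℝ[X] := X ^ m - ∑ i, C (b i) * X ^ (i:ℕ)

theorem wpoly_sum_deg {m : ℕ} (b : Fin m → ℝ) : (∑ i, C (b i) * X ^ (i:ℕ) : ℝ[X]).degree < (m : WithBot ℕ) := by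
  refine lt_of_le_of_lt (Polynomial.degree_sum_le _ _) ?_
  rw [Finset.sup_lt_iff (by exact WithBot.bot_lt_coe m)]
  intro i _
  exact lt_of_le_of_lt (degree_C_mul_X_pow_le _ _) (by exact_mod_cast i.2)

theorem wpoly_monic {m : ℕ} (b : Fin m → ℝ) : (wpoly b).Monic := by
  unfold wpoly
  exact monic_X_pow_sub (n := m) (wpoly_sum_deg b)

theorem wpoly_deg {m : ℕ} (b : Fin m → ℝ) : (wpoly b).natDegree = m := by
  refine natDegree_eq_of_degree_eq_some ?_
  unfold wpoly
  rw [degree_sub_eq_left_of_degree_lt]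
  · simp
  · rw [degree_X_pow]; exact wpoly_sum_deg b

theorem wpoly_eval {m : ℕ} (b : Fin m → ℝ) (t : ℝ) : (wpoly b).eval t = 0 ↔ t ^ m = ∑ i, b i * t ^ (i:ℕ) := by
  unfold wpoly
  simp [eval_finset_sum, sub_eq_zero]

theorem wpoly_zero {m : ℕ} : wpoly (0 : Fin m → ℝ) = X ^ m := by simp [wpoly]

theorem wpoly_an {E : Type*} [NormedAddCommGroup E] [NormedSpace ℝ E] {m : ℕ} {b : E → Fin m → ℝ} {u : E}
    (hb : AnalyticAt ℝ b u) (j : ℕ) : AnalyticAt ℝ (fun u => (wpoly (b u)).coeff j) u := by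
  simp only [wpoly, coeff_sub, finset_sum_coeff, coeff_C_mul]
  refine analyticAt_const.sub (Finset.analyticAt_fun_sum _ fun i _ => ?_)
  exact ((analyticAt_pi_iff.1 hb) i).mul analyticAt_const

theorem prod_coeff_an {E : Type*} [NormedAddCommGroup E] [NormedSpace ℝ E] {κ : Type*} {p : κ → E → ℝ[X]} {u : E}
    (s : Finset κ) (h : ∀ i ∈ s, ∀ j, AnalyticAt ℝ (fun u => (p i u).coeff j) u) :
    ∀ j, AnalyticAt ℝ (fun u => (∏ i ∈ s, p i u).coeff j) u := by
  classical
  induction s using Finset.induction_on with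
  | empty => intro j; simpa using analyticAt_const
  | insert i s hi ih =>
    intro j
    simp only [Finset.prod_insert hi, coeff_mul]
    refine Finset.analyticAt_fun_sum _ fun x _ => ?_
    exact (h i (Finset.mem_insert_self _ _) _).mul (ih (fun k hk => h k (Finset.mem_insert_of_mem hk)) _)

theorem strat_fin (N : ℕ) : ∀ {κ : Type} [Finite κ] (f : κ → (Fin N → ℝ) → ℝ), (∀ i, AnalyticAt ℝ (f i) 0) →
    ∀ U ∈ 𝓝 (0 : Fin N → ℝ), ∃ s : Strat (Fin N → ℝ), s.D ⊆ U ∧ ∀ i, s.Adapted (f i) := by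
  classical
  induction N with
  | zero =>
    intro κ _ f hf U hU
    refine ⟨Strat.triv (D := univ) isOpen_univ (mem_univ _) isPreconnected_univ, ?_, fun i a => ?_⟩
    · intro x _; rw [Subsingleton.elim x 0]; exact mem_of_mem_nhds hU
    · by_cases h : f i 0 = 0
      · left; intro x _; rw [Subsingleton.elim x 0]; exact h
      · right; intro x _; rw [Subsingleton.elim x 0]; exact h
  | succ N ih =>
    intro κ _ f hf U hU
    let κ' := {i : κ // ¬ ∀ᶠ x in 𝓝 0, f i x = 0}
    haveI : Fintype κ' := Fintype.ofFinite κ'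
    obtain ⟨v, hv0, hv⟩ := good_dir (f := fun i : κ' => f i.1) (fun i => hf i.1) (fun i => i.2)
    obtain ⟨e, he⟩ : ∃ e : ((Fin N → ℝ) × ℝ) ≃L[ℝ] (Fin (N+1) → ℝ), e (0, 1) = v := by
      let e0 : ((Fin N → ℝ) × ℝ) ≃L[ℝ] (Fin (N+1) → ℝ) := ContinuousLinearEquiv.ofFinrankEq (by simp)
      obtain ⟨A, hA⟩ := SeparatingDual.exists_continuousLinearEquiv_apply_eq (R := ℝ) (x := e0 (0,1)) (y := v)
        (by simp [Prod.ext_iff]) hv0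
      exact ⟨e0.trans A, hA⟩
    have hg : ∀ i, AnalyticAt ℝ (fun z => f i (e z)) 0 := fun i =>
      AnalyticAt.comp_of_eq (hf i) (e.analyticAt 0) (map_zero e)
    have hWP : ∀ i : κ', ∃ (m : ℕ) (b : (Fin N → ℝ) → (Fin m → ℝ)), AnalyticAt ℝ b 0 ∧ b 0 = 0 ∧
      ∀ᶠ z in 𝓝 (0 : (Fin N → ℝ) × ℝ), (f i.1 (e z) = 0 ↔ z.2 ^ m = ∑ i, b z.1 i * z.2 ^ (i:ℕ)) := by
      intro i
      refine WP (hg i.1) ?_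
      intro h
      refine hv i ?_
      filter_upwards [h] with t ht
      have : t • v = e (0, t) := by rw [← he, ← map_smul]; simp
      rw [this]; exact ht
    choose mm b hban hb0 hbz using hWP
    let p : κ' → (Fin N → ℝ) → ℝ[X] := fun i u => wpoly (b i u)
    let P : (Fin N → ℝ) → ℝ[X] := fun u => ∏ i, p i u
    let m := ∑ i, mm i
    have hm : ∀ u, (P u).Monic := fun u => monic_prod_of_monic _ _ fun i _ => wpoly_monic _
    have hd : ∀ u, (P u).natDegree = m := fun u => by
      show (∏ i, p i u).natDegree = _
      rw [natDegree_prod_of_monic _ _ fun i _ => wpoly_monic _]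
      exact Finset.sum_congr rfl fun i _ => wpoly_deg _
    have hPa : ∀ u, (∀ i, AnalyticAt ℝ (b i) u) → ∀ j, AnalyticAt ℝ (fun u => (P u).coeff j) u :=
      fun u hu j => prod_coeff_an Finset.univ (fun i _ j => wpoly_an (hu i) j) j
    have hP0 : P 0 = X ^ m := by
      show ∏ i, wpoly (b i 0) = _
      simp only [hb0, wpoly_zero, m, Finset.prod_pow_eq_pow_sum]
    -- neighbourhood in the product
    have hz0 : ∀ i : κ, (∀ᶠ x in 𝓝 0, f i x = 0) → ∀ᶠ z in 𝓝 (0 : (Fin N → ℝ) × ℝ), f i (e z) = 0 := by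
      intro i hi
      have h := e.continuous.continuousAt (x := 0)
      rw [ContinuousAt, map_zero] at h
      exact h.eventually hi
    have hUe : ∀ᶠ z in 𝓝 (0 : (Fin N → ℝ) × ℝ), e z ∈ U := by
      have h := e.continuous.continuousAt (x := 0)
      rw [ContinuousAt, map_zero] at h
      exact h.eventually hU
    have hall : ∀ᶠ z in 𝓝 (0 : (Fin N → ℝ) × ℝ), e z ∈ U ∧ (∀ i : κ, (∀ᶠ x in 𝓝 0, f i x = 0) → f i (e z) = 0) ∧
        ∀ i : κ', (f i.1 (e z) = 0 ↔ (p i z.1).eval z.2 = 0) := by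
      refine hUe.and (Filter.Eventually.and ?_ ?_)
      · rw [eventually_all]; intro i
        by_cases hi : ∀ᶠ x in 𝓝 0, f i x = 0
        · filter_upwards [hz0 i hi] with z hz _ using hz
        · exact Eventually.of_forall fun z h => (hi h).elim
      · rw [eventually_all]; intro i
        filter_upwards [hbz i] with z hz
        rw [hz]; exact (wpoly_eval _ _).symm
    obtain ⟨ε, hε, hball⟩ := Metric.eventually_nhds_iff_ball.1 hall
    choose Q hQ using fun s => count_detect m s
    let h : Fin (m+1) → (Fin N → ℝ) → ℝ := fun s u =>
      MvPolynomial.eval (fun i : Fin m => (-1) ^ ((i:ℕ)+1) * (P u).coeff (m - ((i:ℕ)+1))) (Q s)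
    have hban' : ∀ᶠ u in 𝓝 (0 : Fin N → ℝ), ∀ i, AnalyticAt ℝ (b i) u :=
      eventually_all.2 fun i => (hban i).eventually_analyticAt
    have hsm := small_roots hm hd (u0 := 0) (fun j => (hPa 0 hban j).continuousAt) hP0 hε
    obtain ⟨s, hsD, hsA⟩ := ih h (fun s => by
        have := AnalyticAt.aeval_mvPolynomial (𝕜 := ℝ) (A := ℝ) (B := ℝ) (z := (0 : Fin N → ℝ))
          (f := fun u (i : Fin m) => (-1) ^ ((i:ℕ)+1) * (P u).coeff (m - ((i:ℕ)+1)))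
          (fun i => analyticAt_const.mul (hPa 0 hban _)) (Q s)
        simpa only [MvPolynomial.aeval_eq_eval] using this)
      _ (inter_mem (inter_mem hban' hsm) (ball_mem_nhds 0 hε))
    have hcard : ∀ a, ∀ u ∈ s.S a, ∀ v ∈ s.S a, (CR (P u)).card ≤ (CR (P v)).card := by
      intro a u hu v hv
      by_contra hlt
      push Not at hlt
      have hle : (CR (P u)).card < m + 1 := by have := CR_card_le (hm u); rw [hd] at this; omega
      have h1 : h ⟨_, hle⟩ u ≠ 0 := (hQ _ _ (hm u) (hd u)).1 rfl
      have h2 : h ⟨_, hle⟩ v = 0 := (hQ _ _ (hm v) (hd v)).2 hlt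
      rcases hsA ⟨_, hle⟩ a with h3 | h3
      · exact h1 (h3 u hu)
      · exact h3 v hv h2
    have hcard' : ∀ a, ∀ u ∈ s.S a, ∀ v ∈ s.S a, (CR (P u)).card = (CR (P v)).card :=
      fun a u hu v hv => le_antisymm (hcard a u hu v hv) (hcard a v hv u hu)
    have hR : ∀ u ∈ s.D, ∀ x ∈ RR (P u), |x| < ε := fun u hu => (hsD hu).1.2
    have hca : ∀ u ∈ s.D, ∀ j, AnalyticAt ℝ (fun u => (P u).coeff j) u := fun u hu => hPa u (hsD hu).1.1
    have hDball : ∀ z : (Fin N → ℝ) × ℝ, z.1 ∈ s.D → |z.2| < ε → z ∈ ball (0 : (Fin N → ℝ) × ℝ) ε := by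
      intro z hz1 hz2
      rw [mem_ball_zero_iff, Prod.norm_def]
      exact max_lt (mem_ball_zero_iff.1 (hsD hz1).2) hz2
    refine ⟨(s.step hε hm hd hca hR hcard').pull e.symm, ?_, ?_⟩
    · intro x hx
      have := (hball _ (hDball (e.symm x) hx.1 hx.2)).1
      simpa using this
    · intro i
      by_cases hi : ∀ᶠ x in 𝓝 0, f i x = 0
      · intro a
        left
        intro x hx
        have hx' := (s.step hε hm hd hca hR hcard').sub a hx
        have := (hball _ (hDball (e.symm x) hx'.1 hx'.2)).2.1 i hi
        simpa using this
      · rintro ⟨a, b', j⟩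
        have key := cell_div hm hd (fun u hu j => (hca u (s.sub _ hu) j).continuousAt) (hcard' a) (p := p ⟨i, hi⟩)
          (fun u => wpoly_monic _) (fun u => wpoly_deg _)
          (fun u hu j => (wpoly_an ((hsD (s.sub _ hu)).1.1 ⟨i, hi⟩) j).continuousAt)
          (fun u => Finset.dvd_prod_of_mem _ (Finset.mem_univ _)) (s.conn a) hε (fun u hu => hR u (s.sub _ hu)) b' j
        have tr : ∀ x : Fin (N+1) → ℝ, e.symm x ∈ cellS (s.S a) P ε b' j →
            (f i x = 0 ↔ (p ⟨i, hi⟩ (e.symm x).1).eval (e.symm x).2 = 0) := by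
          intro x hx
          have := (hball _ (hDball (e.symm x) (s.sub _ hx.1) hx.2.1)).2.2 ⟨i, hi⟩
          simpa using this
        rcases key with key | key
        · left; intro x hx; exact (tr x hx).2 (key _ hx)
        · right; intro x hx h0; exact key _ hx ((tr x hx).1 h0)

theorem strat_exists {E : Type} [NormedAddCommGroup E] [NormedSpace ℝ E] [FiniteDimensional ℝ E]
    {κ : Type} [Finite κ] (f : κ → E → ℝ) (hf : ∀ i, AnalyticAt ℝ (f i) 0) {U : Set E} (hU : U ∈ 𝓝 0) :
    ∃ s : Strat E, s.D ⊆ U ∧ ∀ i, s.Adapted (f i) := by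
  let e : E ≃L[ℝ] (Fin (Module.finrank ℝ E) → ℝ) := ContinuousLinearEquiv.ofFinrankEq (by simp)
  have hU' : e.symm ⁻¹' U ∈ 𝓝 0 := by
    refine e.symm.continuous.continuousAt.preimage_mem_nhds ?_
    simpa using hU
  obtain ⟨s, hs, hA⟩ := strat_fin _ (fun i x => f i (e.symm x))
    (fun i => AnalyticAt.comp_of_eq (hf i) (e.symm.analyticAt 0) (map_zero _)) _ hU'
  refine ⟨s.pull e, fun x hx => ?_, fun i a => ?_⟩
  · have := hs hx; simpa using this
  · rcases hA i a with h | h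
    · left; intro x hx; have := h _ hx; simpa using this
    · right; intro x hx; have := h _ hx; simpa using this

end DF
end Part11

section Part12
open Metric Set Filter Topology
open scoped ContDiff NNReal ENNReal

namespace DF

section
variable {E : Type} [NormedAddCommGroup E] [NormedSpace ℝ E]

theorem LS.cd_le [FiniteDimensional ℝ E] {d : ℕ} {S : Set E} {y : E} (h : LS d S y) : d ≤ Module.finrank ℝ E := by
  obtain ⟨F, -, hs, -⟩ := h
  have := LinearMap.finrank_le_finrank_of_surjective (f := (fderiv ℝ F y : E →ₗ[ℝ] (Fin d → ℝ))) hs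
  simpa using this

/-- a preconnected set on which the pattern is constant lies in one cell -/
theorem Strat.sub_cell (s : Strat E) {a : s.c} {T : Set E} (hT : IsPreconnected T) (hTD : T ⊆ s.D)
    (hp : ∀ x ∈ T, ∀ j, j ∈ s.τ a ↔ s.P j x = 0) {w : E} (hw : w ∈ T) (hwa : w ∈ s.S a) : T ⊆ s.S a := by
  intro x hx
  have := preconn_const hT (fun x => x ∈ s.S a) (fun y hy => by
    filter_upwards [s.loc a y (hTD hy) (hp y hy)] with z hz hzT
    exact propext (hz (hp z hzT))) hx hw
  simp only [eq_iff_iff] at this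
  exact this.2 hwa

theorem fin_gen_aux [FiniteDimensional ℝ E] {I : Type} {U : Set E} (hU : U ∈ 𝓝 0) {g : I → E → ℝ}
    (hg : ∀ i, AnalyticOnNhd ℝ (g i) U) (d : ℕ) :
    ∃ (F : Finset I) (s : Strat E), s.D ⊆ U ∧ ∀ a, ∀ w ∈ s.S a, (∀ i ∈ F, g i w = 0) → (∃ i, g i w ≠ 0) →
      d ≤ s.cd a := by
  classical
  induction d with
  | zero =>
    obtain ⟨s, hs, -⟩ := strat_exists (κ := Empty) (fun i (x:E) => (0:ℝ)) (fun i => analyticAt_const) hU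
    exact ⟨∅, s, hs, fun _ _ _ _ _ => Nat.zero_le _⟩
  | succ d ih =>
    obtain ⟨F, s, hsU, hs⟩ := ih
    haveI := s.fc
    haveI := s.fι
    haveI := Fintype.ofFinite s.c
    have hch : ∀ a : s.c, ∃ G : Finset I, (∃ x ∈ s.S a, ∃ i, g i x ≠ 0) → ∃ i ∈ G, ∃ x ∈ s.S a, g i x ≠ 0 := by
      intro a
      by_cases h : ∃ x ∈ s.S a, ∃ i, g i x ≠ 0
      · obtain ⟨x, hx, i, hi⟩ := h
        exact ⟨{i}, fun _ => ⟨i, by simp, x, hx, hi⟩⟩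
      · exact ⟨∅, fun h' => (h h').elim⟩
    choose G hG using hch
    let F' := F ∪ Finset.univ.biUnion G
    let f : s.ι ⊕ F' → E → ℝ := Sum.elim s.P (fun i => g i.1)
    have hf : ∀ i, AnalyticAt ℝ (f i) 0 := by
      rintro (i | i)
      · exact s.an i 0 s.h0
      · exact hg i.1 0 (hsU s.h0)
    obtain ⟨s', hs'D, hs'A⟩ := strat_exists f hf (s.hD.mem_nhds s.h0)
    refine ⟨F', s', hs'D.trans hsU, fun a' w hw hwF hwV => ?_⟩
    have hwD := hs'D (s'.sub _ hw)
    obtain ⟨a, ha⟩ := s.cover w hwD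
    have hpat : ∀ x ∈ s'.S a', ∀ j, j ∈ s.τ a ↔ s.P j x = 0 := by
      intro x hx j
      rw [s.pat a w ha j]
      rcases hs'A (Sum.inl j) a' with h | h
      · exact ⟨fun _ => h x hx, fun _ => h w hw⟩
      · exact ⟨fun h0 => (h w hw h0).elim, fun h0 => (h x hx h0).elim⟩
    have hsub := s.sub_cell (s'.conn a') ((s'.sub a').trans hs'D) hpat hw ha
    obtain ⟨h1, h2⟩ := LS.dim (s'.chart a' w hw) (s.chart a w ha) hw (Eventually.of_forall fun x hx => hsub hx)
    have h3 := hs a w ha (fun i hi => hwF i (Finset.mem_union_left _ hi)) hwV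
    by_contra hlt
    have heq : s.cd a = s'.cd a' := by omega
    have h4 := h2 heq
    obtain ⟨i, hi⟩ := hwV
    obtain ⟨i0, hi0, x, hx, hne⟩ := hG a ⟨w, ha, i, hi⟩
    have hi0F : i0 ∈ F' := Finset.mem_union_right _ (Finset.mem_biUnion.2 ⟨a, Finset.mem_univ _, hi0⟩)
    have h5 : ∀ y ∈ s'.S a', g i0 y = 0 := by
      rcases hs'A (Sum.inr ⟨i0, hi0F⟩) a' with h | h
      · exact h
      · exact (h w hw (hwF i0 hi0F)).elim
    refine hne (ident (s.conn a) (s.chart a) (fun y hy => hg i0 y (hsU (s.sub a hy))) ha ?_ x hx)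
    filter_upwards [h4] with y hy hya using h5 y (hy hya)

theorem fin_gen [FiniteDimensional ℝ E] {I : Type} {U : Set E} (hU : U ∈ 𝓝 0) {g : I → E → ℝ}
    (hg : ∀ i, AnalyticOnNhd ℝ (g i) U) :
    ∃ f : E → ℝ, AnalyticOnNhd ℝ f U ∧ ∀ᶠ x in 𝓝 0, (f x = 0 ↔ ∀ i, g i x = 0) := by
  obtain ⟨F, s, hsU, hs⟩ := fin_gen_aux hU hg (Module.finrank ℝ E + 1)
  refine ⟨fun x => ∑ i ∈ F, g i x ^ 2, ?_, ?_⟩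
  · intro x hx
    exact Finset.analyticAt_fun_sum _ fun i _ => (hg i x hx).pow 2
  · filter_upwards [s.hD.mem_nhds s.h0] with x hx
    rw [Finset.sum_eq_zero_iff_of_nonneg (fun i _ => sq_nonneg _)]
    constructor
    · intro h
      by_contra hcon
      push Not at hcon
      obtain ⟨a, ha⟩ := s.cover x hx
      have h1 := hs a x ha (fun i hi => by simpa using h i hi) hcon
      have h2 := (s.chart a x ha).cd_le
      omega
    · intro h i _; simp [h i]

end
end DF
end Part12

section Part13
open Metric Set Filter Topology
open scoped ContDiff NNReal ENNReal

namespace DF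

/-- complexified coordinates -/
noncomputable def cX {n : ℕ} (p : (Fin n → ℂ) × (Fin n → ℂ)) : Fin n ⊕ Fin n → ℂ :=
  Sum.elim (fun j => (p.1 j + p.2 j) / 2) (fun j => (p.1 j - p.2 j) / (2 * Complex.I))

theorem cX_norm {n : ℕ} (p : (Fin n → ℂ) × (Fin n → ℂ)) : ‖cX p‖ ≤ ‖p‖ := by
  have h1 : ∀ j, ‖p.1 j‖ ≤ ‖p‖ := fun j => (norm_le_pi_norm p.1 j).trans (norm_fst_le p)
  have h2 : ∀ j, ‖p.2 j‖ ≤ ‖p‖ := fun j => (norm_le_pi_norm p.2 j).trans (norm_snd_le p)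
  rw [pi_norm_le_iff_of_nonneg (norm_nonneg _)]
  rintro (j | j)
  · simp only [cX, Sum.elim_inl, norm_div, Complex.norm_ofNat]
    have := norm_add_le (p.1 j) (p.2 j)
    linarith [h1 j, h2 j]
  · simp only [cX, Sum.elim_inr, norm_div, norm_mul, Complex.norm_ofNat, Complex.norm_I, mul_one]
    have := norm_sub_le (p.1 j) (p.2 j)
    linarith [h1 j, h2 j]

theorem cX_an {n : ℕ} (p : (Fin n → ℂ) × (Fin n → ℂ)) : AnalyticAt ℂ (cX (n := n)) p := by
  rw [analyticAt_pi_iff]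
  have h1 : ∀ j, AnalyticAt ℂ (fun p : (Fin n → ℂ) × (Fin n → ℂ) => p.1 j) p := fun j =>
    ((ContinuousLinearMap.proj (R := ℂ) (φ := fun _ : Fin n => ℂ) j).comp
      (ContinuousLinearMap.fst ℂ (Fin n → ℂ) (Fin n → ℂ))).analyticAt p
  have h2 : ∀ j, AnalyticAt ℂ (fun p : (Fin n → ℂ) × (Fin n → ℂ) => p.2 j) p := fun j =>
    ((ContinuousLinearMap.proj (R := ℂ) (φ := fun _ : Fin n => ℂ) j).comp
      (ContinuousLinearMap.snd ℂ (Fin n → ℂ) (Fin n → ℂ))).analyticAt p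
  rintro (j | j)
  · simp only [cX, Sum.elim_inl, div_eq_mul_inv]
    exact ((h1 j).add (h2 j)).mul analyticAt_const
  · simp only [cX, Sum.elim_inr, div_eq_mul_inv]
    exact ((h1 j).sub (h2 j)).mul analyticAt_const

theorem cX_star {n : ℕ} (z x : Fin n → ℂ) : (fun i => star (cX (z, star x) i)) = cX (x, star z) := by
  funext i
  rcases i with j | j
  · simp [cX, add_comm]
  · simp only [cX, Sum.elim_inr, Pi.star_apply, star_div₀, star_sub, star_star, star_mul']
    have : star (2 * Complex.I) = -(2 * Complex.I) := by simp
    rw [← star_mul', this]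
    rw [div_neg, ← neg_div, neg_sub]

theorem cX_real {n : ℕ} (z : Fin n → ℂ) :
    cX (z, star z) = fun i => ((Sum.elim (fun j => (z j).re) (fun j => (z j).im) i : ℝ) : ℂ) := by
  funext i
  rcases i with j | j
  · simp [cX, Complex.add_conj]
  · simp only [cX, Sum.elim_inr, Pi.star_apply]
    have : z j - star (z j) = (z j).im * (2 * Complex.I) := by
      have := Complex.sub_conj (z j)
      rw [show star (z j) = (starRingEnd ℂ) (z j) from rfl, this]; push_cast; ring
    rw [this]; field_simp

theorem cplx {n : ℕ} {f : (Fin n → ℂ) → ℝ} (hf : AnalyticAt ℝ f 0) :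
    ∃ r > 0, ∃ G : (Fin n → ℂ) × (Fin n → ℂ) → ℂ, (∀ p ∈ ball (0 : (Fin n → ℂ) × (Fin n → ℂ)) r, AnalyticAt ℂ G p) ∧
      (∀ z ∈ ball (0 : Fin n → ℂ) r, G (z, star z) = f z) ∧
      (∀ z ∈ ball (0 : Fin n → ℂ) r, ∀ x ∈ ball (0 : Fin n → ℂ) r, star (G (z, star x)) = G (x, star z)) := by
  let e : (Fin n ⊕ Fin n → ℝ) →L[ℝ] (Fin n → ℂ) := ContinuousLinearMap.pi fun j =>
    Complex.ofRealCLM.comp (ContinuousLinearMap.proj (Sum.inl j)) +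
      Complex.I • Complex.ofRealCLM.comp (ContinuousLinearMap.proj (Sum.inr j))
  obtain ⟨c, r, hc, hs⟩ := bc_exists (f := fun x => f (e x)) (AnalyticAt.comp_of_eq hf (e.analyticAt 0) (map_zero e))
  have hstar : ∀ z : Fin n → ℂ, ‖star z‖ = ‖z‖ := fun z => norm_star z
  have hn : ∀ z ∈ ball (0 : Fin n → ℂ) r, ∀ x ∈ ball (0 : Fin n → ℂ) r, ‖cX (z, star x)‖ < r := by
    intro z hz x hx
    refine (cX_norm _).trans_lt ?_
    rw [Prod.norm_def]
    exact max_lt (mem_ball_zero_iff.1 hz) (by rw [hstar]; exact mem_ball_zero_iff.1 hx)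
  refine ⟨r, hc.1, fun p => bcf c (cX p), ?_, ?_, ?_⟩
  · intro p hp
    exact AnalyticAt.comp (g := bcf c) (f := cX)
      (bcf_analyticAt ℂ hc ((cX_norm p).trans_lt (mem_ball_zero_iff.1 hp))) (cX_an p)
  · intro z hz
    set x : Fin n ⊕ Fin n → ℝ := Sum.elim (fun j => (z j).re) (fun j => (z j).im) with hx
    have hxn : ‖x‖ < r := by
      refine lt_of_le_of_lt ?_ (mem_ball_zero_iff.1 hz)
      rw [pi_norm_le_iff_of_nonneg (norm_nonneg _)]
      rintro (j | j)
      · exact (Complex.abs_re_le_norm _).trans (norm_le_pi_norm z j)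
      · exact (Complex.abs_im_le_norm _).trans (norm_le_pi_norm z j)
    have hex : e x = z := by
      funext j
      simp [e, hx, mul_comm Complex.I, Complex.re_add_im]
    have h1 := bcf_rel hc hxn (hn z hz z hz) Complex.ofRealCLM (ContinuousLinearMap.id ℝ ℂ) (by
      intro l
      rw [cX_real]
      simp only [Complex.ofRealCLM_apply, ContinuousLinearMap.id_apply]
      rw [← Complex.ofRealHom_eq_coe, map_list_prod, List.map_map]
      rfl)
    simp only [ContinuousLinearMap.id_apply] at h1
    show bcf c (cX (z, star z)) = _
    rw [← h1, bcf_real hs hxn, hex]; rfl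
  · intro z hz x hx
    have h1 := bcf_rel hc (hn z hz x hx) (hn x hx z hz) (Complex.conjCLE : ℂ →L[ℝ] ℂ) (ContinuousLinearMap.id ℝ ℂ) (by
      intro l
      rw [← cX_star z x]
      simp only [ContinuousLinearMap.id_apply]
      show (starRingEnd ℂ) _ = _
      rw [map_list_prod, List.map_map]
      rfl)
    exact h1

end DF
end Part13

section Part14
open Metric Set Filter Topology
open scoped ContDiff NNReal ENNReal

namespace DF

theorem holo_c1 {E F : Type*} [NormedAddCommGroup E] [NormedSpace ℂ E] [FiniteDimensional ℂ E]
    [NormedAddCommGroup F] [NormedSpace ℂ F] {f : E → F} {U : Set E} (hU : IsOpen U)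
    (hf : DifferentiableOn ℂ f U) {x0 : E} (hx0 : x0 ∈ U) : ContDiffAt ℂ 1 f x0 := by
  haveI : ProperSpace E := FiniteDimensional.proper ℂ E
  rw [contDiffAt_one_iff]
  refine ⟨fderiv ℂ f, U, hU.mem_nhds hx0, ?_, fun x hx => (hf.differentiableAt (hU.mem_nhds hx)).hasFDerivAt⟩
  intro y hy
  refine ContinuousAt.continuousWithinAt ?_
  obtain ⟨ρ, hρ, hb⟩ := Metric.nhds_basis_closedBall.mem_iff.1 (hU.mem_nhds hy)
  have huc := (isCompact_closedBall y ρ).uniformContinuousOn_of_continuous (hf.continuousOn.mono hb)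
  rw [Metric.uniformContinuousOn_iff] at huc
  rw [Metric.continuousAt_iff]
  intro ε hε
  obtain ⟨δ, hδ, h⟩ := huc (ε * ρ / 8) (by positivity)
  refine ⟨min δ (ρ/2), by positivity, fun {x} hx => ?_⟩
  have hx1 : dist x y < δ := hx.trans_le (min_le_left _ _)
  have hx2 : dist x y < ρ / 2 := hx.trans_le (min_le_right _ _)
  have hin : ∀ w ∈ ball y (ρ/2), w + (x - y) ∈ closedBall y ρ ∧ w ∈ closedBall y ρ := by
    intro w hw
    rw [mem_ball] at hw
    constructor
    · rw [mem_closedBall, dist_eq_norm] at *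
      have : w + (x - y) - y = (w - y) + (x - y) := by abel
      rw [this]
      linarith [norm_add_le (w - y) (x - y)]
    · rw [mem_closedBall]; linarith
  let g : E → F := fun w => f (w + (x - y)) - f w
  have hgd : ∀ w ∈ ball y (ρ/2), HasFDerivAt g (fderiv ℂ f (w + (x - y)) - fderiv ℂ f w) w := by
    intro w hw
    have h1 := (hf.differentiableAt (hU.mem_nhds (hb (hin w hw).1))).hasFDerivAt
    have h2 := (hf.differentiableAt (hU.mem_nhds (hb (hin w hw).2))).hasFDerivAt
    have h3 : HasFDerivAt (fun w => f (w + (x - y))) (fderiv ℂ f (w + (x - y))) w := by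
      have := HasFDerivAt.comp (g := f) (f := fun w => w + (x - y)) w h1 ((hasFDerivAt_id w).add_const (x - y))
      exact this
    exact h3.sub h2
  have hgs : ∀ w ∈ ball y (ρ/2), ‖g w‖ ≤ ε * ρ / 8 := by
    intro w hw
    have := h _ (hin w hw).1 _ (hin w hw).2 (by rw [dist_eq_norm, add_sub_cancel_left, ← dist_eq_norm]; exact hx1)
    rw [dist_eq_norm] at this
    exact this.le
  have hyb : y ∈ ball y (ρ/2) := mem_ball_self (by positivity)
  have key := Complex.norm_fderiv_le_div_of_mapsTo_ball (f := g) (c := y) (R₁ := ρ/2) (R₂ := ε * ρ / 4)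
    (fun w hw => (hgd w hw).differentiableAt.differentiableWithinAt) (by
      intro w hw
      rw [mem_closedBall, dist_eq_norm]
      refine (norm_sub_le _ _).trans ?_
      linarith [hgs w hw, hgs y hyb]) (by positivity)
  rw [(hgd y hyb).fderiv] at key
  rw [dist_eq_norm]
  have e1 : y + (x - y) = x := by abel
  rw [e1] at key
  refine key.trans_lt ?_
  rw [div_lt_iff₀ (by positivity)]
  nlinarith

theorem pol {n : ℕ} {K : Type*} [NormedAddCommGroup K] [NormedSpace ℂ K] {φ : K → (Fin n → ℂ)} {δ : ℝ} (hδ : 0 < δ)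
    (hφ : ∀ s ∈ ball (0:K) δ, DifferentiableAt ℂ φ s) {G : (Fin n → ℂ) × (Fin n → ℂ) → ℂ}
    (hG : ∀ s ∈ ball (0:K) δ, ∀ t ∈ ball (0:K) δ, DifferentiableAt ℂ G (φ s, star (φ t)))
    (h0 : ∀ s ∈ ball (0:K) δ, G (φ s, star (φ s)) = 0) {s t : K} (hs : ‖s‖ < δ/4) (ht : ‖t‖ < δ/4) :
    G (φ s, star (φ t)) = 0 := by
  let a : K := (2:ℂ)⁻¹ • (s + t)
  let b : K := (2 * Complex.I)⁻¹ • (s - t)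
  have ha : ‖a‖ < δ/4 := by
    have := norm_add_le s t
    simp only [a, norm_smul, norm_inv, Complex.norm_ofNat]
    linarith
  have hb : ‖b‖ < δ/4 := by
    have := norm_sub_le s t
    simp only [b, norm_smul, norm_inv, norm_mul, Complex.norm_ofNat, Complex.norm_I, mul_one]
    linarith
  have hin : ∀ ζ ∈ ball (0:ℂ) 2, a + ζ • b ∈ ball (0:K) δ := by
    intro ζ hζ
    rw [mem_ball_zero_iff] at *
    have h1 := norm_add_le a (ζ • b)
    rw [norm_smul ζ b] at h1
    have h2 : ‖ζ‖ * ‖b‖ ≤ 2 * (δ/4) := mul_le_mul hζ.le hb.le (norm_nonneg _) (by norm_num)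
    linarith
  have hst : ∀ ζ ∈ ball (0:ℂ) 2, star ζ ∈ ball (0:ℂ) 2 := by
    intro ζ hζ; rw [mem_ball_zero_iff] at *; rwa [norm_star]
  let H : ℂ → ℂ := fun ζ => G (φ (a + ζ • b), star (φ (a + star ζ • b)))
  have hl : ∀ ζ ∈ ball (0:ℂ) 2, DifferentiableAt ℂ (fun ζ : ℂ => φ (a + ζ • b)) ζ := by
    intro ζ hζ
    exact DifferentiableAt.comp (g := φ) (f := fun ζ : ℂ => a + ζ • b) ζ (hφ _ (hin ζ hζ)) (by fun_prop)
  have hH : DifferentiableOn ℂ H (ball 0 2) := by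
    intro ζ hζ
    refine DifferentiableAt.differentiableWithinAt ?_
    refine DifferentiableAt.comp (g := G) (f := fun ζ : ℂ => (φ (a + ζ • b), star (φ (a + star ζ • b)))) ζ
      (hG _ (hin ζ hζ) _ (hin _ (hst ζ hζ))) (DifferentiableAt.prodMk (hl ζ hζ) ?_)
    rw [differentiableAt_pi]
    intro j
    have h1 : DifferentiableAt ℂ (fun ζ : ℂ => φ (a + ζ • b) j) (star ζ) :=
      differentiableAt_pi.1 (hl _ (hst ζ hζ)) j
    have h2 := h1.conj_conj
    rw [show (starRingEnd ℂ) (star ζ) = ζ from star_star ζ] at h2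
    exact h2
  have hHa : AnalyticOnNhd ℂ H (ball 0 2) := hH.analyticOnNhd isOpen_ball
  have hreal : ∀ x : ℝ, |x| < 2 → H x = 0 := by
    intro x hx
    have h1 : star (x:ℂ) = x := Complex.conj_ofReal x
    simp only [H, h1]
    exact h0 _ (hin _ (by rw [mem_ball_zero_iff]; simpa using hx))
  have hfr : ∃ᶠ ζ in 𝓝[≠] (0:ℂ), H ζ = 0 := by
    rw [frequently_nhdsWithin_iff, Metric.nhds_basis_ball.frequently_iff]
    intro ε hε
    have hm : 0 < min (ε/2) 1 := by positivity
    refine ⟨((min (ε/2) 1 : ℝ) : ℂ), ?_, ?_, ?_⟩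
    · rw [mem_ball_zero_iff, Complex.norm_real, Real.norm_of_nonneg hm.le]
      have := min_le_left (ε/2) 1
      linarith
    · refine hreal _ ?_
      rw [abs_of_pos hm]
      have := min_le_right (ε/2) 1
      linarith
    · simpa using hm.ne'
  have := hHa.eqOn_zero_of_preconnected_of_frequently_eq_zero (convex_ball _ _).isPreconnected
    (mem_ball_self (by norm_num)) hfr (x := Complex.I) (by simp)
  have e1 : a + Complex.I • b = s := by
    simp only [a, b, smul_smul]
    rw [show Complex.I * (2 * Complex.I)⁻¹ = (2:ℂ)⁻¹ by field_simp, ← smul_add]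
    rw [show s + t + (s - t) = (2:ℂ) • s by rw [two_smul]; abel, smul_smul]; simp
  have e2 : a + star Complex.I • b = t := by
    simp only [a, b, smul_smul]
    rw [show star Complex.I * (2 * Complex.I)⁻¹ = -(2:ℂ)⁻¹ by
      rw [show star Complex.I = - Complex.I from Complex.conj_I]; field_simp]
    rw [neg_smul, ← sub_eq_add_neg, ← smul_sub]
    rw [show s + t - (s - t) = (2:ℂ) • t by rw [two_smul]; abel, smul_smul]; simp
  simp only [H, e1, e2] at this
  exact this

end DF
end Part14

section Part15
open Metric Set Filter Topology
open scoped ContDiff NNReal ENNReal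

namespace DF

theorem surj_open {E G : Type*} [NormedAddCommGroup E] [NormedSpace ℝ E] 
    [NormedAddCommGroup G] [NormedSpace ℝ G] [FiniteDimensional ℝ G] {F : E → G} {y : E}
    (hF : AnalyticAt ℝ F y) (hs : Function.Surjective (fderiv ℝ F y)) :
    ∀ᶠ x in 𝓝 y, Function.Surjective (fderiv ℝ F x) := by
  haveI : CompleteSpace G := FiniteDimensional.complete ℝ G
  obtain ⟨R0, hR0⟩ := (fderiv ℝ F y : E →ₗ[ℝ] G).exists_rightInverse_of_surjective (LinearMap.range_eq_top.2 hs)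
  let R : G →L[ℝ] E := LinearMap.toContinuousLinearMap R0
  have hR : (fderiv ℝ F y).comp R = ContinuousLinearMap.id ℝ G := by
    ext v
    exact LinearMap.congr_fun hR0 v
  have hc : ContinuousAt (fun x => (fderiv ℝ F x).comp R) y :=
    (hF.fderiv.continuousAt).clm_comp continuousAt_const
  have hop : {T : G →L[ℝ] G | IsUnit T} ∈ 𝓝 ((fderiv ℝ F y).comp R) := by
    refine Units.isOpen.mem_nhds ?_
    rw [hR]
    exact isUnit_one
  filter_upwards [hc hop] with x hx
  have hx' : IsUnit ((fderiv ℝ F x).comp R) := hx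
  obtain ⟨u, hu⟩ := hx'
  intro v
  refine ⟨R ((↑u⁻¹ : G →L[ℝ] G) v), ?_⟩
  have h1 : ((u : G →L[ℝ] G) * (↑u⁻¹ : G →L[ℝ] G)) v = v := by rw [Units.mul_inv]; rfl
  rw [hu] at h1
  exact h1

theorem LS.smooth {n d k : ℕ} {S V : Set (Fin n → ℂ)} {y : Fin n → ℂ} (h : LS d S y) (hk : 2 * n - k = d)
    (hV : ∀ᶠ x in 𝓝 y, (x ∈ V ↔ x ∈ S)) : IsSmoothPtOfDim n V k y := by
  subst hk
  obtain ⟨F, hF, hs, hS⟩ := h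
  have hall := (surj_open hF hs).and (hF.eventually_analyticAt.and (hS.and hV))
  obtain ⟨U, hU, hUo, hyU⟩ := _root_.eventually_nhds_iff.1 hall
  refine ⟨U, hUo, hyU, F, fun x hx => ((hU x hx).2.1.contDiffAt).contDiffWithinAt, fun x hx => (hU x hx).1, ?_⟩
  ext x
  constructor
  · rintro ⟨hxV, hx⟩; exact ⟨hx, (hU x hx).2.2.1.1 ((hU x hx).2.2.2.1 hxV)⟩
  · rintro ⟨hx, hx0⟩; exact ⟨(hU x hx).2.2.2.2 ((hU x hx).2.2.1.2 hx0), hx⟩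

/-- analytic closure of `A` in `D` -/
def Zc {n : ℕ} (D A : Set (Fin n → ℂ)) : Set (Fin n → ℂ) :=
  {x ∈ D | ∀ h : (Fin n → ℂ) → ℝ, AnalyticOnNhd ℝ h D → (∀ y ∈ A, h y = 0) → h x = 0}

theorem Zc_an {n : ℕ} (D A : Set (Fin n → ℂ)) : IsRealAnalyticSetIn n (Zc D A) D := by
  refine ⟨{h : (Fin n → ℂ) → ℝ // AnalyticOnNhd ℝ h D ∧ ∀ y ∈ A, h y = 0}, fun h => h.1, fun h => h.2.1, ?_⟩
  ext x
  constructor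
  · rintro ⟨hx, h⟩; exact ⟨hx, fun i => h i.1 i.2.1 i.2.2⟩
  · rintro ⟨hx, h⟩; exact ⟨hx, fun i h1 h2 => h ⟨i, h1, h2⟩⟩

theorem Zc_union {n : ℕ} (D A B : Set (Fin n → ℂ)) : Zc D (A ∪ B) ⊆ Zc D A ∪ Zc D B := by
  rintro x ⟨hx, h⟩
  by_contra hcon
  rw [mem_union, not_or] at hcon
  obtain ⟨h1, h2⟩ := hcon
  simp only [Zc, mem_setOf_eq, not_and, not_forall] at h1 h2
  obtain ⟨p, hp, hpA, hpx⟩ := h1 hx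
  obtain ⟨q, hq, hqB, hqx⟩ := h2 hx
  have := h (fun x => p x * q x) (fun x hx => (hp x hx).mul (hq x hx)) (by
    rintro y (hy | hy)
    · simp [hpA y hy]
    · simp [hqB y hy])
  rcases mul_eq_zero.1 this with h | h
  · exact hpx h
  · exact hqx h

theorem irr_step {n : ℕ} {V D A B : Set (Fin n → ℂ)} (hirr : IrreducibleGermAt0 n V) (hD : IsOpen D)
    (h0 : (0 : Fin n → ℂ) ∈ D) (hA : Zc D A ⊆ V) (hB : Zc D B ⊆ V) {t : Set (Fin n → ℂ)} (ht : t ∈ 𝓝 (0 : Fin n → ℂ))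
    (hV : V ∩ t ⊆ Zc D (A ∪ B)) :
    (∃ t ∈ 𝓝 (0 : Fin n → ℂ), V ∩ t ⊆ Zc D A) ∨ (∃ t ∈ 𝓝 (0 : Fin n → ℂ), V ∩ t ⊆ Zc D B) := by
  by_contra hcon
  rw [not_or] at hcon
  refine hirr ⟨Zc D A, D, Zc D B, D, hD, h0, Zc_an D A, hD, h0, Zc_an D B, ⟨t, ht, ?_⟩,
    ⟨⟨univ, univ_mem, by simpa using hA⟩, fun ⟨t', ht', h⟩ => hcon.1 ⟨t', ht', h ▸ inter_subset_left⟩⟩,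
    ⟨⟨univ, univ_mem, by simpa using hB⟩, fun ⟨t', ht', h⟩ => hcon.2 ⟨t', ht', h ▸ inter_subset_left⟩⟩⟩
  ext x
  constructor
  · rintro ⟨hx, hxt⟩; exact ⟨Zc_union D A B (hV ⟨hx, hxt⟩), hxt⟩
  · rintro ⟨hx | hx, hxt⟩
    · exact ⟨hA hx, hxt⟩
    · exact ⟨hB hx, hxt⟩

theorem irr_fin {n : ℕ} {V D : Set (Fin n → ℂ)} (hirr : IrreducibleGermAt0 n V) (hD : IsOpen D)
    (h0 : (0 : Fin n → ℂ) ∈ D) (h0V : (0 : Fin n → ℂ) ∈ V) {c : Type*} (S : c → Set (Fin n → ℂ))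
    {f : (Fin n → ℂ) → ℝ} (hf : AnalyticOnNhd ℝ f D) (hfV : ∀ x ∈ D, f x = 0 → x ∈ V) (T : Finset c)
    (hT : ∀ a ∈ T, ∀ x ∈ S a, f x = 0)
    (hV : ∃ t ∈ 𝓝 (0 : Fin n → ℂ), V ∩ t ⊆ Zc D (⋃ a ∈ T, S a)) :
    ∃ a ∈ T, ∃ t ∈ 𝓝 (0 : Fin n → ℂ), V ∩ t ⊆ Zc D (S a) := by
  classical
  have hZ : ∀ A : Set (Fin n → ℂ), (∀ x ∈ A, f x = 0) → Zc D A ⊆ V := fun A hA x hx => hfV x hx.1 (hx.2 f hf hA)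
  induction T using Finset.induction_on with
  | empty =>
    obtain ⟨t, ht, h⟩ := hV
    have := (h ⟨h0V, mem_of_mem_nhds ht⟩).2 (fun _ => 1) (fun _ _ => analyticAt_const) (by simp)
    simp at this
  | insert a T ha ih =>
    obtain ⟨t, ht, h⟩ := hV
    rw [Finset.set_biUnion_insert] at h
    rcases irr_step hirr hD h0 (hZ _ (hT a (Finset.mem_insert_self _ _))) (hZ _ (by
        intro x hx
        simp only [mem_iUnion] at hx
        obtain ⟨b, hb, hx⟩ := hx
        exact hT b (Finset.mem_insert_of_mem hb) x hx)) ht h with h | h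
    · exact ⟨a, Finset.mem_insert_self _ _, h⟩
    · obtain ⟨b, hb, h⟩ := ih (fun b hb => hT b (Finset.mem_insert_of_mem hb)) h
      exact ⟨b, Finset.mem_insert_of_mem hb, h⟩

end DF
end Part15

section Part16
open Metric Set Filter Topology
open scoped ContDiff NNReal ENNReal

namespace DF

theorem polS {n m : ℕ} {S : Set (Fin n → ℂ)} {y : Fin n → ℂ} (hy : y ∈ S) {U : Set (Fin n → ℂ)} (hU : IsOpen U)
    (hyU : y ∈ U) {F : (Fin n → ℂ) → (Fin m → ℂ)} (hF : DifferentiableOn ℂ F U)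
    (hs : Function.Surjective (fderiv ℂ F y)) (hSF : ∀ᶠ x in 𝓝 y, (x ∈ S ↔ F x = 0)) {r : ℝ}
    {G : (Fin n → ℂ) × (Fin n → ℂ) → ℂ} (hG : ∀ p ∈ ball (0 : (Fin n → ℂ) × (Fin n → ℂ)) r, AnalyticAt ℂ G p)
    (hS : S ⊆ ball 0 r) (hGS : ∀ z ∈ S, G (z, star z) = 0) :
    ∃ B ∈ 𝓝 y, ∀ z ∈ S ∩ B, ∀ x ∈ S ∩ B, G (z, star x) = 0 := by
  obtain ⟨φ, π, p, hp, hπ, hφ, hφ0, h1, h2⟩ := param (𝕜 := ℂ) (n := 1) one_ne_zero (holo_c1 hU hF hyU) hs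
  have hFy : F y = 0 := hSF.self_of_nhds.1 hy
  have hφc : Tendsto φ (𝓝 0) (𝓝 y) := by
    have := hφ.continuousAt; rwa [ContinuousAt, hφ0] at this
  have hφd : ∀ᶠ s in 𝓝 0, DifferentiableAt ℂ φ s := by
    filter_upwards [hφ.eventually (by simp)] with s hs using hs.differentiableAt one_ne_zero
  have hφS : ∀ᶠ s in 𝓝 0, φ s ∈ S := by
    filter_upwards [hφc.eventually hSF, h2] with s hs1 hs2
    exact hs1.2 (hs2.1.trans hFy)
  obtain ⟨δ, hδ, hall⟩ := Metric.eventually_nhds_iff_ball.1 (hφd.and hφS)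
  have key := fun s t => pol (s := s) (t := t) hδ (fun s hs => (hall s hs).1) (G := G) (fun s hs t ht =>
      (hG _ (by
        have e1 := mem_ball_zero_iff.1 (hS (hall s hs).2)
        have e2 := mem_ball_zero_iff.1 (hS (hall t ht).2)
        rw [mem_ball_zero_iff, Prod.norm_def]
        exact max_lt e1 (by rw [norm_star]; exact e2))).differentiableAt)
    (fun s hs => hGS _ (hall s hs).2)
  have hπc : Tendsto π (𝓝 y) (𝓝 0) := by
    have : Continuous π := by
      have e : π = fun x => p (x - y) := funext hπ
      rw [e]; fun_prop
    have h := this.tendsto y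
    rwa [hπ y, sub_self, map_zero] at h
  have hB : ∀ᶠ z in 𝓝 y, ‖π z‖ < δ/4 ∧ (F z = F y → φ (π z) = z) ∧ (z ∈ S ↔ F z = 0) := by
    have := hπc.eventually (ball_mem_nhds 0 (show 0 < δ/4 by positivity))
    filter_upwards [this, h1, hSF] with z hz1 hz2 hz3
    exact ⟨mem_ball_zero_iff.1 hz1, hz2, hz3⟩
  refine ⟨_, hB, ?_⟩
  rintro z ⟨hzS, hz1, hz2, hz3⟩ x ⟨hxS, hx1, hx2, hx3⟩
  have := key _ _ hz1 hx1
  rwa [hz2 ((hz3.1 hzS).trans hFy.symm), hx2 ((hx3.1 hxS).trans hFy.symm)] at this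

theorem re_an {n : ℕ} {h : (Fin n → ℂ) → ℂ} {x : Fin n → ℂ} (hh : AnalyticAt ℂ h x) :
    AnalyticAt ℝ (fun x => (h x).re) x := 
  AnalyticAt.comp (g := Complex.reCLM) (Complex.reCLM.analyticAt _) (hh.restrictScalars (𝕜 := ℝ))

theorem im_an {n : ℕ} {h : (Fin n → ℂ) → ℂ} {x : Fin n → ℂ} (hh : AnalyticAt ℂ h x) :
    AnalyticAt ℝ (fun x => (h x).im) x := 
  AnalyticAt.comp (g := Complex.imCLM) (Complex.imCLM.analyticAt _) (hh.restrictScalars (𝕜 := ℝ))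

theorem identC {n : ℕ} (s : Strat (Fin n → ℂ)) (a : s.c) {h : (Fin n → ℂ) → ℂ} (hh : AnalyticOnNhd ℂ h s.D)
    {y : Fin n → ℂ} (hy : y ∈ s.S a) (h0 : ∀ᶠ x in 𝓝 y, x ∈ s.S a → h x = 0) : ∀ x ∈ s.S a, h x = 0 := by
  intro x hx
  apply Complex.ext
  · refine ident (s.conn a) (s.chart a) (g := fun x => (h x).re) (fun z hz => re_an (hh z (s.sub a hz))) hy ?_ x hx
    filter_upwards [h0] with z hz hzS
    simp [hz hzS]
  · refine ident (s.conn a) (s.chart a) (g := fun x => (h x).im) (fun z hz => im_an (hh z (s.sub a hz))) hy ?_ x hx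
    filter_upwards [h0] with z hz hzS
    simp [hz hzS]

theorem main (n k : ℕ) (U : Set (Fin n → ℂ)) (hU : IsOpen U)
    (hU0 : (0 : Fin n → ℂ) ∈ U)
    (V : Set (Fin n → ℂ)) (hV : IsRealAnalyticSetIn n V U)
    (h0V : (0 : Fin n → ℂ) ∈ V)
    (hirr : IrreducibleGermAt0 n V)
    (hdim_le : ∀ x ∈ V, ∀ d : ℕ, IsSmoothPtOfDim n V d x → d ≤ k)
    (hdim : ∀ t ∈ nhds (0 : Fin n → ℂ), ∃ x ∈ V ∩ t, IsSmoothPtOfDim n V k x)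
    (hcx : ∀ x ∈ {y ∈ V | IsSmoothPtOfDim n V k y},
      IsComplexSubmanifoldPt n {y ∈ V | IsSmoothPtOfDim n V k y} x) :
    ∃ W : Set (Fin n → ℂ), IsOpen W ∧ (0 : Fin n → ℂ) ∈ W ∧
      ∃ (ι : Type) (g : ι → (Fin n → ℂ) → ℂ),
        (∀ i, DifferentiableOn ℂ (g i) W) ∧
        V ∩ W = {y ∈ W | ∀ i, g i y = 0} := by
  classical
  obtain ⟨I, g, hg, hVe⟩ := hV
  obtain ⟨f, hf, hfg⟩ := fin_gen (hU.mem_nhds hU0) hg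
  obtain ⟨r, hr, G, hG, hGf, hGs⟩ := cplx (hf 0 hU0)
  obtain ⟨s, hsD, hsA⟩ := strat_exists (κ := Unit) (fun _ => f) (fun _ => hf 0 hU0)
    (inter_mem (inter_mem (hU.mem_nhds hU0) hfg) (ball_mem_nhds 0 hr))
  have hsA := hsA ()
  have hVf : ∀ x ∈ s.D, (x ∈ V ↔ f x = 0) := by
    intro x hx
    have h1 : f x = 0 ↔ ∀ i, g i x = 0 := (hsD hx).1.2
    rw [h1, hVe]
    exact ⟨fun h => h.2, fun h => ⟨(hsD hx).1.1, h⟩⟩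
  have hDr : s.D ⊆ ball 0 r := fun x hx => (hsD hx).2
  have hfD : AnalyticOnNhd ℝ f s.D := fun x hx => hf x (hsD hx).1.1
  haveI := s.fc
  haveI := Fintype.ofFinite s.c
  -- cells whose closure contains the origin
  let T : Finset s.c := Finset.univ.filter fun a => (∀ x ∈ s.S a, f x = 0) ∧ (0 : Fin n → ℂ) ∈ closure (s.S a)
  have hnear : ∀ᶠ x in 𝓝 (0 : Fin n → ℂ), x ∈ s.D ∧ ∀ a, x ∈ s.S a → (0 : Fin n → ℂ) ∈ closure (s.S a) := by
    refine Filter.Eventually.and (s.hD.mem_nhds s.h0) (eventually_all.2 fun a => ?_)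
    by_cases h : (0 : Fin n → ℂ) ∈ closure (s.S a)
    · exact Eventually.of_forall fun _ _ => h
    · filter_upwards [isClosed_closure.isOpen_compl.mem_nhds h] with x hx hxa
      exact (hx (subset_closure hxa)).elim
  obtain ⟨a, haT, t, ht, hVt⟩ := irr_fin hirr s.hD s.h0 h0V s.S hfD (fun x hx h => (hVf x hx).2 h) T
    (fun a ha => (Finset.mem_filter.1 ha).2.1) ⟨_, hnear, by
      rintro x ⟨hxV, hxD, hx⟩
      refine ⟨hxD, fun h _ hh => hh x ?_⟩
      obtain ⟨a, ha⟩ := s.cover x hxD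
      simp only [mem_iUnion]
      refine ⟨a, Finset.mem_filter.2 ⟨Finset.mem_univ _, ?_, hx a ha⟩, ha⟩
      rcases hsA a with h | h
      · exact h
      · exact (h x ha ((hVf x hxD).1 hxV)).elim⟩
  obtain ⟨haf, ha0⟩ := (Finset.mem_filter.1 haT).2
  let W : Set (Fin n → ℂ) := interior t ∩ s.D
  have hWo : IsOpen W := isOpen_interior.inter s.hD
  have h0W : (0 : Fin n → ℂ) ∈ W := ⟨mem_interior_iff_mem_nhds.2 ht, s.h0⟩
  have hWD : W ⊆ s.D := inter_subset_right
  have hVW : ∀ x ∈ V, x ∈ W → x ∈ Zc s.D (s.S a) := fun x hx hxW => hVt ⟨hx, interior_subset hxW.1⟩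
  have hVτ : ∀ x ∈ V, x ∈ W → ∀ j ∈ s.τ a, s.P j x = 0 := fun x hx hxW j hj =>
    (hVW x hx hxW).2 (s.P j) (s.an j) (fun y hy => (s.pat a y hy j).1 hj)
  have hSV : ∀ x ∈ s.S a, x ∈ V := fun x hx => (hVf x (s.sub a hx)).2 (haf x hx)
  have hVS : ∀ y ∈ s.S a, y ∈ W → ∀ᶠ x in 𝓝 y, (x ∈ V ↔ x ∈ s.S a) := by
    intro y hy hyW
    filter_upwards [s.loc' hy, hWo.mem_nhds hyW] with x hx hxW
    exact ⟨fun h => hx (hVτ x h hxW), hSV x⟩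
  obtain ⟨y, hyW, hy⟩ := mem_closure_iff_nhds.1 ha0 W (hWo.mem_nhds h0W)
  -- dimension of the cell
  have hcd1 : 2 * n - k ≤ s.cd a := by
    have hle := (s.chart a y hy).cd_le
    have hfr : Module.finrank ℝ (Fin n → ℂ) = 2 * n := by
      rw [Module.finrank_pi_fintype]; simp [Complex.finrank_real_complex, mul_comm]
    rw [hfr] at hle
    have := hdim_le y (hSV y hy) (2 * n - s.cd a) ((s.chart a y hy).smooth (by omega) (hVS y hy hyW))
    omega
  have hcd2 : s.cd a ≤ 2 * n - k := by
    obtain ⟨x, ⟨hxV, hxW⟩, U', hU'o, hxU', F, hFc, hFs, hFV⟩ := hdim W (hWo.mem_nhds h0W)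
    haveI := s.fι
    let Q : Set s.c := {b | ∃ x ∈ s.S b, x ∈ V ∧ x ∈ W ∧ x ∈ U'}
    have hQ : Q.Nonempty := by
      obtain ⟨b, hb⟩ := s.cover x (hWD hxW)
      exact ⟨b, x, hb, hxV, hxW, hxU'⟩
    obtain ⟨b, ⟨x1, hx1b, hx1V, hx1W, hx1U⟩, hmin⟩ := (Set.toFinite Q).exists_minimalFor (fun b => (s.τ b).ncard) Q hQ
    have hloc : ∀ᶠ x2 in 𝓝 x1, x2 ∈ V → x2 ∈ s.S b := by
      have hτ : ∀ᶠ x2 in 𝓝 x1, ∀ j, s.P j x2 = 0 → j ∈ s.τ b := by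
        rw [eventually_all]
        intro j
        by_cases hj : j ∈ s.τ b
        · exact Eventually.of_forall fun _ _ => hj
        · have : s.P j x1 ≠ 0 := fun h => hj ((s.pat b x1 hx1b j).2 h)
          filter_upwards [(s.an j x1 (hWD hx1W)).continuousAt.eventually_ne this] with x2 h2 h3
          exact (h2 h3).elim
      filter_upwards [hτ, s.loc' hx1b, hWo.mem_nhds hx1W, hU'o.mem_nhds hx1U] with x2 h2 h3 h4 h5 h6
      obtain ⟨b', hb'⟩ := s.cover x2 (hWD h4)
      have hsub : s.τ b' ⊆ s.τ b := fun j hj => h2 j ((s.pat b' x2 hb' j).1 hj)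
      have hle : (s.τ b').ncard ≤ (s.τ b).ncard := Set.ncard_le_ncard hsub
      have hge : (s.τ b).ncard ≤ (s.τ b').ncard := hmin (j := b') ⟨x2, hb', h6, h4, h5⟩ hle
      have heq : s.τ b' = s.τ b := Set.eq_of_subset_of_ncard_le hsub hge
      refine h3 fun j hj => ?_
      rw [← heq] at hj
      exact (s.pat b' x2 hb' j).1 hj
    obtain ⟨F1, hF1, hs1, hS1⟩ := s.chart b x1 hx1b
    have hVF : ∀ z ∈ U', (z ∈ V ↔ F z = 0) := by
      intro z hz
      have : z ∈ V ∩ U' ↔ z ∈ {y ∈ U' | F y = 0} := by rw [hFV]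
      exact ⟨fun h => (this.1 ⟨h, hz⟩).2, fun h => (this.2 ⟨hz, h⟩).1⟩
    have hdl := (dim_lemma (F := F) (F' := F1) (y := x1)
      (((hFc.contDiffAt (hU'o.mem_nhds hx1U))).of_le (by exact_mod_cast le_top)) (hFs x1 hx1U)
      hF1.contDiffAt hs1 ((hVF x1 hx1U).1 hx1V) (hS1.self_of_nhds.1 hx1b) (by
        filter_upwards [hU'o.mem_nhds hx1U, hS1, hloc] with z hz1 hz2 hz3 hz4
        exact hz2.1 (hz3 ((hVF z hz1).2 hz4)))).1
    simp only [Module.finrank_fin_fun] at hdl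
    have hm := s.mono a b (fun j hj => (s.pat b x1 hx1b j).2 (hVτ x1 hx1V hx1W j hj))
    omega
  have hsm : ∀ z ∈ s.S a, z ∈ W → IsSmoothPtOfDim n V k z := fun z hz hzW =>
    (s.chart a z hz).smooth (by omega) (hVS z hz hzW)
  obtain ⟨U1, hU1o, hyU1, m, F, hFd, hFs, hFV⟩ := hcx y ⟨hSV y hy, hsm y hy hyW⟩
  have hSF : ∀ᶠ x in 𝓝 y, (x ∈ s.S a ↔ F x = 0) := by
    filter_upwards [hU1o.mem_nhds hyU1, hVS y hy hyW, hWo.mem_nhds hyW] with x hx1 hx2 hx3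
    have : x ∈ {y ∈ V | IsSmoothPtOfDim n V k y} ∩ U1 ↔ x ∈ {y ∈ U1 | F y = 0} := by rw [hFV]
    constructor
    · intro h; exact (this.1 ⟨⟨hSV x h, hsm x h hx3⟩, hx1⟩).2
    · intro h; exact hx2.1 (this.2 ⟨hx1, h⟩).1.1
  have hSr : s.S a ⊆ ball 0 r := (s.sub a).trans hDr
  obtain ⟨B, hB, hGB⟩ := polS hy hU1o hyU1 hFd (hFs y hyU1) hSF hG hSr (fun z hz => by
    rw [hGf z (hSr hz), haf z hz]; rfl)
  have hGa : ∀ x ∈ ball (0 : Fin n → ℂ) r, AnalyticOnNhd ℂ (fun z => G (z, star x)) s.D := by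
    intro x hx z hz
    refine AnalyticAt.comp (g := G) (f := fun z => (z, star x)) (hG _ ?_) (analyticAt_id.prod analyticAt_const)
    rw [mem_ball_zero_iff, Prod.norm_def]
    exact max_lt (mem_ball_zero_iff.1 (hDr hz)) (by rw [norm_star]; exact mem_ball_zero_iff.1 hx)
  refine ⟨W, hWo, h0W, {h : (Fin n → ℂ) → ℂ // AnalyticOnNhd ℂ h s.D ∧ ∀ x ∈ s.S a, h x = 0}, fun h => h.1,
    fun h x hx => (h.2.1 x (hWD hx)).differentiableAt.differentiableWithinAt, ?_⟩
  ext z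
  constructor
  · rintro ⟨hzV, hzW⟩
    refine ⟨hzW, fun h => ?_⟩
    have hz := (hVW z hzV hzW).2
    apply Complex.ext
    · exact hz (fun x => (h.1 x).re) (fun x hx => re_an (h.2.1 x hx)) (fun x hx => by simp [h.2.2 x hx])
    · exact hz (fun x => (h.1 x).im) (fun x hx => im_an (h.2.1 x hx)) (fun x hx => by simp [h.2.2 x hx])
  · rintro ⟨hzW, hz⟩
    refine ⟨?_, hzW⟩
    have hzD := hWD hzW
    have h1 : ∀ x ∈ s.S a ∩ B, G (z, star x) = 0 := by
      intro x hx
      refine hz ⟨fun z => G (z, star x), hGa x (hSr hx.1), identC s a (hGa x (hSr hx.1)) hy ?_⟩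
      filter_upwards [hB] with w hw hwS
      exact hGB w ⟨hwS, hw⟩ x hx
    have h2 : ∀ x ∈ s.S a ∩ B, G (x, star z) = 0 := by
      intro x hx
      rw [← hGs z (hDr hzD) x (hSr hx.1), h1 x hx, star_zero]
    have h3 := hz ⟨fun w => G (w, star z), hGa z (hDr hzD), identC s a (hGa z (hDr hzD)) hy (by
      filter_upwards [hB] with w hw hwS
      exact h2 w ⟨hwS, hw⟩)⟩
    have h4 : G (z, star z) = 0 := h3
    rw [hGf z (hDr hzD)] at h4
    exact (hVf z hzD).2 (by exact_mod_cast h4)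

end DF
end Part16

noncomputable section

/-- **Lemma 3.4 (df).**  Let `V₀` be an irreducible germ of real analytic set at
`0 ∈ ℂⁿ` of dimension `k`, represented by a closed real analytic set `V` of
dimension `k` in an open neighborhood `U` of `0`.  Let `V*` be the set of points
of `V` near which `V` is a smooth submanifold of dimension `k`.  If `V*` is a
complex submanifold of `ℂⁿ`, then `V` is a complex variety at `0`: near `0`, `V`
is the common zero set of a family of holomorphic functions. -/
theorem lemma_df (n k : ℕ) (U : Set (Fin n → ℂ)) (hU : IsOpen U)
    (hU0 : (0 : Fin n → ℂ) ∈ U)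
    (V : Set (Fin n → ℂ)) (hV : IsRealAnalyticSetIn n V U)
    (h0V : (0 : Fin n → ℂ) ∈ V)
    (hirr : IrreducibleGermAt0 n V)
    (hdim_le : ∀ x ∈ V, ∀ d : ℕ, IsSmoothPtOfDim n V d x → d ≤ k)
    (hdim : ∀ t ∈ nhds (0 : Fin n → ℂ), ∃ x ∈ V ∩ t, IsSmoothPtOfDim n V k x)
    (hcx : ∀ x ∈ {y ∈ V | IsSmoothPtOfDim n V k y},
      IsComplexSubmanifoldPt n {y ∈ V | IsSmoothPtOfDim n V k y} x) :
    ∃ W : Set (Fin n → ℂ), IsOpen W ∧ (0 : Fin n → ℂ) ∈ W ∧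
      ∃ (ι : Type) (g : ι → (Fin n → ℂ) → ℂ),
        (∀ i, DifferentiableOn ℂ (g i) W) ∧
        V ∩ W = {y ∈ W | ∀ i, g i y = 0} := by
  exact DF.main n k U hU hU0 V hV h0V hirr hdim_le hdim hcx

end
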